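/- Let f be a Boolean function in the Reed–Muller code RM(r,v) whose weight w satisfies 2·2^{v−r} < w < 2.5·2^{v−r}. Then w has one of the following forms: (2) 2·2^{v−r} + 2·2^{v−r−l} with 2 ≤ l ≤ (v−r+2)/2; (3) 2.5·2^{v−r} − 2·2^i with 0 ≤ i ≤ v−r−3; (4) 2.5·2^{v−r} − 6·2^i with 0 ≤ i ≤ v−r−4. -/

import Mathlib

/-- The Reed–Muller code `RM(r,v)`: Boolean functions representable by a
polynomial over `F_2` of total degree at most `r`. -/
def RM (r v : ℕ) (f : (Fin v → ZMod 2) → ZMod 2) : Prop :=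
  ∃ P : MvPolynomial (Fin v) (ZMod 2),
    P.totalDegree ≤ r ∧ ∀ x, MvPolynomial.eval x P = f x

/-- The weight of a Boolean function: its number of ones. -/
def weight {v : ℕ} (f : (Fin v → ZMod 2) → ZMod 2) : ℕ :=
  (Finset.univ.filter (fun x => f x = 1)).card


set_option linter.all false
namespace KTA
section
local notation "Zt" => ZMod 2
local notation "Sb" => Submodule (ZMod 2)
local notation "nc" => Nat.card
variable {V : Type} [AddCommGroup V] [Module Zt V]
lemma z01 (a : Zt) : a = 0 ∨ a = 1 := by revert a; decide
lemma zne {a : Zt} : a ≠ 0 ↔ a = 1 := by revert a; decide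
lemma zne1 {a : Zt} : a ≠ 1 ↔ a = 0 := by revert a; decide
lemma zadd {a b : Zt} : a + b = 0 ↔ a = b := by revert a b; decide
lemma zadd1 {a b : Zt} : a + b = 1 ↔ a = b + 1 := by revert a b; decide
lemma zz (a : Zt) : a + a = 0 := by revert a; decide
lemma vv (x : V) : x + x = 0 := ZModModule.add_self x
lemma vvl (x y : V) : x + (x + y) = y := by rw [← add_assoc, vv, zero_add]
lemma vv0 {x y : V} : x + y = 0 ↔ x = y := by
  rw [add_eq_zero_iff_eq_neg, ZModModule.neg_eq_self]
lemma vneg (x : V) : -x = x := ZModModule.neg_eq_self x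
lemma vsub (x y : V) : x - y = x + y := ZModModule.sub_eq_add x y
def D (a : V) (f : V → Zt) : V → Zt := fun x => f (x + a) + f x
def dg : ℕ → (V → Zt) → Prop
  | 0, f => ∀ x, f x = 0
  | s + 1, f => ∀ a, dg s (D a f)
lemma dg_add {s : ℕ} {f g : V → Zt} (hf : dg s f) (hg : dg s g) : dg s (f + g) := by
  induction s generalizing f g with
  | zero => intro x; simp [hf x, hg x]
  | succ s ih =>
    intro a
    have : D a (f + g) = D a f + D a g := by
      funext x; simp only [D, Pi.add_apply]; ring
    rw [this]; exact ih (hf a) (hg a)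
lemma dg_zero (s : ℕ) : dg s (0 : V → Zt) := by
  induction s with
  | zero => intro x; rfl
  | succ s ih =>
    intro a
    have : D a (0 : V → Zt) = 0 := by funext x; simp [D]
    rw [this]; exact ih
lemma dg_succ {s : ℕ} {f : V → Zt} (hf : dg s f) : dg (s + 1) f := by
  induction s generalizing f with
  | zero =>
    have : f = 0 := funext hf
    rw [this]; exact dg_zero 1
  | succ s ih => intro a; exact ih (hf a)
lemma dg_mono {s t : ℕ} (h : s ≤ t) {f : V → Zt} (hf : dg s f) : dg t f := by
  induction h with
  | refl => exact hf
  | step _ ih => exact dg_succ ih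
lemma dg_comp {W : Type} [AddCommGroup W] [Module Zt W] {s : ℕ} {f : V → Zt}
    (hf : dg s f) (φ : W →+ V) (p : V) : dg s (fun x => f (p + φ x)) := by
  induction s generalizing f with
  | zero => intro x; exact hf _
  | succ s ih =>
    intro a
    have := ih (hf (φ a))
    have e : D a (fun x => f (p + φ x)) = fun x => D (φ a) f (p + φ x) := by
      funext x; simp [D, add_assoc]
    rw [e]; exact this
lemma dg_one {f : V → Zt} : dg 1 f ↔ ∀ x y, f x = f y := by
  constructor
  · intro h x y
    have := h (x + y) y
    simp only [D] at this
    rw [zadd, show y + (x + y) = x by rw [add_comm x y, vvl]] at this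
    exact this
  · intro h a x
    simp [D, h (x + a) x, zz]
lemma dg_const (c : Zt) (s : ℕ) : dg (s + 1) (fun _ : V => c) :=
  dg_mono (by omega) (dg_one.2 fun _ _ => rfl)
def res (K : Sb V) (p : V) (f : V → Zt) : K → Zt := fun x => f (p + x)
lemma dg_res {s : ℕ} {f : V → Zt} (hf : dg s f) (K : Sb V) (p : V) :
    dg s (res K p f) := dg_comp hf K.subtype.toAddMonoidHom p
lemma res_add (K : Sb V) (p : V) (f g : V → Zt) :
    res K p (f + g) = res K p f + res K p g := rfl
lemma dg_trans {s : ℕ} {f : V → Zt} (hf : dg s f) (p : V) : dg s (fun x => f (p + x)) :=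
  dg_comp hf (AddMonoidHom.id V) p
noncomputable def wt (f : V → Zt) : ℕ := {x | f x = 1}.ncard
noncomputable def w (K : Sb V) (p : V) (f : V → Zt) : ℕ :=
  {x | f x = 1 ∧ p + x ∈ K}.ncard
lemma wt_res (K : Sb V) (p : V) (f : V → Zt) : wt (res K p f) = w K p f := by
  unfold wt w
  rw [← Set.ncard_image_of_injective (f := fun x : K => p + (x : V))]
  · congr 1
    ext y
    simp only [Set.mem_image, Set.mem_setOf_eq, res]
    constructor
    · rintro ⟨x, hx, rfl⟩; exact ⟨hx, by rw [vvl]; exact x.2⟩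
    · rintro ⟨h1, h2⟩; exact ⟨⟨p + y, h2⟩, by simpa [vvl] using h1, by simp [vvl]⟩
  · intro x y h; simpa using h
lemma w_top (p : V) (f : V → Zt) : w ⊤ p f = wt f := by simp [w, wt]
lemma card_pos' [Finite V] : 0 < nc V := Nat.card_pos
lemma wt_eq_zero [Finite V] {f : V → Zt} : wt f = 0 ↔ f = 0 := by
  unfold wt
  rw [Set.ncard_eq_zero]
  constructor
  · intro h; funext x
    have : x ∉ {x | f x = 1} := by rw [h]; simp
    exact zne1.1 this
  · rintro rfl; ext x; simp
lemma wt_trans (f : V → Zt) (p : V) : wt (fun x => f (p + x)) = wt f := by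
  unfold wt
  rw [← Set.ncard_image_of_injective (f := fun x : V => p + x)]
  · congr 1; ext y; simp only [Set.mem_image, Set.mem_setOf_eq]
    constructor
    · rintro ⟨x, hx, rfl⟩; exact hx
    · intro h; exact ⟨p + y, by rwa [vvl], vvl _ _⟩
  · intro x y h; simpa using h
lemma wt_add_mul [Finite V] (f g : V → Zt) : wt (f + g) + 2 * wt (f * g) = wt f + wt g := by
  unfold wt
  have e1 : {x | (f * g) x = 1} = {x | f x = 1} ∩ {x | g x = 1} := by
    ext x; simp only [Pi.mul_apply, Set.mem_setOf_eq, Set.mem_inter_iff]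
    generalize f x = a; generalize g x = b; revert a b; decide
  have e2 : {x | (f + g) x = 1} = ({x | f x = 1} ∪ {x | g x = 1}) \ ({x | f x = 1} ∩ {x | g x = 1}) := by
    ext x; simp only [Pi.add_apply, Set.mem_setOf_eq, Set.mem_inter_iff, Set.mem_union, Set.mem_diff]
    generalize f x = a; generalize g x = b; revert a b; decide
  have h1 := Set.ncard_union_add_ncard_inter {x | f x = 1} {x | g x = 1}
  have h2 := Set.ncard_sdiff_add_ncard_of_subset (s := {x | f x = 1} ∩ {x | g x = 1})
    (t := {x | f x = 1} ∪ {x | g x = 1}) (fun x hx => Or.inl hx.1)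
  rw [e1, e2]; omega
lemma wt_add_le [Finite V] (f g : V → Zt) : wt (f + g) ≤ wt f + wt g := by
  have := wt_add_mul f g; omega
lemma wt_le_card [Finite V] (f : V → Zt) : wt f ≤ nc V := by
  unfold wt; rw [← Set.ncard_univ]; exact Set.ncard_le_ncard (Set.subset_univ _)
lemma wt_one [Finite V] : wt (1 : V → Zt) = nc V := by
  unfold wt; rw [← Set.ncard_univ]; congr 1; ext x; simp
lemma wt_mono [Finite V] {f g : V → Zt} (h : ∀ x, f x = 1 → g x = 1) : wt f ≤ wt g :=
  Set.ncard_le_ncard h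
lemma wt_D [Finite V] (a : V) (f : V → Zt) : wt (D a f) ≤ 2 * wt f := by
  have : D a f = (fun x => f (a + x)) + f := by funext x; simp [D, add_comm]
  rw [this]; have := wt_add_le (fun x => f (a + x)) f; rw [wt_trans] at this; omega
lemma minw [Finite V] {s : ℕ} {f : V → Zt} (hf : dg (s + 1) f) (h0 : f ≠ 0) :
    nc V ≤ 2 ^ s * wt f := by
  induction s generalizing f with
  | zero =>
    have h := dg_one.1 hf
    have : ∃ x, f x ≠ 0 := by by_contra hh; push Not at hh; exact h0 (funext hh)
    obtain ⟨x, hx⟩ := this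
    have : f = 1 := by funext y; rw [h y x]; exact zne.1 hx
    rw [this, wt_one]; simp
  | succ s ih =>
    by_cases h : ∀ a, D a f = 0
    · have h1 : dg 1 f := fun a x => by rw [h a]; rfl
      have hc := dg_one.1 h1
      have : f = 1 := by
        funext y; by_contra hh; exact h0 (funext fun z => by rw [hc z y]; exact zne1.1 hh)
      rw [this, wt_one]; exact Nat.le_mul_of_pos_left _ (by positivity)
    · push Not at h
      obtain ⟨a, ha⟩ := h
      have := ih (hf a) ha
      have h2 := wt_D a f
      calc nc V ≤ 2 ^ s * wt (D a f) := this
        _ ≤ 2 ^ s * (2 * wt f) := by gcongr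
        _ = _ := by ring
lemma mem_sup_span {K : Sb V} {v x : V} :
    x ∈ K ⊔ Submodule.span (Zt) {v} ↔ x ∈ K ∨ v + x ∈ K := by
  rw [Submodule.mem_sup]
  constructor
  · rintro ⟨y, hy, z, hz, rfl⟩
    rw [Submodule.mem_span_singleton] at hz
    obtain ⟨c, rfl⟩ := hz
    rcases z01 c with rfl | rfl
    · left; simpa using hy
    · right; rw [one_smul, add_comm y, vvl]; exact hy
  · rintro (h | h)
    · exact ⟨x, h, 0, zero_mem _, by simp⟩
    · exact ⟨v + x, h, v, Submodule.mem_span_singleton_self v, by rw [add_comm, vvl]⟩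
def ad (K : Sb V) (v : V) : Sb V := K ⊔ Submodule.span (Zt) {v}
lemma mem_ad {K : Sb V} {v x : V} : x ∈ ad K v ↔ x ∈ K ∨ v + x ∈ K := mem_sup_span
lemma le_ad (K : Sb V) (v : V) : K ≤ ad K v := le_sup_left
lemma self_mem_ad (K : Sb V) (v : V) : v ∈ ad K v := by
  rw [mem_ad]; right; rw [vv]; exact zero_mem _
lemma ad_le {K L : Sb V} {v : V} : ad K v ≤ L ↔ K ≤ L ∧ v ∈ L := by
  simp [ad]
lemma w_ad [Finite V] {K : Sb V} {v : V} (hv : v ∉ K) (p : V) (f : V → Zt) :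
    w (ad K v) p f = w K p f + w K (p + v) f := by
  unfold w
  rw [← Set.ncard_union_eq]
  · congr 1; ext x; simp only [Set.mem_setOf_eq, mem_ad, Set.mem_union]
    rw [show v + (p + x) = p + v + x by abel]; tauto
  · rw [Set.disjoint_left]; rintro x ⟨_, h1⟩ ⟨_, h2⟩
    apply hv
    have := K.add_mem h1 h2
    rwa [show p + x + (p + v + x) = v + (p + p) + (x + x) by abel, vv, vv, add_zero, add_zero] at this
lemma w_one [Finite V] (K : Sb V) (p : V) : w K p 1 = nc K := by
  rw [← wt_res, show res K p 1 = 1 from rfl, wt_one]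
lemma card_ad [Finite V] {K : Sb V} {v : V} (hv : v ∉ K) :
    nc (ad K v) = 2 * nc K := by
  have := w_ad hv 0 (1 : V → Zt); simp only [w_one] at this; omega
lemma eq_top_of_card [Finite V] {K : Sb V} (h : nc K = nc V) : K = ⊤ := by
  by_contra hK
  have : ∃ x, x ∉ K := by by_contra hh; push Not at hh; exact hK (eq_top_iff.2 fun x _ => hh x)
  obtain ⟨x, hx⟩ := this
  have h1 := card_ad hx
  have h2 : nc (ad K x) ≤ nc V := Nat.card_le_card_of_injective _ (Subtype.val_injective)
  have : 0 < nc V := Nat.card_pos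
  omega
lemma eq_of_le_card [Finite V] {K L : Sb V} (hl : K ≤ L) (h : nc L ≤ nc K) : K = L := by
  by_contra hK
  have : ∃ x ∈ L, x ∉ K := by by_contra hh; push Not at hh; exact hK (le_antisymm hl hh)
  obtain ⟨x, hxl, hx⟩ := this
  have h1 := card_ad hx
  have h2 : nc (ad K x) ≤ nc L := Nat.card_mono (Set.toFinite _) (ad_le.2 ⟨hl, hxl⟩)
  have : 0 < nc K := Nat.card_pos
  omega
lemma card_le_of_le [Finite V] {K L : Sb V} (hl : K ≤ L) : nc K ≤ nc L :=
  Nat.card_mono (Set.toFinite _) hl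
lemma exists_ker {K : Sb V} {v : V} (hv : v ∉ K) :
    ∃ a : V →ₗ[Zt] Zt, a v = 1 ∧ ∀ x ∈ K, a x = 0 := by
  obtain ⟨f, h1, h2⟩ := Submodule.exists_le_ker_of_notMem hv
  exact ⟨f, zne.1 h1, fun x hx => by simpa using h2 hx⟩
lemma exists_ker' {K : Sb V} (h : K ≠ ⊤) :
    ∃ a : V →ₗ[Zt] Zt, a ≠ 0 ∧ ∀ x ∈ K, a x = 0 := by
  have : ∃ x, x ∉ K := by by_contra hh; push Not at hh; exact h (eq_top_iff.2 fun x _ => hh x)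
  obtain ⟨x, hx⟩ := this
  obtain ⟨a, h1, h2⟩ := exists_ker hx
  exact ⟨a, by rintro rfl; simp at h1, h2⟩
lemma exists_one {a : V →ₗ[Zt] Zt} (ha : a ≠ 0) : ∃ v, a v = 1 := by
  by_contra hh; push Not at hh; exact ha (LinearMap.ext fun x => zne1.1 (hh x))
lemma ad_ker {a : V →ₗ[Zt] Zt} {v : V} (hv : a v = 1) : ad (LinearMap.ker a) v = ⊤ := by
  rw [eq_top_iff]; intro x _; rw [mem_ad]; simp only [LinearMap.mem_ker, map_add, hv]
  rcases z01 (a x) with h | h <;> rw [h] <;> decide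
lemma card_ker [Finite V] {a : V →ₗ[Zt] Zt} (ha : a ≠ 0) :
    nc V = 2 * nc (LinearMap.ker a) := by
  obtain ⟨v, hv⟩ := exists_one ha
  have := card_ad (K := LinearMap.ker a) (v := v) (by simp [hv])
  rw [ad_ker hv] at this
  rw [← this]; simp
lemma wt_ker [Finite V] {a : V →ₗ[Zt] Zt} {v : V} (hv : a v = 1) (f : V → Zt) :
    wt f = w (LinearMap.ker a) 0 f + w (LinearMap.ker a) v f := by
  have := w_ad (K := LinearMap.ker a) (v := v) (by simp [hv]) 0 f
  rw [ad_ker hv, w_top, zero_add] at this; exact this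
open Classical in
noncomputable def ind (X : Sb V) (p : V) : V → Zt :=
  fun x => if p + x ∈ X then 1 else 0
lemma ind1 {X : Sb V} {p x : V} : ind X p x = 1 ↔ p + x ∈ X := by
  unfold ind; split_ifs <;> simp_all
lemma ind0 {X : Sb V} {p x : V} : ind X p x = 0 ↔ p + x ∉ X := by
  unfold ind; split_ifs <;> simp_all
lemma fun_ext1 {W : Type} {f g : W → Zt} (h : ∀ x, f x = 1 ↔ g x = 1) : f = g := by
  funext x; have := h x; revert this; generalize f x = a; generalize g x = b; revert a b; decide
lemma fadd (f : V → Zt) : f + f = 0 := by funext x; exact zz _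
lemma ind_self (X : Sb V) (p : V) : ind X p p = 1 := by
  rw [ind1, vv]; exact zero_mem _
lemma ind_ne [Finite V] (X : Sb V) (p : V) : ind X p ≠ 0 := by
  intro h; have := ind_self X p; rw [h] at this; simp at this
lemma wt_ind [Finite V] (X : Sb V) (p : V) : wt (ind X p) = nc X := by
  rw [← w_one X p]; unfold wt w; congr 1; ext x; simp [ind1]
lemma wt_mul_ind (X : Sb V) (p : V) (f : V → Zt) : wt (f * ind X p) = w X p f := by
  unfold wt w; congr 1; ext x; simp only [Pi.mul_apply, Set.mem_setOf_eq, ← ind1]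
  generalize f x = a; generalize ind X p x = b; revert a b; decide
lemma ind_congr {X : Sb V} {p q : V} (h : p + q ∈ X) : ind X p = ind X q := by
  apply fun_ext1; intro x; rw [ind1, ind1]
  constructor
  · intro h1; have := X.add_mem h h1
    rwa [show p + q + (p + x) = p + p + (q + x) by abel, vv, zero_add] at this
  · intro h1; have := X.add_mem h h1
    rwa [show p + q + (q + x) = q + q + (p + x) by abel, vv, zero_add] at this
lemma D_ind_mem {X : Sb V} {a : V} (h : a ∈ X) (p : V) : D a (ind X p) = 0 := by
  funext x; simp only [D, Pi.zero_apply]; rw [zadd]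
  have : ind X p (x + a) = 1 ↔ ind X p x = 1 := by
    rw [ind1, ind1, ← add_assoc]; exact X.add_mem_iff_left h
  revert this; generalize ind X p (x+a) = a; generalize ind X p x = b; revert a b; decide
lemma D_ind_not {X : Sb V} {a : V} (h : a ∉ X) (p : V) :
    D a (ind X p) = ind (ad X a) p := by
  apply fun_ext1; intro x; rw [ind1, mem_ad]
  have h1 := ind1 (X := X) (p := p) (x := x)
  have h2 := ind1 (X := X) (p := p) (x := x + a)
  rw [show p + (x + a) = a + (p + x) by abel] at h2
  have h3 : ¬ (p + x ∈ X ∧ a + (p + x) ∈ X) := by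
    rintro ⟨h3, h4⟩; exact h ((X.add_mem_iff_left h3).1 h4)
  simp only [D]
  rw [← h1, ← h2] at h3 ⊢
  revert h3; generalize ind X p (x+a) = a; generalize ind X p x = b; revert a b; decide
lemma ind_dg [Finite V] {s : ℕ} {X : Sb V} (h : nc V ≤ 2 ^ s * nc X) (p : V) :
    dg (s + 1) (ind X p) := by
  induction s generalizing X with
  | zero =>
    have : X = ⊤ := eq_of_le_card le_top (by rw [show nc (⊤ : Sb V) = nc V by simp]; simpa using h)
    subst this
    apply dg_one.2; intro x y; rw [ind1.2 (Submodule.mem_top), ind1.2 (Submodule.mem_top)]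
  | succ s ih =>
    intro a
    by_cases ha : a ∈ X
    · rw [D_ind_mem ha]; exact dg_zero _
    · rw [D_ind_not ha]; apply ih; rw [card_ad ha]; calc _ ≤ _ := h
        _ = _ := by ring
lemma ind_shift {s : ℕ} {X : Sb V} {p : V} (h : dg (s + 1) (ind X p)) (q : V) :
    dg s (ind X p + ind X q) := by
  have : D (p + q) (ind X p) = ind X p + ind X q := by
    funext x; simp only [D, Pi.add_apply, ind]
    rw [show p + (x + (p + q)) = p + p + (q + x) by abel, vv, zero_add, add_comm]
  rw [← this]; exact h _
lemma min_flat [Finite V] {s : ℕ} {f : V → Zt} (hf : dg (s + 1) f) (h0 : f ≠ 0)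
    (hw : 2 ^ s * wt f ≤ nc V) : ∃ X p, f = ind X p ∧ nc V = 2 ^ s * nc X := by
  have hw' : nc V = 2 ^ s * wt f := le_antisymm (minw hf h0) hw
  obtain ⟨p, hp⟩ : ∃ p, f p = 1 := by
    by_contra hh; push Not at hh; exact h0 (funext fun x => zne1.1 (hh x))
  let X : Sb V :=
    { carrier := {a | D a f = 0}
      add_mem' := by
        intro a b ha hb
        funext x
        have h1 := congrFun ha (x + b); have h2 := congrFun hb x
        simp only [D, Pi.zero_apply] at h1 h2 ⊢
        rw [zadd] at h1 h2 ⊢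
        rw [show x + (a + b) = x + b + a by abel, h1, h2]
      zero_mem' := by funext x; simp [D, zz]
      smul_mem' := by
        intro c a ha
        rcases z01 c with rfl | rfl
        · funext x; simp [D, zz]
        · simpa using ha }
  have hX : ∀ a, a ∈ X ↔ D a f = 0 := fun a => Iff.rfl
  have key : f = ind X p := by
    apply fun_ext1; intro x; rw [ind1, hX]
    constructor
    · intro hx
      by_contra hD
      rcases s with _ | s
      · exact hD (funext (hf _))
      · have h1 := minw (hf _) hD
        have e : D (p + x) f = (fun y => f (p + x + y)) + f := by funext y; simp [D, add_comm]
        have h2 := wt_add_mul (fun y => f (p + x + y)) f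
        rw [← e, wt_trans] at h2
        have h3 : wt ((fun y => f (p + x + y)) * f) = 0 := by
          have : 2 ^ s * (2 * wt f) ≤ 2 ^ s * wt (D (p + x) f) := by
            calc _ = 2 ^ (s+1) * wt f := by ring
              _ ≤ _ := by omega
          have := Nat.le_of_mul_le_mul_left this (by positivity)
          omega
        rw [wt_eq_zero] at h3
        have := congrFun h3 p
        simp only [Pi.mul_apply, Pi.zero_apply, hp] at this
        rw [show p + x + p = p + p + x by abel, vv, zero_add, hx] at this
        exact absurd this (by decide)
    · intro hD
      have := congrFun hD p
      simp only [D, Pi.zero_apply, hp] at this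
      rw [vvl, zadd] at this; exact this
  refine ⟨X, p, key, ?_⟩
  rw [hw', key, wt_ind]
def sub (K X : Sb V) : Sb K := X.comap K.subtype
lemma mem_sub {K X : Sb V} {x : K} : x ∈ sub K X ↔ (x : V) ∈ X := Iff.rfl
lemma card_sub (K X : Sb V) : nc (sub K X) = nc (X ⊓ K : Sb V) := by
  apply Nat.card_congr
  exact ⟨fun x => ⟨x.1.1, x.2, x.1.2⟩, fun x => ⟨⟨x.1, x.2.2⟩, x.2.1⟩, fun x => rfl, fun x => rfl⟩
lemma res_ind_mem (K X : Sb V) {q p : V} {k : K} (h : p + q + k ∈ X) :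
    res K q (ind X p) = ind (sub K X) k := by
  apply fun_ext1; intro x; rw [ind1, res, ind1, mem_sub, Submodule.coe_add]
  constructor
  · intro h1; have := X.add_mem h h1
    rwa [show p + q + (k : V) + (p + (q + x)) = (p + p) + (q + q) + (k + x) by abel, vv, vv, zero_add, zero_add] at this
  · intro h1; have := X.add_mem h h1
    rwa [show p + q + (k : V) + (k + x) = (k + k) + (p + (q + x)) by abel, vv, zero_add] at this
lemma res_ind_cases (K X : Sb V) (q p : V) :
    res K q (ind X p) = 0 ∨ ∃ k : K, res K q (ind X p) = ind (sub K X) k := by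
  by_cases h : ∃ k : K, p + q + k ∈ X
  · obtain ⟨k, hk⟩ := h; exact Or.inr ⟨k, res_ind_mem K X hk⟩
  · left; funext x; rw [res, Pi.zero_apply, ind0]; push Not at h; rw [← add_assoc]; exact h x
abbrev kills (a : V →ₗ[Zt] Zt) (X : Sb V) : Prop := ∀ x ∈ X, a x = 0
lemma not_kills {a : V →ₗ[Zt] Zt} {X : Sb V} (h : ¬ kills a X) : ∃ x ∈ X, a x = 1 := by
  unfold kills at h; push Not at h; obtain ⟨x, h1, h2⟩ := h; exact ⟨x, h1, zne.1 h2⟩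
lemma kills_top {a : V →ₗ[Zt] Zt} (h : kills a ⊤) : a = 0 :=
  LinearMap.ext fun x => h x trivial
lemma kills_sup {a : V →ₗ[Zt] Zt} {X Y : Sb V} (h : X ⊔ Y = ⊤) (h1 : kills a X)
    (h2 : kills a Y) : a = 0 := by
  apply kills_top
  rw [← h]; intro x hx; obtain ⟨y, hy, z, hz, rfl⟩ := Submodule.mem_sup.1 hx
  rw [map_add, h1 y hy, h2 z hz, add_zero]
lemma card_sub_kill [Finite V] {a : V →ₗ[Zt] Zt} {X : Sb V} (h : kills a X) :
    nc (sub (LinearMap.ker a) X) = nc X := by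
  rw [card_sub, inf_eq_left.2]; intro x hx; exact h x hx
lemma card_sub_not [Finite V] {a : V →ₗ[Zt] Zt} {X : Sb V} (h : ¬ kills a X) :
    nc X = 2 * nc (sub (LinearMap.ker a) X) := by
  obtain ⟨v, hv, hv1⟩ := not_kills h
  rw [card_sub, ← card_ad (v := v) (by simp [hv1])]
  have e : X = ad (X ⊓ LinearMap.ker a) v := by
   apply le_antisymm
   · intro x hx; rw [mem_ad]
     rcases z01 (a x) with h | h
     · left; exact ⟨hx, h⟩
     · right; exact ⟨X.add_mem hv hx, by simp [hv1, h, zz]⟩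
   · rw [ad_le]; exact ⟨inf_le_left, hv⟩
  rw [← e]
lemma res_ind_not {a : V →ₗ[Zt] Zt} {X : Sb V} (h : ¬ kills a X) (q p : V) :
    ∃ k, res (LinearMap.ker a) q (ind X p) = ind (sub (LinearMap.ker a) X) k := by
  obtain ⟨v, hv, hv1⟩ := not_kills h
  rcases z01 (a (p + q)) with h1 | h1
  · exact ⟨⟨p + q, h1⟩, res_ind_mem _ _ (by simp only []; rw [vv]; exact zero_mem _)⟩
  · refine ⟨⟨p + q + v, ?_⟩, res_ind_mem _ _ ?_⟩
    · rw [LinearMap.mem_ker, map_add, h1, hv1]; decide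
    · simp only []; rw [vvl]; exact hv
lemma side_dg [Finite V] {a : V →ₗ[Zt] Zt} (ha : a ≠ 0) {X : Sb V} {s : ℕ}
    (hX : nc V ≤ 2 ^ s * nc X) (h : kills a X) (q p : V) :
    dg s (res (LinearMap.ker a) q (ind X p)) := by
  rcases s with _ | s
  · have : X = ⊤ := eq_of_le_card le_top (by rw [show nc (⊤ : Sb V) = nc V by simp]; simpa using hX)
    subst this; exact absurd (kills_top h) ha
  · rcases res_ind_cases (LinearMap.ker a) X q p with h1 | ⟨k, h1⟩
    · rw [h1]; exact dg_zero _
    · rw [h1]; apply ind_dg; rw [card_sub_kill h]; have := card_ker ha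
      rw [pow_succ] at hX; nlinarith
noncomputable def om (r : ℕ) (f : V → Zt) : ℚ := 2 ^ r * wt f / nc V
lemma om_ge [Finite V] {r : ℕ} {f : V → Zt} (hf : dg (r + 1) f) (h0 : f ≠ 0) : 1 ≤ om r f := by
  unfold om; rw [le_div_iff₀ (by exact_mod_cast card_pos'), one_mul]
  exact_mod_cast minw hf h0
lemma om_nonneg (r : ℕ) (f : V → Zt) : 0 ≤ om r f := by unfold om; positivity
lemma om_eq_zero [Finite V] {r : ℕ} {f : V → Zt} : om r f = 0 ↔ f = 0 := by
  unfold om; have : (nc V : ℚ) ≠ 0 := by exact_mod_cast card_pos'.ne'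
  rw [div_eq_zero_iff]; simp [this, wt_eq_zero]
lemma om_trans (r : ℕ) (f : V → Zt) (p : V) : om r (fun x => f (p + x)) = om r f := by
  unfold om; rw [wt_trans]
lemma om_side [Finite V] (r : ℕ) {a : V →ₗ[Zt] Zt} {v : V} (hv : a v = 1) (f : V → Zt) :
    om (r + 1) f = om r (res (LinearMap.ker a) 0 f) + om r (res (LinearMap.ker a) v f) := by
  have ha : a ≠ 0 := by rintro rfl; simp at hv
  unfold om; rw [wt_res, wt_res, wt_ker hv f, card_ker ha]
  have : (nc (LinearMap.ker a) : ℚ) ≠ 0 := by exact_mod_cast card_pos'.ne'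
  push_cast; field_simp; ring
lemma om_succ (r : ℕ) (f : V → Zt) : om (r + 1) f = 2 * om r f := by unfold om; rw [pow_succ]; ring
lemma om_ind [Finite V] {r : ℕ} {X : Sb V} (h : nc V = 2 ^ r * nc X) (p : V) :
    om r (ind X p) = 1 := by
  unfold om; rw [wt_ind, h]; push_cast; rw [div_self]
  have : (nc X : ℚ) ≠ 0 := by exact_mod_cast card_pos'.ne'
  positivity
lemma om_flat [Finite V] {r : ℕ} {f : V → Zt} (hf : dg (r + 1) f) (h : om r f = 1) :
    ∃ X p, f = ind X p ∧ nc V = 2 ^ r * nc X := by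
  apply min_flat hf
  · intro h0; rw [om_eq_zero.2 h0] at h; norm_num at h
  · unfold om at h; rw [div_eq_one_iff_eq (by exact_mod_cast card_pos'.ne')] at h
    exact_mod_cast h.le
abbrev conS (a : V →ₗ[Zt] Zt) (f : V → Zt) : Prop := ∃ c, ∀ x, f x = 1 → a x = c
lemma res_zero_side {a : V →ₗ[Zt] Zt} {q : V} {f : V → Zt} (h : res (LinearMap.ker a) q f = 0)
    {x : V} (hx : a x = a q) : f x = 0 := by
  have := congrFun h ⟨q + x, by simp [hx, zz]⟩
  simpa [res, vvl] using this
lemma Lside [Finite V] {r : ℕ} {f : V → Zt} {a : V →ₗ[Zt] Zt} (ha : a ≠ 0)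
    (h : ∀ q, dg r (res (LinearMap.ker a) q f)) (ho : om r f < 2) : conS a f := by
  obtain ⟨v, hv⟩ := exists_one ha
  have key : ∀ q, res (LinearMap.ker a) q f = 0 → conS a f := by
    intro q hq; refine ⟨a q + 1, fun x hx => ?_⟩
    have h1 : a x ≠ a q := fun h2 => by rw [res_zero_side hq h2] at hx; exact absurd hx (by decide)
    revert h1; generalize a x = c; generalize a q = b; revert c b; decide
  rcases r with _ | r
  · exact key 0 (funext (h 0))
  · rw [om_side r hv] at ho
    by_cases h0 : res (LinearMap.ker a) 0 f = 0
    · exact key _ h0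
    by_cases h1 : res (LinearMap.ker a) v f = 0
    · exact key _ h1
    have := om_ge (h 0) h0; have := om_ge (h v) h1; linarith
lemma L1 [Finite V] {r : ℕ} {f : V → Zt} {a : V →ₗ[Zt] Zt} (ha : a ≠ 0)
    {X Y : Sb V} {p q : V} (hX : nc V ≤ 2 ^ r * nc X) (hY : nc V ≤ 2 ^ r * nc Y)
    (h1 : kills a X) (h2 : kills a Y) (hs : dg r (f + ind X p + ind Y q)) (ho : om r f < 2) : conS a f := by
  apply Lside ha _ ho
  intro t
  have e : f = f + ind X p + ind Y q + ind X p + ind Y q := by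
    rw [show f + ind X p + ind Y q + ind X p + ind Y q = f + (ind X p + ind X p) + (ind Y q + ind Y q) by abel,
      fadd, fadd]; simp
  rw [e, res_add, res_add]
  exact dg_add (dg_add (dg_res hs _ _) (side_dg ha hX h1 _ _)) (side_dg ha hY h2 _ _)
lemma L1' [Finite V] {r : ℕ} {f : V → Zt} {a : V →ₗ[Zt] Zt} (ha : a ≠ 0)
    {X : Sb V} {p : V} (hX : nc V ≤ 2 ^ r * nc X)
    (h1 : kills a X) (hs : dg r (f + ind X p)) (ho : om r f < 2) : conS a f := by
  apply Lside ha _ ho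
  intro t
  have e : f = f + ind X p + ind X p := by rw [add_assoc, fadd]; simp
  rw [e, res_add]
  exact dg_add (dg_res hs _ _) (side_dg ha hX h1 _ _)
lemma ann_ne [Finite V] {s : ℕ} (hs : 1 ≤ s) {X : Sb V} (hX : nc V = 2 ^ s * nc X) :
    ∃ a : V →ₗ[Zt] Zt, a ≠ 0 ∧ kills a X := by
  apply exists_ker'
  rintro rfl
  have h2 : 2 ^ 1 ≤ 2 ^ s := Nat.pow_le_pow_right (by norm_num) hs
  have := card_pos' (V := V)
  rw [show nc (⊤ : Sb V) = nc V by simp] at hX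
  nlinarith
lemma codim_sub_not [Finite V] {s : ℕ} {a : V →ₗ[Zt] Zt} {X : Sb V} (h : ¬ kills a X)
    (hX : nc V = 2 ^ s * nc X) : nc (LinearMap.ker a) = 2 ^ s * nc (sub (LinearMap.ker a) X) := by
  have ha : a ≠ 0 := by rintro rfl; exact h (by intro x _; rfl)
  have := card_ker ha; have := card_sub_not h
  have : 2 * nc (LinearMap.ker a) = 2 * (2 ^ s * nc (sub (LinearMap.ker a) X)) := by
    rw [← card_ker ha, hX, this]; ring
  omega
lemma not_dg_ind [Finite V] {s : ℕ} {X : Sb V} (hX : nc V = 2 ^ s * nc X) (p : V) :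
    ¬ dg s (ind X p) := by
  intro h
  rcases s with _ | s
  · exact ind_ne X p (funext h)
  · have := minw h (ind_ne X p); rw [wt_ind, hX] at this
    have h1 : 0 < nc X := card_pos'
    have : 2 ^ (s+1) * nc X = 2 * (2 ^ s * nc X) := by ring
    have : 0 < 2 ^ s * nc X := by positivity
    omega
lemma D_step1 [Finite V] {s : ℕ} {X1 X2 X3 : Sb V} {p1 p2 p3 : V}
    (h1 : nc V = 2 ^ s * nc X1) (h2 : nc V = 2 ^ s * nc X2) (h3 : nc V = 2 ^ s * nc X3)
    (hs : dg s (ind X1 p1 + ind X2 p2 + ind X3 p3)) {a : V →ₗ[Zt] Zt} (ha : a ≠ 0) (k1 : kills a X1)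
    (k2 : kills a X2) : kills a X3 := by
  by_contra k3
  obtain ⟨k, hk⟩ := res_ind_not k3 0 p3
  apply not_dg_ind (codim_sub_not k3 h3) k
  rw [← hk]
  have e : ind X3 p3 = (ind X1 p1 + ind X2 p2 + ind X3 p3) + ind X1 p1 + ind X2 p2 := by
    rw [show (ind X1 p1 + ind X2 p2 + ind X3 p3) + ind X1 p1 + ind X2 p2 = (ind X1 p1 + ind X1 p1) + (ind X2 p2 + ind X2 p2) + ind X3 p3 by abel,
      fadd, fadd]; simp
  rw [e, res_add, res_add]
  exact dg_add (dg_add (dg_res hs _ _) (side_dg ha h1.le k1 _ _)) (side_dg ha h2.le k2 _ _)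
lemma two_flats_eq [Finite V] {s : ℕ} (h : 1 ≤ s) {X Y : Sb V} {p q : V} (hX : nc V = 2 ^ s * nc X)
    (hY : nc V = 2 ^ s * nc Y) (hs : dg s (ind X p + ind Y q)) : X = Y := by
  obtain ⟨s, rfl⟩ : ∃ t, s = t + 1 := ⟨s - 1, by omega⟩
  have h1 : dg (s + 1) (ind X 0 + ind Y 0) := by
    have := dg_add (dg_add hs (ind_shift (ind_dg hX.le p) 0)) (ind_shift (ind_dg hY.le q) 0)
    rwa [show ind X p + ind Y q + (ind X p + ind X 0) + (ind Y q + ind Y 0) =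
      (ind X p + ind X p) + (ind Y q + ind Y q) + (ind X 0 + ind Y 0) by abel, fadd, fadd, zero_add, zero_add] at this
  have h0 : ind X 0 + ind Y 0 = 0 := by
    by_contra hne
    have h2 := minw h1 hne
    have h3 := wt_add_mul (ind X 0) (ind Y 0)
    rw [wt_ind, wt_ind] at h3
    have h4 : wt (ind X 0 * ind Y 0) ≠ 0 := by
      rw [Ne, wt_eq_zero]; intro h4; have := congrFun h4 0
      rw [Pi.mul_apply, ind_self, ind_self, Pi.zero_apply] at this; exact absurd this (by decide)
    have h5 : nc X = nc Y := by
      have := hX.symm.trans hY; exact Nat.eq_of_mul_eq_mul_left (by positivity) this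
    have h6 : wt (ind X 0 + ind Y 0) < 2 * nc X := by omega
    have : 2 ^ s * wt (ind X 0 + ind Y 0) < 2 ^ s * (2 * nc X) := by gcongr
    rw [pow_succ] at hX
    nlinarith
  have h1 : ind X 0 = ind Y 0 := by
    funext x; have := congrFun h0 x; rw [Pi.add_apply, Pi.zero_apply, zadd] at this; exact this
  ext x; have := congrFun h1 x
  have e1 := ind1 (X := X) (p := 0) (x := x); have e2 := ind1 (X := Y) (p := 0) (x := x)
  rw [zero_add] at e1 e2; rw [← e1, ← e2, this]
lemma D_lem [Finite V] {s : ℕ} (hs2 : 2 ≤ s) {X1 X2 X3 : Sb V} {p1 p2 p3 : V}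
    (h1 : nc V = 2 ^ s * nc X1) (h2 : nc V = 2 ^ s * nc X2) (h3 : nc V = 2 ^ s * nc X3)
    (hs : dg s (ind X1 p1 + ind X2 p2 + ind X3 p3)) :
    ∃ a : V →ₗ[Zt] Zt, a ≠ 0 ∧ kills a X1 ∧ kills a X2 ∧ kills a X3 := by
  obtain ⟨a, ha, k1⟩ := ann_ne (by omega) h1
  have hs' : dg s (ind X1 p1 + ind X3 p3 + ind X2 p2) := by convert hs using 1; abel
  have hs'' : dg s (ind X2 p2 + ind X3 p3 + ind X1 p1) := by convert hs using 1; abel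
  by_cases k2 : kills a X2
  · exact ⟨a, ha, k1, k2, D_step1 h1 h2 h3 hs ha k1 k2⟩
  by_cases k3 : kills a X3
  · exact ⟨a, ha, k1, D_step1 h1 h3 h2 hs' ha k1 k3, k3⟩
  obtain ⟨q2, hq2⟩ := res_ind_not k2 0 p2
  obtain ⟨q3, hq3⟩ := res_ind_not k3 0 p3
  have e : ind X2 p2 + ind X3 p3 = (ind X1 p1 + ind X2 p2 + ind X3 p3) + ind X1 p1 := by
    rw [show (ind X1 p1 + ind X2 p2 + ind X3 p3) + ind X1 p1 = (ind X1 p1 + ind X1 p1) + (ind X2 p2 + ind X3 p3) by abel,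
      fadd]; simp
  have hd : dg s (res (LinearMap.ker a) 0 (ind X2 p2 + ind X3 p3)) := by
    rw [e, res_add]; exact dg_add (dg_res hs _ _) (side_dg ha h1.le k1 _ _)
  rw [res_add, hq2, hq3] at hd
  have he := two_flats_eq (by omega) (codim_sub_not k2 h2) (codim_sub_not k3 h3) hd
  have hm : ∀ x, a x = 0 → (x ∈ X2 ↔ x ∈ X3) := by
    intro x hx
    have : (⟨x, hx⟩ : LinearMap.ker a) ∈ sub (LinearMap.ker a) X2 ↔ (⟨x, hx⟩ : LinearMap.ker a) ∈ sub (LinearMap.ker a) X3 := by rw [he]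
    exact this
  obtain ⟨v3, hv3, hv31⟩ := not_kills k3
  have hle : X3 ≤ ad X2 v3 := by
    intro x hx; rw [mem_ad]
    rcases z01 (a x) with h | h
    · left; exact (hm x h).2 hx
    · right; exact (hm _ (by rw [map_add, hv31, h]; decide)).2 (X3.add_mem hv3 hx)
  have hc : nc (ad X2 v3) ≤ 2 * nc X2 := by
    by_cases h : v3 ∈ X2
    · have : ad X2 v3 = X2 := le_antisymm (ad_le.2 ⟨le_rfl, h⟩) (le_ad _ _)
      rw [this]; omega
    · rw [card_ad h]
  have hne : ad X2 v3 ≠ ⊤ := by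
    intro h; rw [h, show nc (⊤ : Sb V) = nc V by simp, h2] at hc
    have h2 : 2 ^ 2 ≤ 2 ^ s := Nat.pow_le_pow_right (by norm_num) hs2
    have := card_pos' (V := X2)
    nlinarith
  obtain ⟨b, hb, hb'⟩ := exists_ker' hne
  have b2 : kills b X2 := fun x hx => hb' x (le_ad _ _ hx)
  have b3 : kills b X3 := fun x hx => hb' x (hle hx)
  exact ⟨b, hb, D_step1 h2 h3 h1 hs'' hb b2 b3, b2, b3⟩
lemma extend_fun {K : Sb V} (m : K →ₗ[Zt] Zt) :
    ∃ n : V →ₗ[Zt] Zt, ∀ x : K, n x = m x := by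
  obtain ⟨n, hn⟩ := LinearMap.exists_extend m
  exact ⟨n, fun x => by rw [← hn]; rfl⟩
lemma Q4_aux {a n : V →ₗ[Zt] Zt} {X : Sb V} (h : ∀ x ∈ X, a x = 0 → n x = 0) :
    kills n X ∨ kills (n + a) X := by
  by_cases h1 : kills n X
  · exact Or.inl h1
  right
  obtain ⟨v, hv, hv1⟩ := not_kills h1
  have hav : a v = 1 := by
    by_contra h2; rw [h v hv (zne1.1 h2)] at hv1; exact absurd hv1 (by decide)
  intro x hx
  rw [LinearMap.add_apply]
  rcases z01 (a x) with h2 | h2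
  · rw [h x hx h2, h2]; rfl
  · have := h (v + x) (X.add_mem hv hx) (by rw [map_add, hav, h2]; decide)
    rw [map_add, hv1, add_comm] at this
    rw [h2, this]
lemma Q4 [Finite V] {s : ℕ} (hs2 : 2 ≤ s) {X1 X2 X3 X4 : Sb V} {p1 p2 p3 p4 : V}
    (h1 : nc V = 2 ^ s * nc X1) (h2 : nc V = 2 ^ s * nc X2) (h3 : nc V = 2 ^ s * nc X3)
    (h4 : nc V = 2 ^ s * nc X4)
    (hs : dg s (ind X1 p1 + ind X2 p2 + ind X3 p3 + ind X4 p4))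
    (h12 : X1 ⊔ X2 = ⊤) (h13 : X1 ⊔ X3 = ⊤) (h14 : X1 ⊔ X4 = ⊤) (h23 : X2 ⊔ X3 = ⊤) (h24 : X2 ⊔ X4 = ⊤)
    (h34 : X3 ⊔ X4 = ⊤) : False := by
  obtain ⟨a, ha, k1⟩ := ann_ne (by omega) h1
  have k2 : ¬ kills a X2 := fun h => ha (kills_sup h12 k1 h)
  have k3 : ¬ kills a X3 := fun h => ha (kills_sup h13 k1 h)
  have k4 : ¬ kills a X4 := fun h => ha (kills_sup h14 k1 h)
  obtain ⟨q2, hq2⟩ := res_ind_not k2 0 p2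
  obtain ⟨q3, hq3⟩ := res_ind_not k3 0 p3
  obtain ⟨q4, hq4⟩ := res_ind_not k4 0 p4
  have e : ind X2 p2 + ind X3 p3 + ind X4 p4 = (ind X1 p1 + ind X2 p2 + ind X3 p3 + ind X4 p4) + ind X1 p1 := by
    rw [show (ind X1 p1 + ind X2 p2 + ind X3 p3 + ind X4 p4) + ind X1 p1 = (ind X1 p1 + ind X1 p1) + (ind X2 p2 + ind X3 p3 + ind X4 p4) by abel,
      fadd]; simp
  have hd : dg s (res (LinearMap.ker a) 0 (ind X2 p2 + ind X3 p3 + ind X4 p4)) := by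
    rw [e, res_add]; exact dg_add (dg_res hs _ _) (side_dg ha h1.le k1 _ _)
  rw [res_add, res_add, hq2, hq3, hq4] at hd
  obtain ⟨m, hm, m2, m3, m4⟩ := D_lem hs2 (codim_sub_not k2 h2) (codim_sub_not k3 h3) (codim_sub_not k4 h4) hd
  obtain ⟨n, hn⟩ := extend_fun m
  have n0 : n ≠ 0 := by
    rintro rfl; apply hm; ext x; rw [← hn]; rfl
  have n1 : n + a ≠ 0 := by
    intro h; apply hm; ext x; rw [← hn]
    have := LinearMap.congr_fun h x
    rw [LinearMap.add_apply, LinearMap.mem_ker.1 x.2, add_zero] at this; exact this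
  have t : ∀ X : Sb V, kills m (sub (LinearMap.ker a) X) → kills n X ∨ kills (n + a) X := by
    intro X hX; apply Q4_aux; intro x hx hax
    have := hX ⟨x, hax⟩ hx; rwa [← hn] at this
  rcases t _ m2 with t2 | t2 <;> rcases t _ m3 with t3 | t3 <;> rcases t _ m4 with t4 | t4
  all_goals first
    | exact n0 (kills_sup h23 t2 t3)
    | exact n1 (kills_sup h23 t2 t3)
    | exact n0 (kills_sup h24 t2 t4)
    | exact n1 (kills_sup h24 t2 t4)
    | exact n0 (kills_sup h34 t3 t4)
    | exact n1 (kills_sup h34 t3 t4)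
lemma pair_surj {X : Sb V} {a b : V →ₗ[Zt] Zt} (ha : ¬ kills a X) (hb : ¬ kills b X)
    (hab : ¬ kills (a + b) X) (c d : Zt) : ∃ x ∈ X, a x = c ∧ b x = d := by
  have key : ∃ x ∈ X, a x = 1 ∧ b x = 0 := by
    obtain ⟨u, hu, hu1⟩ := not_kills ha
    obtain ⟨t, ht, ht1⟩ := not_kills hab
    rw [LinearMap.add_apply] at ht1
    rcases z01 (b u) with h | h
    · exact ⟨u, hu, hu1, h⟩
    rcases z01 (a t) with h2 | h2
    · rw [h2, zero_add] at ht1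
      exact ⟨u + t, X.add_mem hu ht, by rw [map_add, hu1, h2]; rfl, by rw [map_add, h, ht1]; decide⟩
    · exact ⟨t, ht, h2, by rw [h2] at ht1; revert ht1; generalize b t = z; revert z; decide⟩
  obtain ⟨x, hx, hx1, hx2⟩ := key
  obtain ⟨u, hu, hu1⟩ := not_kills hb
  have key2 : ∃ x ∈ X, a x = 0 ∧ b x = 1 := by
    rcases z01 (a u) with h | h
    · exact ⟨u, hu, h, hu1⟩
    · exact ⟨x + u, X.add_mem hx hu, by rw [map_add, hx1, h]; decide, by rw [map_add, hx2, hu1]; decide⟩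
  obtain ⟨y, hy, hy1, hy2⟩ := key2
  exact ⟨c • x + d • y, X.add_mem (X.smul_mem _ hx) (X.smul_mem _ hy), by simp [hx1, hy1], by simp [hx2, hy2]⟩
lemma flat_of_con [Finite V] {s : ℕ} {f : V → Zt} (hf : dg (s + 1) f) (h0 : f ≠ 0) {X : Sb V}
    (hX : nc V = 2 ^ s * nc X) (h : ∀ a : V →ₗ[Zt] Zt, kills a X → conS a f) :
    ∃ q, f = ind X q := by
  obtain ⟨q, hq⟩ : ∃ p, f p = 1 := by
    by_contra hh; push Not at hh; exact h0 (funext fun x => zne1.1 (hh x))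
  have hsub : ∀ x, f x = 1 → ind X q x = 1 := by
    intro x hx; rw [ind1]; by_contra hn
    obtain ⟨a, ha, ha'⟩ := exists_ker hn
    obtain ⟨c, hc⟩ := h a ha'
    rw [map_add, hc x hx, hc q hq, zz] at ha; exact absurd ha (by decide)
  have hw : wt (ind X q) ≤ wt f := by
    rw [wt_ind]; have := minw hf h0; rw [hX] at this
    exact Nat.le_of_mul_le_mul_left this (by positivity)
  refine ⟨q, fun_ext1 fun x => ⟨hsub x, ?_⟩⟩
  have : {x | f x = 1} = {x | ind X q x = 1} := Set.eq_of_subset_of_ncard_le hsub hw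
  intro hx; have h2 : x ∈ {x | ind X q x = 1} := hx
  rw [← this] at h2; exact h2
lemma om_half [Finite V] (r : ℕ) {a : V →ₗ[Zt] Zt} {v : V} (hv : a v = 1) (f : V → Zt) :
    2 * om r f = om r (res (LinearMap.ker a) 0 f) + om r (res (LinearMap.ker a) v f) := by
  rw [← om_succ, om_side r hv]
lemma TT [Finite V] {s : ℕ} (hs1 : 1 ≤ s) {f : V → Zt} (hf : dg (s + 1) f) {X1 X2 : Sb V} {p1 p2 : V}
    (h1 : nc V = 2 ^ s * nc X1) (h2 : nc V = 2 ^ s * nc X2)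
    (hs : dg s (f + ind X1 p1 + ind X2 p2)) (h12 : X1 ⊔ X2 = ⊤) (ho : om s f < 2) :
    ∃ q1 q2, f = ind X1 q1 + ind X2 q2 := by
  have step : ∀ a : V →ₗ[Zt] Zt, a ≠ 0 → kills a X1 → ∃ c q, ∀ x, a x = c → (f x = 1 ↔ q + x ∈ X2) := by
    intro a ha k1
    have k2 : ¬ kills a X2 := fun h => ha (kills_sup h12 k1 h)
    obtain ⟨v, hv⟩ := exists_one ha
    have : ∃ t, om s (res (LinearMap.ker a) t f) < 2 := by
      by_contra hh; push Not at hh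
      have := om_half s hv f; have := hh 0; have := hh v; linarith
    obtain ⟨t, ht⟩ := this
    obtain ⟨k, hk⟩ := res_ind_not k2 t p2
    have hd : dg s (res (LinearMap.ker a) t f + ind (sub (LinearMap.ker a) X2) k) := by
      rw [← hk, ← res_add]
      have e : f + ind X2 p2 = f + ind X1 p1 + ind X2 p2 + ind X1 p1 := by
        rw [show f + ind X1 p1 + ind X2 p2 + ind X1 p1 = f + ind X2 p2 + (ind X1 p1 + ind X1 p1) by abel, fadd, add_zero]
      rw [e, res_add]; exact dg_add (dg_res hs _ _) (side_dg ha h1.le k1 _ _)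
    have hc := codim_sub_not k2 h2
    have hne : res (LinearMap.ker a) t f ≠ 0 := by
      intro h; rw [h, zero_add] at hd; exact not_dg_ind hc k hd
    obtain ⟨q, hq⟩ := flat_of_con (dg_res hf _ t) hne hc (by
      intro b hb
      by_cases hb0 : b = 0
      · exact ⟨0, fun x _ => by rw [hb0]; rfl⟩
      · exact L1' hb0 hc.le hb hd ht)
    refine ⟨a t, t + q, fun x hx => ?_⟩
    have hxm : t + x ∈ LinearMap.ker a := by rw [LinearMap.mem_ker, map_add, hx, zz]
    have := congrFun hq ⟨t + x, hxm⟩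
    simp only [res, vvl] at this
    rw [this, ind1, mem_sub]
    simp only [Submodule.coe_add]
    rw [show (q : V) + (t + x) = t + q + x by abel]
  obtain ⟨a0, ha0, k0⟩ := ann_ne hs1 h1
  obtain ⟨c0, q0, hq0⟩ := step a0 ha0 k0
  have hall : ∀ a : V →ₗ[Zt] Zt, a ≠ 0 → kills a X1 → ∃ c, ∀ x, a x = c → (f x = 1 ↔ q0 + x ∈ X2) := by
    intro a ha k
    by_cases e : a = a0
    · subst e; exact ⟨c0, hq0⟩
    obtain ⟨c, q, hq⟩ := step a ha k
    refine ⟨c, fun x hx => ?_⟩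
    rw [hq x hx]
    have e' : a0 + a ≠ 0 := by
      intro h; apply e; ext x; have := LinearMap.congr_fun h x
      rw [LinearMap.add_apply, LinearMap.zero_apply, zadd] at this; exact this.symm
    obtain ⟨u, hu, hu1, hu2⟩ := pair_surj (X := X2) (a := a0) (b := a) (fun h => ha0 (kills_sup h12 k0 h))
      (fun h => ha (kills_sup h12 k h)) (fun h => e' (kills_sup h12 (by
        intro x hx; rw [LinearMap.add_apply, k0 x hx, k x hx, zz]) h)) (a0 q0 + c0) (a q0 + c)
    have f1 := (hq0 (q0 + u) (by rw [map_add, hu1, ← add_assoc, zz, zero_add])).2 (by rw [vvl]; exact hu)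
    have f2 := (hq (q0 + u) (by rw [map_add, hu2, ← add_assoc, zz, zero_add])).1 f1
    have f3 : q + q0 ∈ X2 := by rw [← add_assoc] at f2; exact (X2.add_mem_iff_left hu).1 f2
    rw [show q + x = (q + q0) + (q0 + x) by rw [show (q + q0) + (q0 + x) = q + x + (q0 + q0) by abel, vv, add_zero]]
    exact X2.add_mem_iff_right f3
  set κ := f + ind X2 q0 with hκ
  have hκf : f = κ + ind X2 q0 := by rw [hκ, add_assoc, fadd, add_zero]
  have hκd : dg (s + 1) κ := dg_add hf (ind_dg h2.le _)
  have hκ0 : κ ≠ 0 := by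
    intro h; rw [h, zero_add] at hκf
    apply not_dg_ind h1 p1
    have := dg_add hs (ind_shift (ind_dg h2.le p2) q0)
    rwa [hκf, show ind X2 q0 + ind X1 p1 + ind X2 p2 + (ind X2 p2 + ind X2 q0) = ind X1 p1 + (ind X2 q0 + ind X2 q0) + (ind X2 p2 + ind X2 p2) by abel,
      fadd, fadd, add_zero, add_zero] at this
  obtain ⟨q1, hq1⟩ := flat_of_con hκd hκ0 h1 (by
    intro a k
    by_cases ha : a = 0
    · exact ⟨0, fun x _ => by rw [ha]; rfl⟩
    obtain ⟨c, hc⟩ := hall a ha k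
    refine ⟨c + 1, fun x hx => ?_⟩
    have : a x ≠ c := by
      intro h; have := hc x h; rw [← ind1] at this
      rw [hκ, Pi.add_apply] at hx
      revert hx this; generalize f x = a; generalize ind X2 q0 x = b; revert a b; decide
    revert this; generalize a x = z; clear * -; revert z c; decide)
  exact ⟨q1, q0, by rw [← hq1]; exact hκf⟩
def Van (f : V → Zt) (k : ℕ) : Prop :=
  ∃ (K : Sb V) (p : V), nc V = 2 ^ k * nc K ∧ ∀ x ∈ K, f (p + x) = 0
lemma van_trans {f : V → Zt} {k : ℕ} {p : V} (h : Van (fun x => f (p + x)) k) : Van f k := by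
  obtain ⟨K, q, h1, h2⟩ := h
  exact ⟨K, p + q, h1, fun x hx => by have := h2 x hx; simp only [← add_assoc] at this; exact this⟩
lemma van_zero [Finite V] {f : V → Zt} {k : ℕ} {K : Sb V} (hK : nc V = 2 ^ (k + 1) * nc K)
    (h : ∀ x ∈ K, f x = 0) {y : V} (hy : y ∉ K) (h2 : res K y f = 0) : Van f k := by
  refine ⟨ad K y, 0, by rw [card_ad hy, hK]; ring, fun x hx => ?_⟩
  rw [zero_add]
  rcases mem_ad.1 hx with h3 | h3
  · exact h x h3
  · have := congrFun h2 ⟨y + x, h3⟩; simpa [res, vvl] using this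
lemma line_lem [Finite V] {f : V → Zt} {k : ℕ} {K : Sb V} (hK : nc V = 2 ^ (k + 1) * nc K)
    (h : ∀ x ∈ K, f x = 0) {y1 y2 : V} (hy1 : y1 ∉ K) (hy2 : y2 ∉ K) (hy3 : y1 + y2 ∉ K)
    {m : K →ₗ[Zt] Zt} (hm : m ≠ 0) (c1 : conS m (res K y1 f)) (c2 : conS m (res K y2 f))
    (c3 : conS m (res K (y1 + y2) f)) : Van f k := by
  obtain ⟨c1, c1'⟩ := c1
  obtain ⟨c2, c2'⟩ := c2
  obtain ⟨c3, c3'⟩ := c3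
  obtain ⟨n, hn⟩ := extend_fun m
  obtain ⟨⟨v, hvK⟩, hv⟩ := exists_one hm
  rw [← hn] at hv; simp only [] at hv
  have tr : ∀ {y c}, (∀ x, res K y f x = 1 → m x = c) → ∀ x ∈ K, n x = c + 1 → f (y + x) = 0 := by
    intro y c hc x hx hnx
    by_contra h1
    have := hc ⟨x, hx⟩ (zne.1 h1); rw [← hn] at this; simp only [] at this
    rw [this] at hnx; revert hnx; clear * -; revert c; decide
  set u : Zt → V := fun c => c • v
  have uK : ∀ c, u c ∈ K := fun c => K.smul_mem _ hvK
  have nu : ∀ c, n (u c) = c := fun c => by simp [u, hv]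
  set m0 := c1 + c2 + c3 + 1
  set u0 := u m0
  set u1 := u (c1 + 1 + m0)
  set u2 := u (c2 + 1 + m0)
  set M := K ⊓ LinearMap.ker n with hM
  have hMK : M ≤ K := inf_le_left
  have hMn : ∀ x ∈ M, n x = 0 := fun x hx => hx.2
  have cM : nc K = 2 * nc M := by
    have hk : ¬ kills n K := fun hh => by rw [hh v hvK] at hv; exact absurd hv (by decide)
    rw [card_sub_not hk, card_sub]
  have i1 : y1 + u1 ∉ K := fun hh => hy1 ((K.add_mem_iff_left (uK _)).1 hh)
  have i2 : y2 + u2 ∉ K := fun hh => hy2 ((K.add_mem_iff_left (uK _)).1 hh)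
  have i3 : y1 + u1 + (y2 + u2) ∉ K := fun hh => hy3 (by
    rw [show y1 + u1 + (y2 + u2) = (y1 + y2) + (u1 + u2) by abel] at hh
    exact (K.add_mem_iff_left (K.add_mem (uK _) (uK _))).1 hh)
  refine ⟨ad (ad M (y1 + u1)) (y2 + u2), u0, ?_, ?_⟩
  · rw [card_ad, card_ad (fun hh => i1 (hMK hh)), hK, cM]; · ring
    rw [mem_ad]; rintro (hh | hh)
    · exact i2 (hMK hh)
    · exact i3 (hMK hh)
  · intro x hx
    rw [mem_ad, mem_ad, mem_ad] at hx
    rcases hx with (hx | hx) | (hx | hx)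
    · exact h _ (K.add_mem (uK _) (hMK hx))
    · have := tr c1' (u0 + (u1 + (y1 + u1 + x))) (K.add_mem (uK _) (K.add_mem (uK _) (hMK hx))) (by
        rw [map_add, map_add, hMn _ hx, nu, nu]; generalize m0 = z; clear * -; revert z c1; decide)
      rwa [show y1 + (u0 + (u1 + (y1 + u1 + x))) = u0 + x + (y1 + y1) + (u1 + u1) by abel, vv, vv, add_zero, add_zero] at this
    · have := tr c2' (u0 + (u2 + (y2 + u2 + x))) (K.add_mem (uK _) (K.add_mem (uK _) (hMK hx))) (by
        rw [map_add, map_add, hMn _ hx, nu, nu]; generalize m0 = z; clear * -; revert z c2; decide)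
      rwa [show y2 + (u0 + (u2 + (y2 + u2 + x))) = u0 + x + (y2 + y2) + (u2 + u2) by abel, vv, vv, add_zero, add_zero] at this
    · have := tr c3' (u0 + (u1 + u2 + (y1 + u1 + (y2 + u2 + x)))) (K.add_mem (uK _) (K.add_mem (K.add_mem (uK _) (uK _)) (hMK hx))) (by
        rw [map_add, map_add, map_add, hMn _ hx, nu, nu, nu]
        simp only [m0]; clear * -; revert c1 c2 c3; decide)
      rwa [show y1 + y2 + (u0 + (u1 + u2 + (y1 + u1 + (y2 + u2 + x)))) = u0 + x + (y1 + y1) + (u1 + u1) + (y2 + y2) + (u2 + u2) by abel,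
        vv, vv, vv, vv, add_zero, add_zero, add_zero, add_zero] at this
lemma card_pow (V : Type) [AddCommGroup V] [Module Zt V] [Finite V] : ∃ n, nc V = 2 ^ n := by
  refine ⟨Module.finrank (Zt) V, ?_⟩
  rw [Module.natCard_eq_pow_finrank (K := Zt)]; simp
lemma card_sup_inf [Finite V] (A B : Sb V) :
    nc (A ⊔ B : Sb V) * nc (A ⊓ B : Sb V) = nc A * nc B := by
  rw [Module.natCard_eq_pow_finrank (K := Zt) (V := (A ⊔ B : Sb V)),
    Module.natCard_eq_pow_finrank (K := Zt) (V := (A ⊓ B : Sb V)),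
    Module.natCard_eq_pow_finrank (K := Zt) (V := A), Module.natCard_eq_pow_finrank (K := Zt) (V := B),
    ← pow_add, ← pow_add, Submodule.finrank_sup_add_finrank_inf_eq]
lemma card_top [Finite V] : nc (⊤ : Sb V) = nc V := by simp
lemma wt_compl' [Finite V] (g : V → Zt) : wt (g + 1) + wt g = nc V := by
  have := wt_add_mul g 1; rw [mul_one, wt_one] at this; omega
lemma affine_cases [Finite V] {g : V → Zt} (hg : dg 2 g) : g = 0 ∨ g = 1 ∨ 2 * wt g = nc V := by
  by_cases h0 : g = 0
  · exact Or.inl h0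
  by_cases h1 : g = 1
  · exact Or.inr (Or.inl h1)
  right; right
  have e1 := minw (s := 1) hg h0
  have e2 := minw (s := 1) (f := g + 1) (dg_add hg (dg_const 1 1)) (by
    intro h; apply h1; funext x; have := congrFun h x; exact zadd.1 this)
  have := wt_compl' g; omega
noncomputable def chi (f : V → Zt) : ℤ := nc V - 2 * wt f
lemma chi_compl [Finite V] (g : V → Zt) : chi (g + 1) = - chi g := by
  have := wt_compl' g; unfold chi; omega
def es (a : Zt) : ℤ := if a = 0 then 1 else -1
lemma es_add (a b : Zt) : es (a + b) = es a * es b := by revert a b; decide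
lemma chi_sum [Fintype V] (f : V → Zt) : chi f = ∑ x, es (f x) := by
  classical
  have h : ∀ x, es (f x) = 1 - 2 * (if f x = 1 then 1 else 0) := by
    intro x; generalize f x = a; revert a; decide
  simp only [h, Finset.sum_sub_distrib, ← Finset.mul_sum, Finset.sum_boole]
  unfold chi wt
  rw [Set.ncard_eq_toFinset_card', Nat.card_eq_fintype_card]
  simp
lemma chi_sq [Fintype V] (f : V → Zt) : chi f ^ 2 = ∑ a, chi (D a f) := by
  have : ∀ a, chi (D a f) = ∑ x, es (f (x + a)) * es (f x) := by
    intro a; rw [chi_sum]; simp only [D, es_add]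
  simp only [this]
  rw [Finset.sum_comm, sq, chi_sum, Finset.sum_mul_sum]
  refine Finset.sum_congr rfl fun x _ => ?_
  rw [← Equiv.sum_comp (Equiv.addLeft x)]
  refine Finset.sum_congr rfl fun y _ => ?_
  simp [mul_comm]
def rad (f : V → Zt) : Sb V :=
  { carrier := {a | ∀ x y, D a f x = D a f y}
    add_mem' := by
      intro a b ha hb x y
      have h1 := ha (x + b) (y + b); have h2 := hb x y
      simp only [D] at *
      rw [show x + (a + b) = x + b + a by abel, show y + (a + b) = y + b + a by abel]
      have h3 : (2 : Zt) = 0 := rfl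
      linear_combination h1 + h2 - (f (x+b) - f (y+b)) * h3
    zero_mem' := by intro x y; simp [D, zz]
    smul_mem' := by
      intro c a ha
      rcases z01 c with rfl | rfl
      · intro x y; simp [D, zz]
      · simpa using ha }
lemma mem_rad {f : V → Zt} {a : V} : a ∈ rad f ↔ dg 1 (D a f) := by
  rw [dg_one]; rfl
lemma chi_quad [Finite V] {f : V → Zt} (hf : dg 3 f) :
    chi f = 0 ∨ chi f ^ 2 = nc V * nc (rad f) := by
  haveI := Fintype.ofFinite V
  classical
  by_cases h : ∃ b, D b f = 1
  · left
    obtain ⟨b, hb⟩ := h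
    have h1 : ∀ a, chi (D (a + b) f) = - chi (D a f) := by
      intro a
      have : D (a + b) f = (fun x => (D a f) (b + x)) + 1 := by
        funext x; have := congrFun hb x
        simp only [D, Pi.add_apply, Pi.one_apply] at this ⊢
        rw [← this, show b + x + a = x + (a + b) by abel, show b + x = x + b by abel, add_assoc]
        rw [← add_assoc (f (x + b)), zz, zero_add]
      rw [this, chi_compl]; unfold chi; rw [wt_trans]
    have h2 := chi_sq f
    have h3 : ∑ a, chi (D a f) = ∑ a, chi (D (a + b) f) := (Equiv.sum_comp (Equiv.addRight b) _).symm
    simp only [h1, Finset.sum_neg_distrib] at h3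
    have : chi f ^ 2 = 0 := by omega
    exact pow_eq_zero_iff (by norm_num) |>.1 this
  · right
    push Not at h
    rw [chi_sq]
    have h1 : ∀ a, chi (D a f) = if a ∈ rad f then (nc V : ℤ) else 0 := by
      intro a
      rcases affine_cases (hf a) with h0 | h0 | h0
      · rw [if_pos (mem_rad.2 (by rw [h0]; exact dg_zero _)), h0]
        unfold chi; rw [wt_eq_zero.2 rfl]; simp
      · exact absurd h0 (h a)
      · rw [if_neg]
        · unfold chi; omega
        · intro hm
          have hc := dg_one.1 (mem_rad.1 hm)
          have hN := card_pos' (V := V)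
          by_cases h2 : ∃ x, D a f x = 1
          · obtain ⟨x, hx⟩ := h2
            have : D a f = 1 := by funext y; rw [hc y x, hx]; rfl
            exact h a this
          · push Not at h2
            have : D a f = 0 := funext fun x => zne1.1 (h2 x)
            rw [wt_eq_zero.2 this] at h0; omega
    simp only [h1]
    rw [← Finset.sum_filter, Finset.sum_const, nsmul_eq_mul, mul_comm]
    congr 2
    rw [Nat.card_eq_fintype_card, Fintype.card_subtype]
noncomputable def bet (f : V → Zt) : ℚ := chi f / nc V
lemma om2_bet [Finite V] (f : V → Zt) : om 2 f = 2 - 2 * bet f := by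
  unfold om bet chi; have : (nc V : ℚ) ≠ 0 := by exact_mod_cast card_pos'.ne'
  push_cast; field_simp; ring
lemma quad [Finite V] {f : V → Zt} (hf : dg 3 f) :
    bet f = 0 ∨ ∃ h : ℕ, 4 ^ h * nc (rad f) = nc V ∧ (bet f = 1 / 2 ^ h ∨ bet f = - (1 / 2 ^ h)) := by
  rcases chi_quad hf with h | h
  · left; unfold bet; rw [h]; simp
  right
  obtain ⟨n, hn⟩ := card_pow V
  obtain ⟨m, hm⟩ := card_pow (rad f)
  have h1 : (chi f).natAbs ^ 2 = 2 ^ (n + m) := by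
    zify; rw [sq_abs, h, hn, hm]; push_cast; ring
  have h2 : (chi f).natAbs ∣ 2 ^ (n + m) := ⟨(chi f).natAbs, by rw [← h1, sq]⟩
  obtain ⟨j, hj, hj'⟩ := (Nat.dvd_prime_pow Nat.prime_two).1 h2
  rw [hj', ← pow_mul] at h1
  have h3 : j * 2 = n + m := Nat.pow_right_injective (le_refl 2) h1
  have hmn : m ≤ n := by
    have : nc (rad f) ≤ nc V := Nat.card_le_card_of_injective _ (Subtype.val_injective)
    rw [hn, hm] at this; exact (Nat.pow_le_pow_iff_right (by norm_num)).1 this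
  refine ⟨n - j, ?_, ?_⟩
  · rw [hm, hn, show (4 : ℕ) = 2 ^ 2 by norm_num, ← pow_mul, ← pow_add]; congr 1; omega
  · have e : (2 : ℚ) ^ n = 2 ^ (n - j) * 2 ^ j := by rw [← pow_add]; congr 1; omega
    have hb : bet f = chi f / 2 ^ n := by unfold bet; rw [hn]; push_cast; rfl
    rcases Int.natAbs_eq (chi f) with h4 | h4
    · left; rw [hb, h4, hj', e]; push_cast; field_simp
    · right; rw [hb, h4, hj', e]; push_cast; field_simp
lemma quad_ratio [Finite V] {f g : V → Zt} {X : Sb V} {p : V} (hX : nc V = 4 * nc X)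
    (h : dg 2 (f + g + ind X p)) {i j : ℕ} (hi : 4 ^ i * nc (rad f) = nc V)
    (hj : 4 ^ j * nc (rad g) = nc V) : i ≤ j + 1 := by
  have h1 : rad g ⊓ X ≤ rad f := by
    rintro a ⟨h1, h2⟩
    have h1 := mem_rad.1 h1
    rw [mem_rad]
    have h3 := dg_add (h a) h1
    have : D a (f + g + ind X p) + D a g = D a f := by
      have := D_ind_mem h2 p
      funext x; have := congrFun this x; simp only [D, Pi.add_apply, Pi.zero_apply] at this ⊢
      rw [show f (x + a) + g (x + a) + ind X p (x + a) + (f x + g x + ind X p x) + (g (x + a) + g x) =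
        f (x + a) + f x + (ind X p (x+a) + ind X p x) + (g (x+a) + g (x + a)) + (g x + g x) by ring, this, zz, zz]; simp
    rwa [this] at h3
  have h2 := card_le_of_le h1
  have h3 := card_sup_inf (rad g) X
  have h4 : nc (rad g ⊔ X : Sb V) ≤ nc V := Nat.card_le_card_of_injective _ (Subtype.val_injective)
  have hN := card_pos' (V := V)
  set S := nc (rad g ⊔ X : Sb V)
  set I := nc (rad g ⊓ X : Sb V)
  have hxp := card_pos' (V := X)
  have h5 : nc (rad g) ≤ 4 * nc (rad f) := by
    have : nc (rad g) * nc X ≤ 4 * nc (rad f) * nc X := by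
      calc _ = S * I := h3.symm
        _ ≤ nc V * nc (rad f) := Nat.mul_le_mul h4 h2
        _ = _ := by rw [hX]; ring
    exact Nat.le_of_mul_le_mul_right this hxp
  have h6 : 4 ^ i * nc (rad f) ≤ 4 ^ (j + 1) * nc (rad f) := by
    calc _ = 4 ^ j * nc (rad g) := by rw [hi, hj]
      _ ≤ 4 ^ j * (4 * nc (rad f)) := by gcongr
      _ = _ := by ring
  have := Nat.le_of_mul_le_mul_right h6 card_pos'
  exact (Nat.pow_le_pow_iff_right (by norm_num)).1 this
lemma drop1 {s : ℕ} {f : V → Zt} (hf : dg (s + 1) f) {K : Sb V} (h : ∀ x ∈ K, f x = 0) (y : V) :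
    dg s (res K y f) := by
  have := dg_res (hf y) K 0
  have e : res K 0 (D y f) = res K y f := by
    funext x; simp only [res, D, zero_add]; rw [h x x.2, add_zero, add_comm]
  rwa [e] at this
lemma drop4 {s : ℕ} {f : V → Zt} (hf : dg (s + 2) f) (K : Sb V) (a b c : V) :
    dg s (res K a f + res K b f + res K c f + res K (a + b + c) f) := by
  have := dg_res (hf (a + b) (a + c)) K a
  have e : res K a (D (a + c) (D (a + b) f)) = res K a f + res K b f + res K c f + res K (a + b + c) f := by
    funext x; simp only [res, D, Pi.add_apply]
    rw [show a + x.1 + (a + c) + (a + b) = (a + a) + (a + b + c + x) by abel,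
      show a + x.1 + (a + c) = (a + a) + (c + x) by abel, show a + x.1 + (a + b) = (a + a) + (b + x) by abel, vv, zero_add, zero_add, zero_add]
    ring
  rwa [e] at this
lemma drop2 {s : ℕ} {f : V → Zt} (hf : dg (s + 2) f) {K : Sb V} (h : ∀ x ∈ K, f x = 0) (a b : V) :
    dg s (res K a f + res K b f + res K (a + b) f) := by
  have := drop4 hf K a b 0
  have e : res K 0 f = 0 := by funext x; simp only [res, zero_add]; exact h x x.2
  rwa [e, add_zero, add_zero] at this
lemma setup [Finite V] {f : V → Zt} (h : ∃ x, f x = 0) :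
    ∃ (k : ℕ) (K : Sb V) (p : V), nc V = 2 ^ k * nc K ∧ (∀ x ∈ K, f (p + x) = 0) ∧
      ∀ j < k, ¬ Van f j := by
  classical
  have : ∃ k, Van f k := by
    obtain ⟨x, hx⟩ := h
    obtain ⟨n, hn⟩ := card_pow V
    refine ⟨n, ⊥, x, by simp [hn], fun y hy => ?_⟩
    rw [(Submodule.mem_bot _).1 hy, add_zero, hx]
  obtain ⟨K, p, h1, h2⟩ := Nat.find_spec this
  exact ⟨Nat.find this, K, p, h1, h2, fun j hj => Nat.find_min this hj⟩
lemma zero_of_om [Finite V] {r : ℕ} {f : V → Zt} (h : om r f < 2 ^ r) : ∃ x, f x = 0 := by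
  by_contra hh; push Not at hh
  have : f = 1 := funext fun x => zne.1 (hh x)
  rw [this] at h; unfold om at h; rw [wt_one, mul_div_assoc, div_self (by exact_mod_cast card_pos'.ne')] at h; linarith
lemma wt_sum [Finite V] {C K : Sb V} (hC : IsCompl C K) (f : V → Zt) :
    wt f = ∑ c ∈ (Set.toFinite (C : Set V)).toFinset, w K c f := by
  classical
  have h1 : ∀ x : V, ∃ c ∈ C, c + x ∈ K := by
    intro x
    have : x ∈ C ⊔ K := by rw [hC.sup_eq_top]; trivial
    obtain ⟨c, hc, k, hk, rfl⟩ := Submodule.mem_sup.1 this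
    exact ⟨c, hc, by rw [vvl]; exact hk⟩
  choose π hπ hπ2 using h1
  have h2 : ∀ x, ∀ c ∈ C, (π x = c ↔ c + x ∈ K) := by
    intro x c hc; constructor
    · rintro rfl; exact hπ2 x
    · intro h
      have h3 := K.add_mem (hπ2 x) h
      rw [show π x + x + (c + x) = π x + c + (x + x) by abel, vv, add_zero] at h3
      have := Submodule.disjoint_def.1 hC.disjoint _ (C.add_mem (hπ x) hc) h3
      exact vv0.1 this
  unfold wt w
  rw [Set.ncard_eq_toFinset_card _ (Set.toFinite _)]
  rw [Finset.card_eq_sum_card_fiberwise (f := π) (t := (Set.toFinite (C : Set V)).toFinset) (by intro x _; simpa using hπ x)]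
  refine Finset.sum_congr rfl fun c hc => ?_
  have hc' : c ∈ C := by simpa using hc
  rw [Set.ncard_eq_toFinset_card _ (Set.toFinite _)]
  congr 1; ext x
  simp [h2 x c hc']
lemma conS_ind {a : V →ₗ[Zt] Zt} {X : Sb V} (h : kills a X) (p : V) : conS a (ind X p) := by
  refine ⟨a p, fun x hx => ?_⟩
  have := h _ (ind1.1 hx); rw [map_add, zadd] at this; exact this.symm
lemma noline [Finite V] {s : ℕ} (hs : 2 ≤ s) {f : V → Zt} (hf : dg (s + 2) f) {k : ℕ} {K : Sb V}
    (hK : nc V = 2 ^ (k + 1) * nc K) (h0 : ∀ x ∈ K, f x = 0) (hV : ¬ Van f k) {y1 y2 : V} (hy1 : y1 ∉ K)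
    (hy2 : y2 ∉ K) (hy3 : y1 + y2 ∉ K) (o1 : om s (res K y1 f) = 1) (o2 : om s (res K y2 f) = 1)
    (o3 : om s (res K (y1 + y2) f) = 1) : False := by
  obtain ⟨X1, p1, e1, c1⟩ := om_flat (drop1 hf h0 y1) o1
  obtain ⟨X2, p2, e2, c2⟩ := om_flat (drop1 hf h0 y2) o2
  obtain ⟨X3, p3, e3, c3⟩ := om_flat (drop1 hf h0 (y1 + y2)) o3
  have := drop2 hf h0 y1 y2
  rw [e1, e2, e3] at this
  obtain ⟨a, ha, k1, k2, k3⟩ := D_lem hs c1 c2 c3 this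
  exact hV (line_lem hK h0 hy1 hy2 hy3 ha (e1 ▸ conS_ind k1 p1) (e2 ▸ conS_ind k2 p2) (e3 ▸ conS_ind k3 p3))
open Classical in
lemma sum_setup [Finite V] (s : ℕ) {f : V → Zt} {k : ℕ} {K : Sb V}
    (hK : nc V = 2 ^ k * nc K) (h0 : ∀ x ∈ K, f x = 0) :
    ∃ C : Finset V, C.card = 2 ^ k ∧ 0 ∈ C ∧ (∀ x ∈ C, ∀ y ∈ C, x + y ∈ C) ∧ (∀ x ∈ C, x ≠ 0 → x ∉ K) ∧
      2 ^ k * om (s + 1) f = 2 * ∑ c ∈ C.filter (· ≠ 0), om s (res K c f) := by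
  obtain ⟨C, hC⟩ := Submodule.exists_isCompl K
  have hm : ∀ x, x ∈ (Set.toFinite (C : Set V)).toFinset ↔ x ∈ C := by intro x; simp
  have hKp : (nc K : ℚ) ≠ 0 := by exact_mod_cast card_pos'.ne'
  refine ⟨(Set.toFinite (C : Set V)).toFinset, ?_, (hm 0).2 C.zero_mem, ?_, ?_, ?_⟩
  · have := wt_sum hC.symm (1 : V → Zt)
    simp only [w_one, wt_one, hK, Finset.sum_const, smul_eq_mul] at this
    exact (Nat.eq_of_mul_eq_mul_right card_pos' this).symm
  · intro x hx y hy; rw [hm] at *; exact C.add_mem hx hy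
  · intro x hx hx0 hxK; exact hx0 (Submodule.disjoint_def.1 hC.disjoint _ hxK ((hm x).1 hx))
  · have h1 := wt_sum hC.symm f
    have h2 : ∑ c ∈ (Set.toFinite (C : Set V)).toFinset, w K c f = ∑ c ∈ (Set.toFinite (C : Set V)).toFinset.filter (· ≠ 0), w K c f := by
      symm; apply Finset.sum_filter_of_ne
      intro x _ hx hx0; subst hx0; apply hx
      rw [← wt_res, wt_eq_zero]; funext x; simp only [res, zero_add]; exact h0 x x.2
    rw [h2] at h1
    unfold om; rw [h1, hK]; simp only [wt_res]; push_cast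
    rw [← Finset.sum_div, ← Finset.mul_sum]; field_simp; ring
lemma sum1 [Finite V] (s : ℕ) {f : V → Zt} {K : Sb V}
    (hK : nc V = 2 * nc K) (h0 : ∀ x ∈ K, f x = 0) {y : V} (hy : y ∉ K) :
    om (s + 1) f = om s (res K y f) := by
  have h1 : ad K y = ⊤ := eq_of_le_card le_top (by rw [card_ad hy, card_top, hK])
  have h2 := w_ad hy 0 f
  have h3 : w K 0 f = 0 := by
    rw [← wt_res, wt_eq_zero]; funext x; simp only [res, zero_add]; exact h0 x x.2
  rw [h1, w_top, h3, zero_add, zero_add] at h2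
  have hKp : (nc K : ℚ) ≠ 0 := by exact_mod_cast card_pos'.ne'
  unfold om; rw [wt_res, h2, hK]; push_cast; field_simp; ring
lemma nmem_ad {K : Sb V} {y1 y2 : V} (h2 : y2 ∉ K) (h3 : y1 + y2 ∉ K) : y2 ∉ ad K y1 := by
  rw [mem_ad]; tauto
lemma sum2 [Finite V] (s : ℕ) {f : V → Zt} {K : Sb V}
    (hK : nc V = 4 * nc K) (h0 : ∀ x ∈ K, f x = 0) {y1 y2 : V} (hy1 : y1 ∉ K) (hy2 : y2 ∉ K) (hy3 : y1 + y2 ∉ K) :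
    2 * om (s + 1) f = om s (res K y1 f) + om s (res K y2 f) + om s (res K (y1 + y2) f) := by
  have hy := nmem_ad hy2 hy3
  have h1 : ad (ad K y1) y2 = ⊤ := eq_of_le_card le_top (by rw [card_ad hy, card_ad hy1, card_top, hK]; omega)
  have h2 := w_ad hy 0 f
  have h3 : w K 0 f = 0 := by
    rw [← wt_res, wt_eq_zero]; funext x; simp only [res, zero_add]; exact h0 x x.2
  rw [h1, w_top, w_ad hy1, w_ad hy1, h3, zero_add, zero_add, zero_add, add_comm y2] at h2
  have hKp : (nc K : ℚ) ≠ 0 := by exact_mod_cast card_pos'.ne'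
  unfold om; rw [wt_res, wt_res, wt_res, h2, hK]; push_cast; field_simp; ring
lemma exists_plane [Finite V] {K : Sb V} (hK : nc V = 4 * nc K) :
    ∃ y1 y2, y1 ∉ K ∧ y2 ∉ K ∧ y1 + y2 ∉ K := by
  have hp := card_pos' (V := K)
  have h1 : ∃ y, y ∉ K := by
    by_contra hh; push Not at hh
    have : K = ⊤ := eq_top_iff.2 fun x _ => hh x
    rw [this, card_top] at hK; have := card_pos' (V := V); omega
  obtain ⟨y1, hy1⟩ := h1
  have h2 : ∃ y, y ∉ ad K y1 := by
    by_contra hh; push Not at hh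
    have : ad K y1 = ⊤ := eq_top_iff.2 fun x _ => hh x
    have h3 := card_ad hy1; rw [this, card_top] at h3; omega
  obtain ⟨y2, hy2⟩ := h2
  rw [mem_ad] at hy2; push Not at hy2
  exact ⟨y1, y2, hy1, hy2.1, hy2.2⟩
open Classical in
lemma kge3 [Finite V] {s : ℕ} (hs : 2 ≤ s) {f : V → Zt} (hf : dg (s + 2) f) {k : ℕ} (hk : 2 ≤ k) {K : Sb V}
    (hK : nc V = 2 ^ (k + 1) * nc K) (h0 : ∀ x ∈ K, f x = 0) (hV : ¬ Van f k)
    (hKT : ∀ y ∉ K, om s (res K y f) = 1 ∨ 3 / 2 ≤ om s (res K y f)) (ho : om (s + 1) f < 2) : False := by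
  obtain ⟨C, cC, C0, Ca, CK, hsum⟩ := sum_setup s hK h0
  set B := (C.filter (· ≠ 0)).filter (fun c => om s (res K c f) ≠ 1) with hB
  have hB1 : B.card ≤ 1 := by
    have h1 : ∑ c ∈ C.filter (· ≠ 0), (1 + if om s (res K c f) ≠ 1 then (1/2 : ℚ) else 0) ≤ ∑ c ∈ C.filter (· ≠ 0), om s (res K c f) := by
      apply Finset.sum_le_sum; intro c hc
      rw [Finset.mem_filter] at hc
      rcases hKT c (CK c hc.1 hc.2) with h | h
      · simp [h]
      · split_ifs <;> linarith
    rw [Finset.sum_add_distrib, ← Finset.sum_filter, ← hB] at h1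
    simp only [Finset.sum_const, nsmul_eq_mul, mul_one] at h1
    have h2 : (C.filter (· ≠ 0)).card + 1 = 2 ^ (k + 1) := by
      rw [Finset.filter_ne', Finset.card_erase_add_one C0, cC]
    have h2' : ((C.filter (· ≠ 0)).card : ℚ) + 1 = 2 ^ (k + 1) := by exact_mod_cast h2
    have h3 : (2 : ℚ) ^ (k+1) * om (s + 1) f < 2 ^ (k + 1) * 2 := by gcongr
    have : (B.card : ℚ) < 2 := by linarith
    have : B.card < 2 := by exact_mod_cast this
    omega
  obtain ⟨n, hn⟩ : ∃ n, ∀ c ∈ C, c ≠ 0 → c ≠ n → om s (res K c f) = 1 := by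
    rcases B.eq_empty_or_nonempty with h | ⟨n, hn⟩
    · refine ⟨0, fun c hc hc0 _ => ?_⟩
      by_contra h1
      have : c ∈ B := by rw [hB, Finset.mem_filter, Finset.mem_filter]; exact ⟨⟨hc, hc0⟩, h1⟩
      rw [h] at this; simp at this
    · refine ⟨n, fun c hc hc0 hcn => ?_⟩
      by_contra h1
      have : c ∈ B := by rw [hB, Finset.mem_filter, Finset.mem_filter]; exact ⟨⟨hc, hc0⟩, h1⟩
      exact hcn (Finset.card_le_one.1 hB1 _ this _ hn)
  have h8 : 8 ≤ C.card := by
    rw [cC]; calc 8 = 2 ^ 3 := by norm_num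
      _ ≤ _ := Nat.pow_le_pow_right (by norm_num) (by omega)
  obtain ⟨y1, hy1, hy1'⟩ := Finset.exists_mem_notMem_of_card_lt_card (s := ({0, n} : Finset V)) (t := C)
    (lt_of_le_of_lt Finset.card_le_two (by omega))
  obtain ⟨y2, hy2, hy2'⟩ := Finset.exists_mem_notMem_of_card_lt_card (s := ({0, n, y1, y1 + n} : Finset V)) (t := C)
    (lt_of_le_of_lt Finset.card_le_four (by omega))
  simp only [Finset.mem_insert, Finset.mem_singleton, not_or] at hy1' hy2'
  have h3 : y1 + y2 ≠ 0 := fun h => hy2'.2.2.1 (vv0.1 h).symm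
  have h4 : y1 + y2 ≠ n := fun h => hy2'.2.2.2 (by rw [← h, vvl])
  have m3 := Ca _ hy1 _ hy2
  exact noline hs hf hK h0 hV (CK _ hy1 hy1'.1) (CK _ hy2 hy2'.1) (CK _ m3 h3) (hn _ hy1 hy1'.1 hy1'.2)
    (hn _ hy2 hy2'.1 hy2'.2.1) (hn _ m3 h3 h4)
lemma res_ne [Finite V] {f : V → Zt} {k : ℕ} {K : Sb V} (hK : nc V = 2 ^ (k + 1) * nc K)
    (h : ∀ x ∈ K, f x = 0) (hV : ¬ Van f k) {y : V} (hy : y ∉ K) : res K y f ≠ 0 :=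
  fun h2 => hV (van_zero hK h hy h2)
lemma exists_notin [Finite V] {K : Sb V} {k : ℕ} (hK : nc V = 2 ^ (k + 1) * nc K) : ∃ y, y ∉ K := by
  by_contra hh; push Not at hh
  have : K = ⊤ := eq_top_iff.2 fun x _ => hh x
  rw [this, card_top] at hK; have := card_pos' (V := V)
  have : 2 ^ 1 ≤ 2 ^ (k + 1) := Nat.pow_le_pow_right (by norm_num) (by omega)
  nlinarith
lemma setup0 [Finite V] {f : V → Zt} (hne : f ≠ 0) (h : ∃ x, f x = 0) :
    ∃ (k : ℕ) (K : Sb V) (p : V), nc V = 2 ^ (k + 1) * nc K ∧ (∀ x ∈ K, (fun x => f (p + x)) x = 0) ∧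
      ∀ j < k + 1, ¬ Van (fun x => f (p + x)) j := by
  obtain ⟨k, K, p, h1, h2, h3⟩ := setup h
  rcases k with _ | k
  · exfalso; apply hne
    have : K = ⊤ := eq_of_le_card le_top (by rw [card_top]; omega)
    subst this; funext x; have := h2 (p + x) trivial; rwa [vvl] at this
  · exact ⟨k, K, p, h1, h2, fun j hj hv => h3 j hj (van_trans hv)⟩
lemma tr_ne {f : V → Zt} (hne : f ≠ 0) (p : V) : (fun x => f (p + x)) ≠ 0 := by
  intro h; apply hne; funext x; have := congrFun h (p + x); simpa [vvl] using this
lemma om1 [Finite V] {f : V → Zt} (hf : dg 2 f) : om 1 f = 0 ∨ om 1 f = 1 ∨ om 1 f = 2 := by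
  have hN : (nc V : ℚ) ≠ 0 := by exact_mod_cast card_pos'.ne'
  rcases affine_cases hf with h | h | h
  · left; rw [om_eq_zero, h]
  · right; right; unfold om; rw [h, wt_one]; field_simp
  · right; left; unfold om; rw [← h]; rw [← h] at hN; push_cast at hN ⊢
    have : (wt f:ℚ) ≠ 0 := by intro h; apply hN; rw [h]; ring
    field_simp
lemma half_cases {i : ℕ} : (2 : ℚ) - 1 / 2 ^ i = 1 ∨ (2 : ℚ) - 1 / 2 ^ i = 3 / 2 ∨ 7 / 4 ≤ (2 : ℚ) - 1 / 2 ^ i := by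
  rcases i with _ | _ | i
  · left; norm_num
  · right; left; norm_num
  · right; right
    have : (4 : ℚ) ≤ 2 ^ (i + 2) := by rw [pow_add]; nlinarith [one_le_pow₀ (show (1:ℚ) ≤ 2 by norm_num) (n := i)]
    have : (1 : ℚ) / 2 ^ (i + 2) ≤ 1 / 4 := one_div_le_one_div_of_le (by norm_num) this
    linarith
theorem KT (r : ℕ) : ∀ (V : Type) [AddCommGroup V] [Module Zt V] [Finite V] (f : V → Zt), dg (r + 1) f → f ≠ 0 →
    om r f < 2 → ∃ i : ℕ, om r f = 2 - 1 / 2 ^ i := by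
  induction r with
  | zero =>
    intro V _ _ _ f hf hne ho
    refine ⟨0, ?_⟩
    have h1 := om_ge hf hne
    have : om 0 f ≤ 1 := by
      unfold om; rw [div_le_one (by exact_mod_cast card_pos')]; have := wt_le_card f; simp; exact_mod_cast this
    norm_num; linarith
  | succ s ih =>
    intro V _ _ _ f hf hne ho
    rcases s with _ | _ | s
    · refine ⟨0, ?_⟩
      have h1 := om_ge hf hne
      rcases om1 hf with h | h | h
      · linarith
      · rw [h]; norm_num
      · linarith
    · have h1 := om_ge hf hne
      rw [om2_bet] at ho h1 ⊢
      rcases quad hf with h | ⟨h, -, hb | hb⟩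
      · rw [h] at ho; norm_num at ho
      · rcases h with _ | h
        · rw [hb] at h1; norm_num at h1
        · refine ⟨h, ?_⟩; rw [hb, pow_succ]; field_simp
      · have : (0 : ℚ) < 1 / 2 ^ h := by positivity
        linarith
    · set σ := s + 1 + 1 with hσ
      have hσ2 : 2 ≤ σ := by omega
      have hz : ∃ x, f x = 0 := zero_of_om (lt_of_lt_of_le ho (by
        calc (2:ℚ) = 2 ^ 1 := by norm_num
          _ ≤ 2 ^ (σ + 1) := pow_le_pow_right₀ (by norm_num) (by omega)))
      obtain ⟨k, K, p, hK, h0, hV⟩ := setup0 hne hz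
      rw [← om_trans (σ + 1) f p] at ho ⊢
      replace hf := dg_trans hf p
      generalize (fun x => f (p + x)) = g at *
      have hnz : ∀ y ∉ K, res K y g ≠ 0 := fun y hy => res_ne hK h0 (hV k (by omega)) hy
      have hd : ∀ y, dg (σ + 1) (res K y g) := fun y => drop1 hf h0 y
      have hKT : ∀ y ∉ K, om σ (res K y g) = 1 ∨ 3 / 2 ≤ om σ (res K y g) := by
        intro y hy
        by_cases h2 : om σ (res K y g) < 2
        · obtain ⟨i, hi⟩ := ih K _ (hd y) (hnz y hy) h2
          rw [hi]; rcases half_cases (i := i) with h | h | h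
          · left; exact h
          · right; linarith
          · right; linarith
        · right; linarith
      rcases k with _ | _ | k
      · obtain ⟨y, hy⟩ := exists_notin hK
        have := sum1 σ (by simpa using hK) h0 hy
        rw [this] at ho ⊢
        exact ih K _ (hd y) (hnz y hy) ho
      · have hK4 : nc V = 4 * nc K := by rw [hK]; norm_num
        obtain ⟨y1, y2, hy1, hy2, hy3⟩ := exists_plane hK4
        have hsum := sum2 σ hK4 h0 hy1 hy2 hy3
        have key : ∀ y ∉ K, 2 * om (σ + 1) g = 2 + om σ (res K y g) → ∃ i : ℕ, om (σ + 1) g = 2 - 1 / 2 ^ i := by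
          intro y hy h
          obtain ⟨i, hi⟩ := ih K _ (hd y) (hnz y hy) (by linarith)
          refine ⟨i + 1, ?_⟩
          rw [pow_succ]
          have : (1 : ℚ) / (2 ^ i * 2) = (1 / 2 ^ i) / 2 := by field_simp
          rw [this]; linarith
        rcases hKT _ hy1 with h1 | h1 <;> rcases hKT _ hy2 with h2 | h2 <;> rcases hKT _ hy3 with h3 | h3
        all_goals first
          | exact key _ hy1 (by linarith)
          | exact key _ hy2 (by linarith)
          | exact key _ hy3 (by linarith)
          | (exfalso; linarith)
      · exact (kge3 hσ2 hf (by omega) hK h0 (hV _ (by omega)) hKT ho).elim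
lemma KTc [Finite V] {r : ℕ} {f : V → Zt} (hf : dg (r + 1) f) (hne : f ≠ 0) :
    om r f = 1 ∨ om r f = 3 / 2 ∨ 7 / 4 ≤ om r f := by
  by_cases h : om r f < 2
  · obtain ⟨i, hi⟩ := KT r V f hf hne h
    rw [hi]; exact half_cases
  · right; right; linarith
open Classical in
noncomputable def lf (K : Sb V) (y : V) (h : K → Zt) : V → Zt :=
  fun x => if hx : y + x ∈ K then h ⟨y + x, hx⟩ else 0
lemma lf_add (K : Sb V) (y : V) (g h : K → Zt) : lf K y (g + h) = lf K y g + lf K y h := by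
  funext x; simp only [lf, Pi.add_apply]; split_ifs <;> simp
lemma lf_ind (K : Sb V) (y : V) (X : Sb K) (k : K) :
    lf K y (ind X k) = ind (X.map K.subtype) (y + k) := by
  apply fun_ext1; intro x
  rw [ind1, lf]
  split_ifs with hx
  · rw [ind1, Submodule.mem_map]
    constructor
    · intro h; exact ⟨_, h, by simp [add_comm, add_left_comm]⟩
    · rintro ⟨z, hz, hz'⟩
      have : z = k + ⟨y + x, hx⟩ := by
        apply Subtype.ext; simp only [Submodule.coe_add]; rw [← add_assoc, add_comm (k : V), ← hz']; rfl
      rwa [← this]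
  · constructor
    · intro h; exact absurd h (by decide)
    · intro h; exfalso; apply hx
      obtain ⟨z, hz, hz'⟩ := Submodule.mem_map.1 h
      have : y + x = k + z := by
        have : (z : V) = y + k + x := hz'
        rw [this, show (k : V) + (y + k + x) = y + x + (k + k) by abel, vv, add_zero]
      rw [this]; exact K.add_mem k.2 z.2
lemma lf_res {K : Sb V} {y : V} {g : V → Zt} (h : ∀ x, g x = 1 → y + x ∈ K) : lf K y (res K y g) = g := by
  apply fun_ext1; intro x; rw [lf]
  split_ifs with hx
  · simp only [res, vvl]
  · constructor
    · intro h; exact absurd h (by decide)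
    · intro h1; exact absurd (h x h1) hx
lemma card_map' (K : Sb V) (X : Sb K) : nc (X.map K.subtype) = nc X :=
  (Nat.card_congr (Submodule.equivMapOfInjective _ K.subtype_injective X).toEquiv).symm
lemma ind_ad {X : Sb V} {v : V} (hv : v ∉ X) (p : V) : ind (ad X v) p = ind X p + ind X (p + v) := by
  apply fun_ext1; intro x
  rw [ind1, mem_ad, Pi.add_apply]
  have h1 := ind1 (X := X) (p := p) (x := x)
  have h2 := ind1 (X := X) (p := p + v) (x := x)
  rw [show v + (p + x) = p + v + x by abel, ← h1, ← h2]
  have h3 : ¬ (ind X p x = 1 ∧ ind X (p + v) x = 1) := by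
    rintro ⟨h3, h4⟩; rw [h1] at h3; rw [h2] at h4; apply hv
    have := X.add_mem h3 h4
    rwa [show p + x + (p + v + x) = v + (p + p) + (x + x) by abel, vv, vv, add_zero, add_zero] at this
  revert h3; generalize ind X p x = a; generalize ind X (p + v) x = b; revert a b; decide
lemma lf_plane [Finite V] {K : Sb V} (hK : nc V = 4 * nc K) {f : V → Zt} (h0 : ∀ x ∈ K, f x = 0)
    {y1 y2 : V} (hy1 : y1 ∉ K) (hy2 : y2 ∉ K) (hy3 : y1 + y2 ∉ K) :
    f = lf K y1 (res K y1 f) + lf K y2 (res K y2 f) + lf K (y1 + y2) (res K (y1 + y2) f) := by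
  have hy := nmem_ad hy2 hy3
  have h1 : ad (ad K y1) y2 = ⊤ := eq_of_le_card le_top (by rw [card_ad hy, card_ad hy1, card_top, hK]; omega)
  funext x
  have hx : x ∈ ad (ad K y1) y2 := by rw [h1]; trivial
  rw [mem_ad, mem_ad, mem_ad] at hx
  have e : ∀ {a b c : V}, a ∈ K → b ∈ K → a + b = c → c ∈ K := fun ha hb hc => hc ▸ K.add_mem ha hb
  have e1 : x ∈ K → y1 + x ∉ K := fun h h' => hy1 (e h h' (by rw [add_comm y1, vvl]))
  have e2 : x ∈ K → y2 + x ∉ K := fun h h' => hy2 (e h h' (by rw [add_comm y2, vvl]))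
  have e3 : x ∈ K → y1 + y2 + x ∉ K := fun h h' => hy3 (e h h' (by rw [add_comm (y1 + y2), vvl]))
  have e4 : y1 + x ∈ K → y2 + x ∉ K := fun h h' => hy3 (e h h' (by
    rw [show y1 + x + (y2 + x) = y1 + y2 + (x + x) by abel, vv, add_zero]))
  have e5 : y1 + x ∈ K → y1 + y2 + x ∉ K := fun h h' => hy2 (e h h' (by
    rw [show y1 + x + (y1 + y2 + x) = y2 + (x + x) + (y1 + y1) by abel, vv, vv, add_zero, add_zero]))
  have e6 : y2 + x ∈ K → y1 + y2 + x ∉ K := fun h h' => hy1 (e h h' (by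
    rw [show y2 + x + (y1 + y2 + x) = y1 + (x + x) + (y2 + y2) by abel, vv, vv, add_zero, add_zero]))
  rw [← add_assoc y1] at hx
  simp only [Pi.add_apply, lf]
  rcases hx with (hx | hx) | (hx | hx)
  · rw [dif_neg (e1 hx), dif_neg (e2 hx), dif_neg (e3 hx), h0 x hx]; rfl
  · rw [dif_pos hx, dif_neg (e4 hx), dif_neg (e5 hx)]; simp [res, vvl]
  · rw [dif_pos hx, dif_neg (fun h => e4 h hx), dif_neg (e6 hx)]; simp [res, vvl]
  · rw [dif_pos hx, dif_neg (fun h => e5 h hx), dif_neg (fun h => e6 h hx)]; simp [res, vvl]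
lemma glue [Finite V] {s : ℕ} (hs : 1 ≤ s) {f : V → Zt} (hf : dg (s + 2) f) (hV : ¬ Van f 1) {K : Sb V}
    (hK : nc V = 4 * nc K) (h0 : ∀ x ∈ K, f x = 0)
    {y1 y2 : V} (hy1 : y1 ∉ K) (hy2 : y2 ∉ K) (hy3 : y1 + y2 ∉ K) (o1 : om s (res K y1 f) = 1) (o2 : om s (res K y2 f) = 1)
    (o3 : om s (res K (y1 + y2) f) < 2) :
    ∃ X1 X2 p1 p2, f = ind X1 p1 + ind X2 p2 ∧ nc V = 2 ^ (s + 1) * nc X1 ∧ nc V = 2 ^ (s + 1) * nc X2 ∧ X1 ⊔ X2 = ⊤ := by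
  obtain ⟨X1, p1, e1, c1⟩ := om_flat (drop1 hf h0 y1) o1
  obtain ⟨X2, p2, e2, c2⟩ := om_flat (drop1 hf h0 y2) o2
  have hd := drop2 hf h0 y1 y2
  rw [e1, e2, add_comm, ← add_assoc] at hd
  have h12 : X1 ⊔ X2 = ⊤ := by
    by_contra hn
    obtain ⟨a, ha, hk⟩ := exists_ker' hn
    have k1 : kills a X1 := fun x hx => hk x (Submodule.mem_sup_left hx)
    have k2 : kills a X2 := fun x hx => hk x (Submodule.mem_sup_right hx)
    exact hV (line_lem (by rw [hK]; norm_num) h0 hy1 hy2 hy3 ha (e1 ▸ conS_ind k1 p1) (e2 ▸ conS_ind k2 p2) (L1 ha c1.le c2.le k1 k2 hd o3))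
  obtain ⟨q1, q2, e3⟩ := TT hs (drop1 hf h0 _) c1 c2 hd h12 o3
  set Y1 := X1.map K.subtype with hY1
  set Y2 := X2.map K.subtype with hY2
  have hYK : ∀ X : Sb K, X.map K.subtype ≤ K := fun X => Submodule.map_subtype_le K X
  set v1 : V := y2 + (p1 + q1) with hv1
  set v2 : V := y1 + (p2 + q2) with hv2
  have n1 : v1 ∉ K := fun h => hy2 ((K.add_mem_iff_left (K.add_mem p1.2 q1.2)).1 h)
  have n2 : v2 ∉ K := fun h => hy1 ((K.add_mem_iff_left (K.add_mem p2.2 q2.2)).1 h)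
  have m1 : v1 ∉ Y1 := fun h => n1 (hYK _ h)
  have m2 : v2 ∉ Y2 := fun h => n2 (hYK _ h)
  have hKs : Y1 ⊔ Y2 = K := by
    rw [hY1, hY2, ← Submodule.map_sup, h12]; simp
  refine ⟨ad Y1 v1, ad Y2 v2, y1 + p1, y2 + p2, ?_, ?_, ?_, ?_⟩
  · rw [ind_ad m1, ind_ad m2]
    conv_lhs => rw [lf_plane hK h0 hy1 hy2 hy3, e1, e2, e3, lf_add, lf_ind, lf_ind, lf_ind, lf_ind]
    rw [show y1 + p1.1 + v1 = y1 + y2 + q1 + (p1.1 + p1.1) by rw [hv1]; abel,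
      show y2 + p2.1 + v2 = y1 + y2 + q2 + (p2.1 + p2.1) by rw [hv2]; abel, vv, vv, add_zero, add_zero]
    abel
  · rw [card_ad m1, hY1, card_map', hK, c1]; ring
  · rw [card_ad m2, hY2, card_map', hK, c2]; ring
  · rw [eq_top_iff]
    have hy := nmem_ad hy2 hy3
    have h1 : ad (ad K y1) y2 = ⊤ := eq_of_le_card le_top (by rw [card_ad hy, card_ad hy1, card_top, hK]; omega)
    rw [← h1, ad_le, ad_le]
    have hle : K ≤ ad Y1 v1 ⊔ ad Y2 v2 := by
      conv_lhs => rw [← hKs]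
      exact sup_le_sup (le_ad _ _) (le_ad _ _)
    refine ⟨⟨hle, ?_⟩, ?_⟩
    · exact (Submodule.add_mem_iff_left _ (hle (K.add_mem p2.2 q2.2))).1 (Submodule.mem_sup_right (self_mem_ad Y2 v2))
    · exact (Submodule.add_mem_iff_left _ (hle (K.add_mem p1.2 q1.2))).1 (Submodule.mem_sup_left (self_mem_ad Y1 v1))
lemma van1 [Finite V] {f : V → Zt} (h : Van f 1) : ∃ (K : Sb V) (e : V), nc V = 2 * nc K ∧
    (∀ x, f x = 1 → e + x ∈ K) ∧ (∀ s, dg (s + 1) f → dg s (res K e f)) ∧ ∀ s, om (s + 1) f = om s (res K e f) := by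
  obtain ⟨K, p, hK, h0⟩ := h
  have hK' : nc V = 2 ^ (0 + 1) * nc K := by rw [hK]
  obtain ⟨y, hy⟩ := exists_notin hK'
  have h1 : ad K y = ⊤ := eq_of_le_card le_top (by rw [card_ad hy, card_top, hK]; norm_num)
  have hr : res K y (fun x => f (p + x)) = res K (p + y) f := by funext x; simp only [res, add_assoc]
  refine ⟨K, p + y, by rw [hK]; norm_num, ?_, ?_, ?_⟩
  · intro x hx
    have : p + x ∈ ad K y := by rw [h1]; trivial
    rw [mem_ad] at this
    rcases this with h | h
    · have := h0 _ h; rw [vvl, hx] at this; exact absurd this (by decide)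
    · rwa [add_comm p y, add_assoc]
  · intro s hs; rw [← hr]; exact drop1 (dg_trans hs p) h0 y
  · intro s; rw [← hr, ← om_trans _ f p]; exact sum1 s (by rw [hK]; norm_num) h0 hy
lemma om_ge1 [Finite V] {f : V → Zt} (hf : dg 2 f) (h : f ≠ 0) : om 1 f = 1 ∨ 3 / 2 ≤ om 1 f := by
  have := om_ge hf h
  rcases om1 hf with h | h | h
  · linarith
  · left; exact h
  · right; linarith
lemma two_le_pow' (n : ℕ) (h : 1 ≤ n) : (2 : ℚ) ≤ 2 ^ n := by
  calc (2:ℚ) = 2 ^ 1 := by norm_num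
    _ ≤ 2 ^ n := pow_le_pow_right₀ (by norm_num) h
open Classical in
lemma KTstar [Finite V] {s : ℕ} (hs : 1 ≤ s) {f : V → Zt} (hf : dg (s + 2) f) (hne : f ≠ 0) (hV : ¬ Van f 1) (ho : om (s + 1) f < 2)
    (h' : 2 ≤ s ∨ om (s + 1) f ≤ 3 / 2) :
    ∃ X1 X2 p1 p2, f = ind X1 p1 + ind X2 p2 ∧ nc V = 2 ^ (s + 1) * nc X1 ∧ nc V = 2 ^ (s + 1) * nc X2 ∧ X1 ⊔ X2 = ⊤ := by
  have hz : ∃ x, f x = 0 := zero_of_om (lt_of_lt_of_le ho (two_le_pow' _ (by omega)))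
  obtain ⟨k, K, p, hK, h0, hVk⟩ := setup0 hne hz
  have hV1 : ¬ Van (fun x => f (p + x)) 1 := fun h => hV (van_trans h)
  suffices hh : ∃ X1 X2 p1 p2, (fun x => f (p + x)) = ind X1 p1 + ind X2 p2 ∧ nc V = 2 ^ (s + 1) * nc X1 ∧ nc V = 2 ^ (s + 1) * nc X2 ∧ X1 ⊔ X2 = ⊤ by
    obtain ⟨X1, X2, p1, p2, e, c⟩ := hh
    refine ⟨X1, X2, p + p1, p + p2, ?_, c⟩
    apply fun_ext1; intro x
    have := congrFun e (p + x)
    simp only [vvl] at this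
    rw [this]
    have e1 : ∀ (X : Sb V) (q : V), ind X q (p + x) = ind X (p + q) x := by
      intro X q
      have a := ind1 (X := X) (p := q) (x := p + x)
      have b := ind1 (X := X) (p := p + q) (x := x)
      rw [show q + (p + x) = p + q + x by abel, ← b] at a
      revert a; generalize ind X q (p + x) = u; generalize ind X (p + q) x = v; clear * -; revert u v; decide
    rw [Pi.add_apply, e1, e1]; rfl
  rw [← om_trans (s + 1) f p] at ho h'
  replace hf := dg_trans hf p
  generalize (fun x => f (p + x)) = g at *
  have hnz : ∀ y ∉ K, res K y g ≠ 0 := fun y hy => res_ne hK h0 (hVk k (by omega)) hy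
  have hd : ∀ y, dg (s + 1) (res K y g) := fun y => drop1 hf h0 y
  have hKT : ∀ y ∉ K, om s (res K y g) = 1 ∨ 3 / 2 ≤ om s (res K y g) := by
    intro y hy
    rcases KTc (hd y) (hnz y hy) with h | h | h
    · left; exact h
    · right; linarith
    · right; linarith
  rcases k with _ | _ | k
  · exact absurd ⟨K, 0, by rw [hK], by intro x hx; rw [zero_add]; exact h0 x hx⟩ hV1
  · have hK4 : nc V = 4 * nc K := by rw [hK]; norm_num
    obtain ⟨y1, y2, hy1, hy2, hy3⟩ := exists_plane hK4
    have hsum := sum2 s hK4 h0 hy1 hy2 hy3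
    have a13 : y1 + (y1 + y2) ∉ K := by rwa [vvl]
    have a31 : y1 + (y1 + y2) = y2 := vvl _ _
    have a23 : y2 + (y1 + y2) ∉ K := by rwa [add_comm y1, vvl]
    have a32 : y2 + (y1 + y2) = y1 := by rw [add_comm y1, vvl]
    rcases hKT _ hy1 with h1 | h1 <;> rcases hKT _ hy2 with h2 | h2 <;> rcases hKT _ hy3 with h3 | h3
    all_goals first
      | exact glue hs hf hV1 hK4 h0 hy1 hy2 hy3 h1 h2 (by linarith)
      | exact glue hs hf hV1 hK4 h0 hy1 hy3 a13 h1 h3 (by rw [a31]; linarith)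
      | exact glue hs hf hV1 hK4 h0 hy2 hy3 a23 h2 h3 (by rw [a32]; linarith)
      | (exfalso; linarith)
  · exfalso
    rcases h' with h' | h'
    · exact (kge3 h' hf (by omega) hK h0 (hVk _ (by omega)) hKT ho).elim
    · obtain ⟨C, cC, C0, Ca, CK, hsum⟩ := sum_setup s hK h0
      have h1 : ∑ c ∈ C.filter (· ≠ 0), (1 : ℚ) ≤ ∑ c ∈ C.filter (· ≠ 0), om s (res K c g) := by
        apply Finset.sum_le_sum; intro c hc
        rw [Finset.mem_filter] at hc
        exact om_ge (hd c) (hnz c (CK c hc.1 hc.2))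
      simp only [Finset.sum_const, nsmul_eq_mul, mul_one] at h1
      have h2 : (C.filter (· ≠ 0)).card + 1 = 2 ^ (k + 1 + 1 + 1) := by
        rw [Finset.filter_ne', Finset.card_erase_add_one C0, cC]
      have h2' : ((C.filter (· ≠ 0)).card : ℚ) + 1 = 2 ^ (k + 1 + 1 + 1) := by exact_mod_cast h2
      have h3 : (2 : ℚ) ^ (k+1 + 1 + 1) * om (s + 1) g ≤ 2 ^ (k + 1 + 1 + 1) * (3 / 2) := by gcongr
      have h8 : (8 : ℚ) ≤ 2 ^ (k + 1 + 1 + 1) := by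
        calc (8:ℚ) = 2 ^ 3 := by norm_num
          _ ≤ _ := pow_le_pow_right₀ (by norm_num) (by omega)
      linarith
lemma ind_mul {X Y : Sb V} {p q : V} (h : p + q ∈ X ⊔ Y) : ∃ o, ind X p * ind Y q = ind (X ⊓ Y) o ∧ p + o ∈ X ∧ q + o ∈ Y := by
  obtain ⟨x, hx, y, hy, hxy⟩ := Submodule.mem_sup.1 h
  have e1 : p + (p + x) ∈ X := by rwa [vvl]
  have e2 : q + (p + x) ∈ Y := by
    rw [show q + (p + x) = (p + q) + x by abel, ← hxy, show x + y + x = y + (x + x) by abel, vv, add_zero]; exact hy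
  refine ⟨p + x, ?_, e1, e2⟩
  apply fun_ext1; intro z
  rw [ind1, Submodule.mem_inf, ← ind1, ← ind1, ← ind_congr e1, ← ind_congr e2, Pi.mul_apply]
  generalize ind X p z = a; generalize ind Y q z = b; clear * -; revert a b; decide
lemma ind_mul0 {X Y : Sb V} {p q : V} (h : p + q ∉ X ⊔ Y) : ind X p * ind Y q = 0 := by
  apply fun_ext1; intro z
  constructor
  · intro hz; exfalso; apply h
    have : ind X p z = 1 ∧ ind Y q z = 1 := by
      rw [Pi.mul_apply] at hz; revert hz; generalize ind X p z = a; generalize ind Y q z = b; clear * -; revert a b; decide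
    rw [ind1, ind1] at this
    have := Submodule.add_mem_sup this.1 this.2
    rwa [show p + z + (q + z) = p + q + (z + z) by abel, vv, add_zero] at this
  · intro hz; exact absurd (show (0:Zt) = 1 from hz) (by decide)
lemma om_add [Finite V] (r : ℕ) (f g : V → Zt) : om r (f + g) + 2 * om r (f * g) = om r f + om r g := by
  have := wt_add_mul f g
  have h : ((wt (f + g) : ℚ)) + 2 * wt (f * g) = wt f + wt g := by exact_mod_cast this
  have hN : (nc V : ℚ) ≠ 0 := by exact_mod_cast card_pos'.ne'
  unfold om; field_simp; linear_combination h
lemma om_two [Finite V] {r : ℕ} {X Y : Sb V} (hX : nc V = 2 ^ r * nc X) (hY : nc V = 2 ^ r * nc Y)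
    (h : X ⊔ Y = ⊤) (p q : V) : om r (ind X p + ind Y q) = 2 - 2 / 2 ^ r := by
  have h1 := om_add r (ind X p) (ind Y q)
  obtain ⟨o, ho, -⟩ := ind_mul (X := X) (Y := Y) (p := p) (q := q) (by rw [h]; trivial)
  rw [om_ind hX, om_ind hY, ho] at h1
  have h2 : om r (ind (X ⊓ Y) o) = 1 / 2 ^ r := by
    have hi := card_sup_inf X Y
    rw [h, card_top] at hi
    have hi2 : (nc V : ℚ) * nc (X ⊓ Y : Sb V) = nc X * nc Y := by exact_mod_cast hi
    have hX' : (nc V : ℚ) = 2 ^ r * nc X := by exact_mod_cast hX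
    have hY' : (nc V : ℚ) = 2 ^ r * nc Y := by exact_mod_cast hY
    have hN : (nc V : ℚ) ≠ 0 := by exact_mod_cast card_pos'.ne'
    unfold om; rw [wt_ind]; field_simp
    have : (nc V : ℚ) * ((2 ^ r)^2 * nc (X ⊓ Y : Sb V)) = nc V * nc V := by
      linear_combination (2^r)^2 * hi2 - nc V * hX' - 2^r * nc X * hY'
    have := mul_left_cancel₀ hN this
    linarith
  rw [h2] at h1
  have : (2:ℚ) / 2 ^ r = 2 * (1 / 2 ^ r) := by ring
  linarith
theorem KTS (ρ : ℕ) : ∀ (V : Type) [AddCommGroup V] [Module Zt V] [Finite V] (g : V → Zt), dg (ρ + 3) g → g ≠ 0 →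
    om (ρ + 2) g < 2 → (∃ A p, g = ind A p ∧ nc V = 2 ^ (ρ + 2) * nc A) ∨
    (∃ A B p q, g = ind A p + ind B q ∧ nc V = 2 ^ (ρ + 2) * nc A ∧ nc V = 2 ^ (ρ + 2) * nc B) ∨
    (∃ (W : Sb V) (e : V), nc V = 2 ^ ρ * nc W ∧ (∀ x, g x = 1 → e + x ∈ W) ∧ dg 3 (res W e g) ∧ 7 / 4 ≤ om (ρ + 2) g) := by
  induction ρ with
  | zero =>
    intro V _ _ _ g hg hne ho
    rcases KTc hg hne with h | h | h
    · left; exact om_flat hg h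
    · right; left
      by_cases hV : Van g 1
      · exfalso
        obtain ⟨K, e, -, -, h1, h2⟩ := van1 hV
        have := h2 1; rw [show 1 + 1 = 0 + 2 by norm_num, h] at this
        rcases om1 (h1 2 hg) with h | h | h <;> rw [h] at this <;> norm_num at this
      · obtain ⟨A, B, p, q, a, b, c, -⟩ := KTstar (s := 1) le_rfl hg hne hV ho (by right; exact h.le)
        exact ⟨A, B, p, q, a, b, c⟩
    · right; right
      exact ⟨⊤, 0, by rw [card_top]; simp, fun _ _ => trivial, dg_res hg _ _, h⟩
  | succ ρ ih =>
    intro V _ _ _ g hg hne ho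
    by_cases hV : Van g 1
    · obtain ⟨K, e, hK, hs, h1, h2⟩ := van1 hV
      have hl := lf_res hs
      rw [show ρ + 1 + 2 = ρ + 2 + 1 by ring, h2] at ho
      have hn : res K e g ≠ 0 := by
        intro h; apply hne; rw [← hl, h]; funext x; simp only [lf]; split_ifs <;> rfl
      rcases ih K _ (h1 _ hg) hn ho with ⟨A, p, he, hc⟩ | ⟨A, B, p, q, he, hc, hd⟩ | ⟨W, k, hc, hW, hd, h7⟩
      · left
        refine ⟨A.map K.subtype, e + p, by rw [← lf_ind, ← he, hl], ?_⟩
        rw [card_map', hK, hc]; ring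
      · right; left
        refine ⟨A.map K.subtype, B.map K.subtype, e + p, e + q, by rw [← lf_ind, ← lf_ind, ← lf_add, ← he, hl], ?_, ?_⟩
        · rw [card_map', hK, hc]; ring
        · rw [card_map', hK, hd]; ring
      · right; right
        refine ⟨W.map K.subtype, e + k, ?_, ?_, ?_, ?_⟩
        · rw [card_map', hK, hc]; ring
        · intro x hx
          have := hW ⟨e + x, hs x hx⟩ (by simp only [res, vvl]; exact hx)
          exact Submodule.mem_map.2 ⟨_, this, by simp; abel⟩
        · have := dg_comp hd ((Submodule.equivMapOfInjective _ K.subtype_injective W).symm : _ ≃ₗ[Zt] W).toLinearMap.toAddMonoidHom 0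
          convert this using 1
          funext x
          simp only [res, zero_add]
          congr 1
          have h3 := (Submodule.equivMapOfInjective _ K.subtype_injective W).apply_symm_apply x
          have h4 := congrArg Subtype.val h3
          rw [Submodule.coe_equivMapOfInjective_apply] at h4
          simp [add_assoc]
          exact h4.symm
        · rw [show ρ + 1 + 2 = ρ + 2 + 1 by ring, h2]; exact h7
    · right; left
      obtain ⟨A, B, p, q, a, b, c, -⟩ := KTstar (s := ρ + 2) (by omega) hg hne hV ho (by left; omega)
      exact ⟨A, B, p, q, a, b, c⟩
def dy (q : ℚ) : Prop := q = 0 ∨ ∃ i : ℕ, q = 1 / 2 ^ i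
def fin5 (v : ℚ) : Prop := ∃ i : ℕ, v = 1 / 2 ^ i ∨ v = 3 / 2 ^ i
lemma ip_le {i j : ℕ} (h : j ≤ i) : (1 : ℚ) / 2 ^ i ≤ 1 / 2 ^ j :=
  one_div_le_one_div_of_le (by positivity) (pow_le_pow_right₀ (by norm_num) h)
lemma ip_lt {i j : ℕ} (h : (1 : ℚ) / 2 ^ i < 1 / 2 ^ j) : j < i := by
  by_contra h2; have := ip_le (not_lt.1 h2); linarith
lemma dy_nonneg {q : ℚ} (h : dy q) : 0 ≤ q := by
  rcases h with h | ⟨i, h⟩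
  · rw [h]
  · rw [h]; positivity
lemma dy_pos {q : ℚ} (h : dy q) (h0 : 0 < q) : ∃ i : ℕ, q = 1 / 2 ^ i := by
  rcases h with h | h
  · linarith
  · exact h
lemma dy_cases {q : ℚ} (h : dy q) : q = 1 ∨ q = 1 / 2 ∨ q = 1 / 4 ∨ q = 1 / 8 ∨ q ≤ 1 / 16 := by
  rcases h with h | ⟨i, h⟩
  · right; right; right; right; rw [h]; norm_num
  · rcases i with _ | _ | _ | _ | i
    · left; rw [h]; norm_num
    · right; left; rw [h]; norm_num
    · right; right; left; rw [h]; norm_num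
    · right; right; right; left; rw [h]; norm_num
    · right; right; right; right; rw [h]
      have := ip_le (i := i + 1 + 1 + 1 + 1) (j := 4) (by omega)
      norm_num at this ⊢; linarith
lemma dy_ratio {p q : ℚ} (hp : dy p) (hq : dy q) (h0 : 0 < q) (h1 : q ≤ p) (h2 : p ≤ 4 * q) : p = q ∨ p = 2 * q ∨ p = 4 * q := by
  obtain ⟨i, rfl⟩ := dy_pos hq h0
  obtain ⟨j, rfl⟩ := dy_pos hp (by linarith)
  by_cases hij : i ≤ j
  · left; have := ip_le hij; linarith
  · have hj : j < i + 1 := by omega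
    by_cases h3 : i = j + 1
    · right; left; rw [h3, pow_succ]; field_simp
    · right; right
      obtain ⟨k, rfl⟩ : ∃ k, i = j + 2 + k := ⟨i - j - 2, by omega⟩
      have e : (1 : ℚ) / 2 ^ (j + 2 + k) = (1 / 2 ^ j) * (1 / 2 ^ k) / 4 := by rw [pow_add, pow_add]; field_simp; norm_num
      have hk : (1 : ℚ) / 2 ^ k ≤ 1 := by simpa using ip_le (i := k) (j := 0) (by omega)
      have hp : (0 : ℚ) < 1 / 2 ^ j := by positivity
      rw [e] at h2 ⊢
      nlinarith
lemma fin_a {q : ℚ} (hq : dy q) (h0 : 0 < q) (m : ℕ) (h : q * 2 ^ m ≤ 1) : ∃ i : ℕ, q * 2 ^ m = 1 / 2 ^ i := by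
  obtain ⟨i, rfl⟩ := dy_pos hq h0
  by_cases hm : m ≤ i
  · obtain ⟨k, rfl⟩ := Nat.exists_eq_add_of_le hm
    exact ⟨k, by rw [pow_add]; field_simp⟩
  · exfalso
    have : (2:ℚ) ^ (i + 1) ≤ 2 ^ m := pow_le_pow_right₀ (by norm_num) (by omega)
    rw [pow_succ] at this
    have hp : (0:ℚ) < 2 ^ i := by positivity
    rw [div_mul_eq_mul_div, div_le_one hp] at h
    linarith
lemma fin_1 {q v : ℚ} (hq : dy q) (h0 : 0 < q) (m : ℕ) (h : q * 2 ^ m ≤ 1) (hv : v = q * 2 ^ m) : fin5 v := by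
  obtain ⟨i, hi⟩ := fin_a hq h0 m h
  exact ⟨i, Or.inl (by rw [hv, hi])⟩
lemma fin_3 {q v : ℚ} (hq : dy q) (h0 : 0 < q) (m : ℕ) (h : q * 2 ^ m ≤ 1) (hv : v = 3 * (q * 2 ^ m)) : fin5 v := by
  obtain ⟨i, hi⟩ := fin_a hq h0 m h
  exact ⟨i, Or.inr (by rw [hv, hi]; ring)⟩
structure TF (x y z g : ℚ) : Prop where
  hx : dy x
  hy : dy y
  hz : dy z
  hg : dy g
  gx : g ≤ x
  gy : g ≤ y
  gz : g ≤ z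
  xy : 0 < g → x * y ≤ g
  xz : 0 < g → x * z ≤ g
  yz : 0 < g → y * z ≤ g
  fx : g = 0 → x = 1 / 4 → 0 < y → 0 < z → y ≤ 2 * z ∧ z ≤ 2 * y
  fy : g = 0 → y = 1 / 4 → 0 < x → 0 < z → x ≤ 2 * z ∧ z ≤ 2 * x
  fz : g = 0 → z = 1 / 4 → 0 < x → 0 < y → x ≤ 2 * y ∧ y ≤ 2 * x
lemma TF.s1 {x y z g : ℚ} (h : TF x y z g) : TF y x z g :=
  ⟨h.hy, h.hx, h.hz, h.hg, h.gy, h.gx, h.gz, fun a => by rw [mul_comm]; exact h.xy a, h.yz, h.xz, h.fy, h.fx,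
    fun a b c d => (h.fz a b d c).symm⟩
lemma TF.s2 {x y z g : ℚ} (h : TF x y z g) : TF x z y g :=
  ⟨h.hx, h.hz, h.hy, h.hg, h.gx, h.gz, h.gy, h.xz, h.xy, fun a => by rw [mul_comm]; exact h.yz a,
    fun a b c d => (h.fx a b d c).symm, h.fz, h.fy⟩
lemma tf_num0 {x y z g v : ℚ} (h : TF x y z g) (hyx : y ≤ x) (hzy : z ≤ y) (hv : v = 2 * (x + y + z) - 4 * g - 1 / 2)
    (h0 : 0 < v) (h1 : v < 1 / 2) : fin5 v := by
  have gx := h.gx; have gy := h.gy; have gz := h.gz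
  have x0 := dy_nonneg h.hx; have y0 := dy_nonneg h.hy; have z0 := dy_nonneg h.hz; have g0 := dy_nonneg h.hg
  rcases dy_cases h.hx with hx | hx | hx | hx | hx
  · linarith
  · linarith
  ·
    rcases g0.lt_or_eq with hg | hg
    · have a1 := h.xy hg; have a2 := h.xz hg; rw [hx] at a1 a2
      have := dy_ratio h.hy h.hg hg gy (by linarith)
      have := dy_ratio h.hz h.hg hg gz (by linarith)
      have hg1 : g ≤ 1 / 4 := by linarith
      rcases dy_ratio h.hy h.hg hg gy (by linarith) with hy | hy | hy <;> rcases dy_ratio h.hz h.hg hg gz (by linarith) with hz | hz | hz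
      · linarith
      · linarith
      · linarith
      · exact fin_1 h.hg hg 1 (by linarith) (by rw [hv, hx, hy, hz]; ring)
      · exact fin_1 h.hg hg 2 (by linarith) (by rw [hv, hx, hy, hz]; ring)
      · linarith
      · exact fin_3 h.hg hg 1 (by linarith) (by rw [hv, hx, hy, hz]; ring)
      · exact fin_1 h.hg hg 3 (by linarith) (by rw [hv, hx, hy, hz]; ring)
      · exact fin_3 h.hg hg 2 (by linarith) (by rw [hv, hx, hy, hz]; ring)
    · rcases z0.lt_or_eq with hz | hz
      · have a1 := h.fx hg.symm hx (by linarith) hz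
        rcases dy_ratio h.hy h.hz hz hzy (by linarith) with hy | hy | hy
        · exact fin_1 h.hz hz 2 (by linarith) (by rw [hv, hx, hy, ← hg]; ring)
        · exact fin_3 h.hz hz 1 (by linarith) (by rw [hv, hx, hy, ← hg]; ring)
        · linarith
      · exact fin_1 h.hy (by linarith) 1 (by linarith) (by rw [hv, hx, ← hz, ← hg]; ring)
  · rcases dy_cases h.hy with hy | hy | hy | hy | hy
    · linarith
    · linarith
    · linarith
    · rcases g0.lt_or_eq with hg | hg
      · have a1 := h.xy hg; rw [hx, hy] at a1
        have hzz : z = 1 / 8 ∨ z = 1 / 16 := by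
          have d8 : dy (1/16) := Or.inr ⟨4, by norm_num⟩
          rcases dy_cases h.hz with hz | hz | hz | hz | hz
          · linarith
          · linarith
          · linarith
          · left; exact hz
          · right
            rcases dy_ratio d8 h.hz (by linarith) hz (by linarith) with h | h | h
            · exact h.symm
            · linarith
            · linarith
        rcases hzz with hz | hz
        · rcases dy_ratio (p := 1/16) (Or.inr ⟨4, by norm_num⟩) h.hg hg (by linarith) (by linarith) with hz' | hz' | hz'
          · linarith
          · exact fin_1 h.hg hg 2 (by linarith) (by linarith)
          · exact fin_3 h.hg hg 2 (by linarith) (by linarith)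
        · rcases dy_ratio (p := z) h.hz h.hg hg gz (by linarith) with hz | hz | hz
          · linarith
          · linarith
          · exact fin_1 h.hg hg 2 (by linarith) (by rw [hv, hx, hy, hz]; ring)
      · exact fin_1 h.hz (by linarith) 1 (by linarith) (by rw [hv, hx, hy, ← hg]; ring)
    · linarith
  · linarith
lemma tf_num {x y z g v : ℚ} (h : TF x y z g) (hv : v = 2 * (x + y + z) - 4 * g - 1 / 2)
    (h0 : 0 < v) (h1 : v < 1 / 2) : fin5 v := by
  rcases le_total x y with a | a <;> rcases le_total y z with b | b <;> rcases le_total x z with c | c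
  all_goals first
    | exact tf_num0 h (by assumption) (by assumption) (by linarith) h0 h1
    | exact tf_num0 h.s1 (by assumption) (by assumption) (by linarith) h0 h1
    | exact tf_num0 h.s2 (by assumption) (by assumption) (by linarith) h0 h1
    | exact tf_num0 h.s1.s2 (by assumption) (by assumption) (by linarith) h0 h1
    | exact tf_num0 h.s2.s1 (by assumption) (by assumption) (by linarith) h0 h1
    | exact tf_num0 h.s1.s2.s1 (by assumption) (by assumption) (by linarith) h0 h1
    | exact tf_num0 h (by linarith) (by linarith) (by linarith) h0 h1
lemma om_pt {r : ℕ} {f : V → Zt} (h : 0 < om r f) : ∃ x, f x = 1 := by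
  by_contra hh; push Not at hh
  have : wt f = 0 := by
    unfold wt; convert Set.ncard_empty V; ext x; simp [hh]
  unfold om at h; rw [this] at h; simp at h
lemma om_mono [Finite V] (r : ℕ) {f g : V → Zt} (h : ∀ x, f x = 1 → g x = 1) : om r f ≤ om r g := by
  unfold om
  have : (wt f : ℚ) ≤ wt g := by exact_mod_cast wt_mono h
  gcongr
lemma pair_val {A B : Sb V} {a b o : V} (ha : a + o ∈ A) (hb : b + o ∈ B) : ind A a * ind B b = ind (A ⊓ B) o := by
  apply fun_ext1; intro z
  rw [ind1, Submodule.mem_inf, ← ind1, ← ind1, ← ind_congr ha, ← ind_congr hb, Pi.mul_apply]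
  generalize ind A a z = u; generalize ind B b z = v; clear * -; revert u v; decide
lemma om_ind' [Finite V] {r : ℕ} {A : Sb V} (hA : nc V = 2 ^ r * nc A) (D : Sb V) (o : V) :
    om r (ind D o) = nc D / nc A := by
  have h : (nc A : ℚ) ≠ 0 := by exact_mod_cast card_pos'.ne'
  unfold om; rw [wt_ind, hA]; push_cast; field_simp
lemma mul1 {a b : Zt} : a * b = 1 ↔ a = 1 ∧ b = 1 := by revert a b; decide
lemma card_dy [Finite V] {A D : Sb V} (h : D ≤ A) : dy (nc D / nc A) := by
  right
  obtain ⟨n, hn⟩ := card_pow A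
  obtain ⟨m, hm⟩ := card_pow D
  have := card_le_of_le h
  rw [hn, hm] at this ⊢
  have := (Nat.pow_le_pow_iff_right (by norm_num : 1 < 2)).1 this
  obtain ⟨k, rfl⟩ := Nat.exists_eq_add_of_le this
  refine ⟨k, ?_⟩
  push_cast; rw [pow_add]; field_simp
lemma pair_dy [Finite V] {r : ℕ} {A B : Sb V} (hA : nc V = 2 ^ r * nc A) (a b : V) :
    dy (om r (ind A a * ind B b)) := by
  rcases (om_nonneg r (ind A a * ind B b)).lt_or_eq with h | h
  · obtain ⟨o, ho⟩ := om_pt h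
    rw [Pi.mul_apply, mul1, ind1, ind1] at ho
    rw [pair_val ho.1 ho.2, om_ind' hA]; exact card_dy inf_le_left
  · left; exact h.symm
lemma f3_aux [Finite V] (A B C : Sb V) :
    (nc (A ⊓ B : Sb V) / nc A : ℚ) * (nc (A ⊓ C : Sb V) / nc A) ≤
      nc (A ⊓ B ⊓ C : Sb V) / nc A := by
  have h1 := card_sup_inf (A ⊓ B) (A ⊓ C)
  have h2 : (A ⊓ B) ⊓ (A ⊓ C) = A ⊓ B ⊓ C := by
    ext x; simp only [Submodule.mem_inf]; tauto
  have h3 : nc ((A ⊓ B) ⊔ (A ⊓ C) : Sb V) ≤ nc A := card_le_of_le (sup_le inf_le_left inf_le_left)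
  rw [h2] at h1
  have h : (0 : ℚ) < (nc A : ℚ) := by exact_mod_cast card_pos'
  have h4 : (nc (A ⊓ B : Sb V) : ℚ) * nc (A ⊓ C : Sb V) ≤ nc A * nc (A ⊓ B ⊓ C : Sb V) := by
    rw [← Nat.cast_mul, ← h1]; exact_mod_cast Nat.mul_le_mul_right _ h3
  rw [div_mul_div_comm, div_le_div_iff₀ (by positivity) h]
  nlinarith
lemma f4_aux [Finite V] {A B C : Sb V} {a b c o1 o2 : V} (h4 : nc A = 4 * nc (A ⊓ B : Sb V))
    (a1 : a + o1 ∈ A) (b1 : b + o1 ∈ B) (a2 : a + o2 ∈ A) (c2 : c + o2 ∈ C) (hn : ¬ ∃ o, a + o ∈ A ∧ b + o ∈ B ∧ c + o ∈ C) :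
    nc (A ⊓ C : Sb V) ≤ 2 * nc (A ⊓ B ⊓ C : Sb V) := by
  by_contra hh
  have h2 : (A ⊓ B) ⊓ (A ⊓ C) = A ⊓ B ⊓ C := by
    ext x; simp only [Submodule.mem_inf]; tauto
  have h1 := card_sup_inf (A ⊓ B) (A ⊓ C)
  rw [h2] at h1
  have hge : 4 * nc (A ⊓ B ⊓ C : Sb V) ≤ nc (A ⊓ C : Sb V) := by
    obtain ⟨n, hn⟩ := card_pow (A ⊓ B ⊓ C : Sb V)
    obtain ⟨m, hm⟩ := card_pow (A ⊓ C : Sb V)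
    rw [hn, hm, not_le, mul_comm, ← pow_succ] at hh
    have := (Nat.pow_lt_pow_iff_right (by norm_num : 1 < 2)).1 hh
    rw [hn, hm]
    calc 4 * 2 ^ n = 2 ^ (n + 2) := by rw [pow_add]; ring
      _ ≤ _ := Nat.pow_le_pow_right (by norm_num) (by omega)
  have hsup : (A ⊓ B) ⊔ (A ⊓ C) = A := by
    apply eq_of_le_card (sup_le inf_le_left inf_le_left)
    have hp := card_pos' (V := (A ⊓ B ⊓ C : Sb V))
    by_contra h5
    have := Nat.mul_lt_mul_of_pos_right (not_le.1 h5) hp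
    rw [h1, h4] at this
    nlinarith [card_pos' (V := (A ⊓ B : Sb V))]
  have hm : o1 + o2 ∈ (A ⊓ B) ⊔ (A ⊓ C) := by
    rw [hsup]; have := A.add_mem a1 a2
    rwa [show a + o1 + (a + o2) = o1 + o2 + (a + a) by abel, vv, add_zero] at this
  obtain ⟨o, -, h5, h6⟩ := ind_mul hm
  apply hn
  refine ⟨o, ?_, ?_, ?_⟩
  · have := A.add_mem a1 h5.1
    rwa [show a + o1 + (o1 + o) = a + o + (o1 + o1) by abel, vv, add_zero] at this
  · have := B.add_mem b1 h5.2
    rwa [show b + o1 + (o1 + o) = b + o + (o1 + o1) by abel, vv, add_zero] at this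
  · have := C.add_mem c2 h6.2
    rwa [show c + o2 + (o2 + o) = c + o + (o2 + o2) by abel, vv, add_zero] at this
lemma f3_om [Finite V] {r : ℕ} {A B C : Sb V} {a b c : V} (hA : nc V = 2 ^ r * nc A)
    (h : 0 < om r (ind A a * ind B b * ind C c)) :
    om r (ind A a * ind B b) * om r (ind A a * ind C c) ≤ om r (ind A a * ind B b * ind C c) := by
  obtain ⟨o, ho⟩ := om_pt h
  rw [Pi.mul_apply, Pi.mul_apply, mul1, mul1, ind1, ind1, ind1] at ho
  obtain ⟨⟨h1, h2⟩, h3⟩ := ho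
  rw [pair_val h1 h2, pair_val h1 h3, pair_val (show o + o ∈ A ⊓ B by rw [vv]; exact Submodule.zero_mem _) h3, om_ind' hA, om_ind' hA, om_ind' hA]
  exact f3_aux A B C
lemma f4_om [Finite V] {r : ℕ} {A B C : Sb V} {a b c : V} (hA : nc V = 2 ^ r * nc A)
    (hB : nc V = 2 ^ r * nc B)
    (h : om r (ind A a * ind B b * ind C c) = 0) (h1 : om r (ind A a * ind B b) = 1 / 4) (h2 : 0 < om r (ind A a * ind C c))
    (h3 : 0 < om r (ind B b * ind C c)) :
    om r (ind A a * ind C c) ≤ 2 * om r (ind B b * ind C c) ∧ om r (ind B b * ind C c) ≤ 2 * om r (ind A a * ind C c) := by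
  obtain ⟨o1, p1⟩ := om_pt (h1 ▸ (by norm_num : (0:ℚ) < 1 / 4) : 0 < om r (ind A a * ind B b))
  obtain ⟨o2, p2⟩ := om_pt h2
  obtain ⟨o3, p3⟩ := om_pt h3
  rw [Pi.mul_apply, mul1, ind1, ind1] at p1 p2 p3
  have hn : ¬ ∃ o, a + o ∈ A ∧ b + o ∈ B ∧ c + o ∈ C := by
    rintro ⟨o, q1, q2, q3⟩
    rw [om_eq_zero] at h
    have := congrFun h o
    rw [Pi.mul_apply, Pi.mul_apply, ind1.2 q1, ind1.2 q2, ind1.2 q3] at this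
    exact absurd (show (1:Zt)*1*1=0 from this) (by decide)
  have hAB : nc A = nc B := Nat.eq_of_mul_eq_mul_left (by positivity) (hA.symm.trans hB)
  rw [pair_val p1.1 p1.2, om_ind' hA] at h1
  have hp : (0 : ℚ) < (nc A : ℚ) := by exact_mod_cast card_pos'
  rw [div_eq_div_iff hp.ne' (by norm_num)] at h1
  have h4 : nc A = 4 * nc (A ⊓ B : Sb V) := by
    have : (nc A : ℚ) = 4 * nc (A ⊓ B : Sb V) := by linarith
    exact_mod_cast this
  have e1 := f4_aux h4 p1.1 p1.2 p2.1 p2.2 hn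
  have e2 := f4_aux (A := B) (B := A) (C := C) (a := b) (b := a) (c := c) (by rw [inf_comm, ← hAB]; exact h4) p1.2 p1.1 p3.1 p3.2
    (fun ⟨o, q1, q2, q3⟩ => hn ⟨o, q2, q1, q3⟩)
  rw [inf_comm B A] at e2
  have e3 : nc (A ⊓ B ⊓ C : Sb V) ≤ nc (A ⊓ C : Sb V) :=
    card_le_of_le (inf_le_inf_right _ inf_le_left)
  have e4 : nc (A ⊓ B ⊓ C : Sb V) ≤ nc (B ⊓ C : Sb V) :=
    card_le_of_le (inf_le_inf_right _ inf_le_right)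
  rw [pair_val p2.1 p2.2, pair_val p3.1 p3.2, om_ind' hA, om_ind' hA]
  constructor
  · rw [← mul_div_assoc]; gcongr; exact_mod_cast (by omega)
  · rw [← mul_div_assoc]; gcongr; exact_mod_cast (by omega)
lemma om_three [Finite V] (r : ℕ) (f g h : V → Zt) :
    om r (f + g + h) = om r f + om r g + om r h - 2 * (om r (f * g) + om r (f * h) + om r (g * h)) + 4 * om r (f * g * h) := by
  have h1 := om_add r (f + g) h
  have h2 := om_add r f g
  have h3 := om_add r (f * h) (g * h)
  have e1 : (f + g) * h = f * h + g * h := by ring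
  have e2 : f * h * (g * h) = f * g * h := by
    funext x; simp only [Pi.mul_apply]; generalize f x = a; generalize g x = b; generalize h x = c; clear * -; revert a b c; decide
  rw [e1] at h1; rw [e2] at h3
  linarith
lemma three_flats [Finite V] {r : ℕ} {A B C : Sb V} {a b c : V} (hA : nc V = 2 ^ r * nc A)
    (hB : nc V = 2 ^ r * nc B) (hC : nc V = 2 ^ r * nc C)
    (h2 : 2 < om r (ind A a + ind B b + ind C c)) (h5 : om r (ind A a + ind B b + ind C c) < 5 / 2) :
    fin5 (5 / 2 - om r (ind A a + ind B b + ind C c)) := by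
  have h3 := om_three r (ind A a) (ind B b) (ind C c)
  rw [om_ind hA, om_ind hB, om_ind hC] at h3
  have m1 : ind B b * ind A a = ind A a * ind B b := mul_comm _ _
  have m2 : ind C c * ind A a = ind A a * ind C c := mul_comm _ _
  have m3 : ind C c * ind B b = ind B b * ind C c := mul_comm _ _
  have m4 : ind A a * ind C c * ind B b = ind A a * ind B b * ind C c := by ring
  have m5 : ind B b * ind C c * ind A a = ind A a * ind B b * ind C c := by ring
  have m6 : ind B b * ind A a * ind C c = ind A a * ind B b * ind C c := by ring
  have m7 : ind C c * ind A a * ind B b = ind A a * ind B b * ind C c := by ring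
  have hTF : TF (om r (ind A a * ind B b)) (om r (ind A a * ind C c)) (om r (ind B b * ind C c)) (om r (ind A a * ind B b * ind C c)) := by
    refine ⟨pair_dy hA a b, pair_dy hA a c, pair_dy hB b c, ?_, ?_, ?_, ?_, ?_, ?_, ?_, ?_, ?_, ?_⟩
    · rcases (om_nonneg r (ind A a * ind B b * ind C c)).lt_or_eq with h | h
      · obtain ⟨o, ho⟩ := om_pt h
        rw [Pi.mul_apply, Pi.mul_apply, mul1, mul1, ind1, ind1, ind1] at ho
        rw [pair_val ho.1.1 ho.1.2, pair_val (show o + o ∈ A ⊓ B by rw [vv]; exact Submodule.zero_mem _) ho.2, om_ind' hA]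
        exact card_dy (inf_le_left.trans inf_le_left)
      · left; exact h.symm
    · apply om_mono; intro x; simp only [Pi.mul_apply, mul1]; tauto
    · apply om_mono; intro x; simp only [Pi.mul_apply, mul1]; tauto
    · apply om_mono; intro x; simp only [Pi.mul_apply, mul1]; tauto
    · intro h; exact f3_om hA h
    · intro h; have := f3_om (A := B) (B := A) (C := C) (a := b) (b := a) (c := c) hB (by rw [m6]; exact h)
      rwa [m1] at this
    · intro h; have := f3_om (A := C) (B := A) (C := B) (a := c) (b := a) (c := b) hC (by rw [m7]; exact h)
      rwa [m7, m2, m3] at this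
    · intro h; exact f4_om hA hB h
    · intro h h1 h2 h3
      have := f4_om (A := A) (B := C) (C := B) (a := a) (b := c) (c := b) hA hC (by rw [m4]; exact h) h1 h2 (by rw [m3]; exact h3)
      rwa [m3] at this
    · intro h h1 h2 h3
      have := f4_om (A := B) (B := C) (C := A) (a := b) (b := c) (c := a) hB hC (by rw [m5]; exact h) h1 (by rw [m1]; exact h2) (by rw [m2]; exact h3)
      rwa [m1, m2] at this
  exact tf_num hTF (by linarith) (by linarith) (by linarith)
lemma w_full [Finite V] {K : Sb V} {q : V} {f : V → Zt} (h : ∀ x ∈ K, f (q + x) = 1) : w K q f = nc K := by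
  rw [← wt_res, show res K q f = 1 from funext fun x => h x x.2, wt_one]
lemma w_mono_sub [Finite V] {K L : Sb V} (h : K ≤ L) (q : V) (f : V → Zt) : w K q f ≤ w L q f :=
  Set.ncard_le_ncard (fun x hx => ⟨hx.1, h hx.2⟩) (Set.toFinite _)
lemma om_w [Finite V] {r : ℕ} {X : Sb V} (hX : nc V = 2 ^ r * nc X) (p : V) (f : V → Zt) :
    om r (f * ind X p) = w X p f / nc X := by
  have h : (nc X : ℚ) ≠ 0 := by exact_mod_cast card_pos'.ne'
  unfold om; rw [wt_mul_ind, hX]; push_cast; field_simp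
lemma van_of_con [Finite V] {f : V → Zt} {a : V →ₗ[Zt] Zt} (ha : a ≠ 0) (h : conS a f) : Van f 1 := by
  obtain ⟨c, hc⟩ := h
  obtain ⟨v, hv⟩ := exists_one ha
  refine ⟨LinearMap.ker a, (c + 1) • v, by rw [card_ker ha]; norm_num, fun x hx => ?_⟩
  by_contra h1
  have := hc _ (zne.1 h1)
  rw [map_add, map_smul, hv, LinearMap.mem_ker.1 hx] at this
  clear * - this; revert this; simp
lemma Mlem [Finite V] {ρ : ℕ} (hρ : 2 ≤ ρ) {f : V → Zt} (hf : dg (ρ + 3) f) (hV : ¬ Van f 1) (h2 : 2 < om (ρ + 2) f)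
    (h5 : om (ρ + 2) f < 5 / 2) {X : Sb V} {p : V} (hX : nc V = 2 ^ (ρ + 2) * nc X)
    (hw : 3 * nc X ≤ 4 * w X p f) : fin5 (5 / 2 - om (ρ + 2) f) := by
  have hXp : (0 : ℚ) < (nc X : ℚ) := by exact_mod_cast card_pos'
  obtain ⟨g, hg⟩ : ∃ g, g = f + ind X p := ⟨_, rfl⟩
  have hfg : f = g + ind X p := by rw [hg, add_assoc, fadd, add_zero]
  have hdg : dg (ρ + 3) g := by rw [hg]; exact dg_add hf (ind_dg hX.le p)
  have e1 := om_add (ρ + 2) f (ind X p)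
  have e2 := om_add (ρ + 2) g (ind X p)
  rw [← hg, om_ind hX, om_w hX] at e1
  rw [← hfg, om_ind hX] at e2
  have hq : (3 / 4 : ℚ) ≤ w X p f / nc X := by
    rw [div_le_div_iff₀ (by norm_num) hXp]; have : (3 * nc X : ℚ) ≤ 4 * w X p f := by exact_mod_cast hw
    linarith
  have hog : om (ρ + 2) g < 2 := by linarith
  have ht : om (ρ + 2) (g * ind X p) ≤ 1 / 4 := by linarith
  have hgn : g ≠ 0 := by
    intro h; rw [h, zero_add] at hfg; rw [hfg, om_ind hX] at h2; norm_num at h2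
  rcases KTS ρ V g hdg hgn hog with ⟨A, a, hA, cA⟩ | ⟨A, B, a, b, hA, cA, cB⟩ | ⟨W, e, cW, hs, hd, h7⟩
  · exfalso
    have := om_nonneg (ρ + 2) (g * ind X p)
    have : om (ρ + 2) g = 1 := by rw [hA, om_ind cA]
    linarith
  · rw [hA] at hfg
    rw [hfg] at h2 h5 ⊢
    exact three_flats cA cB hX h2 h5
  · have hsup : X ⊔ W = ⊤ := by
      by_contra hn
      obtain ⟨a, ha, hk⟩ := exists_ker' hn
      by_cases hae : a e = a p
      · apply hV; apply van_of_con ha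
        refine ⟨a p, fun x hx => ?_⟩
        rw [hfg, Pi.add_apply] at hx
        have : g x = 1 ∨ ind X p x = 1 := by
          revert hx; generalize g x = u; generalize ind X p x = v; clear * -; revert u v; decide
        rcases this with h | h
        · have := hk _ (Submodule.mem_sup_right (hs x h))
          rw [map_add, zadd] at this; rw [← this, hae]
        · have := hk _ (Submodule.mem_sup_left (ind1.1 h))
          rw [map_add, zadd] at this; exact this.symm
      · have : om (ρ + 2) (g * ind X p) = 0 := by
          rw [om_eq_zero]
          by_contra h0
          have : ∃ x, (g * ind X p) x = 1 := by
            by_contra hh; push Not at hh; apply h0; funext x; exact zne1.1 (hh x)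
          obtain ⟨x, hx⟩ := this
          rw [Pi.mul_apply, mul1, ind1] at hx
          apply hae
          have h1 := hk _ (Submodule.mem_sup_right (hs x hx.1))
          have h2 := hk _ (Submodule.mem_sup_left hx.2)
          rw [map_add, zadd] at h1 h2
          rw [h1, h2]
        linarith
    obtain ⟨o, -, ho1, ho2⟩ := ind_mul (X := X) (Y := W) (p := p) (q := e) (by rw [hsup]; trivial)
    have hci := card_sup_inf X W
    rw [hsup, card_top, cW, mul_comm (nc X), mul_comm (2 ^ ρ) (nc W), mul_assoc] at hci
    have hci := Nat.eq_of_mul_eq_mul_left card_pos' hci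
    have hYp : (0 : ℚ) < (nc (X ⊓ W : Sb V) : ℚ) := by exact_mod_cast card_pos'
    have hci' : (2:ℚ) ^ ρ * nc (X ⊓ W : Sb V) = nc X := by exact_mod_cast hci
    have hwe : w X p g = wt (res (X ⊓ W) o g) := by
      rw [wt_res]; unfold w; congr 1; ext x
      simp only [Set.mem_setOf_eq, Submodule.mem_inf]
      constructor
      · rintro ⟨h1, h2⟩
        refine ⟨h1, ?_, ?_⟩
        · have := X.add_mem ho1 h2; rwa [show p + o + (p + x) = o + x + (p + p) by abel, vv, add_zero] at this
        · have := W.add_mem ho2 (hs x h1); rwa [show e + o + (e + x) = o + x + (e + e) by abel, vv, add_zero] at this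
      · rintro ⟨h1, h2, h3⟩
        refine ⟨h1, ?_⟩
        have := X.add_mem ho1 h2; rwa [show p + o + (o + x) = p + x + (o + o) by abel, vv, add_zero] at this
    rw [om_w hX, hwe, ← hci'] at e2 ht
    have hρ4 : (4 : ℚ) ≤ 2 ^ ρ := by
      calc (4:ℚ) = 2 ^ 2 := by norm_num
        _ ≤ _ := pow_le_pow_right₀ (by norm_num) hρ
    have hle : (wt (res (X ⊓ W) o g) : ℚ) ≤ nc (X ⊓ W : Sb V) := by
      exact_mod_cast wt_le_card _
    rcases hρ.eq_or_lt with hr | hr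
    · have hdq : dg 3 (res (X ⊓ W) o g) := by
        have := dg_comp hd (Submodule.inclusion (inf_le_right : X ⊓ W ≤ W)).toAddMonoidHom ⟨e + o, ho2⟩
        convert this using 1
        funext x
        simp only [res]; congr 1
        simp [← add_assoc, vv]
      have hb := om2_bet (res (X ⊓ W) o g)
      have h16 : (wt (res (X ⊓ W) o g) : ℚ) / (2 ^ ρ * nc (X ⊓ W : Sb V)) = om 2 (res (X ⊓ W) o g) / 16 := by
        unfold om; rw [← hr]; field_simp; norm_num
      rw [h16, hb] at e2
      obtain ⟨i, hi⟩ := KT _ V g hdg hgn hog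
      have hbet : ∃ h : ℕ, bet (res (X ⊓ W) o g) = -(1 / 2 ^ h) := by
        rcases quad hdq with h | ⟨h, -, h' | h'⟩
        · linarith
        · have : (0:ℚ) < 1 / 2 ^ h := by positivity
          linarith
        · exact ⟨h, h'⟩
      obtain ⟨h, hh⟩ := hbet
      rw [hh, hi] at e2
      rcases dy_cases (Or.inr ⟨i, rfl⟩ : dy (1 / 2 ^ i)) with hi' | hi' | hi' | hi' | hi'
      · linarith
      · linarith
      · refine ⟨h + 2, Or.inl ?_⟩
        rw [pow_add, show (1:ℚ) / (2 ^ h * 2 ^ 2) = (1 / 2 ^ h) / 4 by field_simp; norm_num]; linarith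
      all_goals
        rcases h with _ | h
        · refine ⟨i, Or.inl ?_⟩
          norm_num at e2 ⊢; linarith
        · have := ip_le (i := h + 1) (j := 1) (by omega)
          norm_num at this e2 hi' ⊢; linarith
    · exfalso
      have h8 : (8 : ℚ) ≤ 2 ^ ρ := by
        calc (8:ℚ) = 2 ^ 3 := by norm_num
          _ ≤ _ := pow_le_pow_right₀ (by norm_num) hr
      have : (wt (res (X ⊓ W) o g) : ℚ) / (2 ^ ρ * nc (X ⊓ W : Sb V)) ≤ 1 / 8 := by
        rw [div_le_div_iff₀ (by positivity) (by norm_num)]; nlinarith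
      linarith
lemma two_flats_M [Finite V] {ρ : ℕ} (hρ : 2 ≤ ρ) {f : V → Zt} (hf : dg (ρ + 3) f) (hV : ¬ Van f 1) (h2 : 2 < om (ρ + 2) f)
    (h5 : om (ρ + 2) f < 5 / 2) {X Y : Sb V} {o : V} (hX : nc V = 2 ^ (ρ + 2) * (2 * nc X))
    (hXY : nc X = 2 * nc (X ⊓ Y : Sb V)) (hY : nc Y = nc X)
    (fX : ∀ x ∈ X, f (o + x) = 1) (fY : ∀ x ∈ Y, f (o + x) = 1) : fin5 (5 / 2 - om (ρ + 2) f) := by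
  have hp := card_pos' (V := (X ⊓ Y : Sb V))
  obtain ⟨y, hy, hyX⟩ : ∃ y ∈ Y, y ∉ X := by
    by_contra hh; push Not at hh
    have : X ⊓ Y = Y := inf_eq_right.2 hh
    rw [this] at hXY hp; omega
  refine Mlem hρ hf hV h2 h5 (X := ad X y) (p := o) (by rw [card_ad hyX, hX]) ?_
  rw [card_ad hyX, w_ad hyX, w_full fX]
  have h1 := w_mono_sub (inf_le_left : X ⊓ Y ≤ X) (o + y) f
  rw [w_full (K := X ⊓ Y) (by intro x hx; rw [add_assoc]; exact fY _ (Y.add_mem hy hx.2))] at h1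
  omega
lemma pair_top [Finite V] {s : ℕ} {f : V → Zt} (hf : dg (s + 2) f) {k : ℕ} {K : Sb V}
    (hK : nc V = 2 ^ (k + 1) * nc K) (h0 : ∀ x ∈ K, f x = 0) (hV : ¬ Van f k) {y1 y2 : V} (hy1 : y1 ∉ K)
    (hy2 : y2 ∉ K) (hy3 : y1 + y2 ∉ K) {X1 X2 : Sb K} {p1 p2 : K} (e1 : res K y1 f = ind X1 p1)
    (c1 : nc K = 2 ^ s * nc X1) (e2 : res K y2 f = ind X2 p2)
    (c2 : nc K = 2 ^ s * nc X2) (o3 : om s (res K (y1 + y2) f) < 2) : X1 ⊔ X2 = ⊤ := by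
  have hd := drop2 hf h0 y1 y2
  rw [e1, e2, add_comm, ← add_assoc] at hd
  by_contra hn
  obtain ⟨a, ha, hk⟩ := exists_ker' hn
  have k1 : kills a X1 := fun x hx => hk x (Submodule.mem_sup_left hx)
  have k2 : kills a X2 := fun x hx => hk x (Submodule.mem_sup_right hx)
  exact hV (line_lem hK h0 hy1 hy2 hy3 ha (e1 ▸ conS_ind k1 p1) (e2 ▸ conS_ind k2 p2) (L1 ha c1.le c2.le k1 k2 hd o3))
lemma quad_Z [Finite V] {s : ℕ} (hs : 2 ≤ s) {f : V → Zt} (hf : dg (s + 2) f) {k : ℕ} {K : Sb V}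
    (hK : nc V = 2 ^ (k + 1) * nc K) (h0 : ∀ x ∈ K, f x = 0) (hV : ¬ Van f k) {y a b : V} (hy : y ∉ K)
    (ha : a ∉ K) (hb : b ∉ K) (hab : a + b ∉ K) (hya : y + a ∉ K) (hyb : y + b ∉ K) (hyab : y + (a + b) ∉ K)
    (oy : om s (res K y f) = 1) (o1 : om s (res K (y + a) f) = 1) (o2 : om s (res K (y + b) f) = 1)
    (o3 : om s (res K (y + (a + b)) f) = 1)
    (u1 : om s (res K a f) < 2) (u2 : om s (res K b f) < 2) (u3 : om s (res K (a + b) f) < 2) : False := by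
  obtain ⟨X1, p1, e1, c1⟩ := om_flat (drop1 hf h0 y) oy
  obtain ⟨X2, p2, e2, c2⟩ := om_flat (drop1 hf h0 (y + a)) o1
  obtain ⟨X3, p3, e3, c3⟩ := om_flat (drop1 hf h0 (y + b)) o2
  obtain ⟨X4, p4, e4, c4⟩ := om_flat (drop1 hf h0 (y + (a + b))) o3
  have q1 : y + (y + a) = a := vvl _ _
  have q2 : y + (y + b) = b := vvl _ _
  have q3 : y + (y + (a + b)) = a + b := vvl _ _
  have q4 : y + a + (y + b) = a + b := by rw [show y + a + (y + b) = a + b + (y + y) by abel, vv, add_zero]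
  have q5 : y + a + (y + (a + b)) = b := by
    rw [show y + a + (y + (a + b)) = b + (y + y) + (a + a) by abel, vv, vv, add_zero, add_zero]
  have q6 : y + b + (y + (a + b)) = a := by
    rw [show y + b + (y + (a + b)) = a + (y + y) + (b + b) by abel, vv, vv, add_zero, add_zero]
  have hd := drop4 hf K y (y + a) (y + b)
  rw [show y + (y + a) + (y + b) = y + (a + b) by rw [q1]; abel, e1, e2, e3, e4] at hd
  exact Q4 hs c1 c2 c3 c4 hd
    (pair_top hf hK h0 hV hy hya (by rwa [q1]) e1 c1 e2 c2 (by rwa [q1]))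
    (pair_top hf hK h0 hV hy hyb (by rwa [q2]) e1 c1 e3 c3 (by rwa [q2]))
    (pair_top hf hK h0 hV hy hyab (by rwa [q3]) e1 c1 e4 c4 (by rwa [q3]))
    (pair_top hf hK h0 hV hya hyb (by rwa [q4]) e2 c2 e3 c3 (by rwa [q4]))
    (pair_top hf hK h0 hV hya hyab (by rwa [q5]) e2 c2 e4 c4 (by rwa [q5]))
    (pair_top hf hK h0 hV hyb hyab (by rwa [q6]) e3 c3 e4 c4 (by rwa [q6]))
lemma closed_card [Finite V] {P : Finset V} (hP : ∀ x ∈ P, ∀ y ∈ P, x + y ∈ P) (h0 : 0 ∈ P) : ∃ n, P.card = 2 ^ n := by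
  let S : Sb V :=
    { carrier := P
      add_mem' := fun {a b} ha hb => hP a ha b hb
      zero_mem' := h0
      smul_mem' := by
        intro c x hx
        rcases z01 c with h | h
        · rw [h, zero_smul]; exact h0
        · rw [h, one_smul]; exact hx }
  obtain ⟨n, hn⟩ := card_pow S
  refine ⟨n, ?_⟩
  rw [← hn]
  have : nc (S : Set V) = P.card := by
    show nc ((P : Set V)) = _
    simp
  exact this.symm
open Classical in
lemma sumset5 [Finite V] {G Q : Finset V} (hG : 5 ≤ G.card) (hQ : Q.card ≤ 4) (h : ∀ a ∈ G, ∀ b ∈ G, a ≠ b → a + b ∈ Q) : False := by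
  obtain ⟨g, hg⟩ : G.Nonempty := by rw [← Finset.card_pos]; omega
  set P := G.image (fun x => g + x) with hP
  have hPc : P.card = G.card := Finset.card_image_of_injective _ (add_right_injective g)
  have hsub : P ⊆ insert 0 Q := by
    intro x hx
    rw [hP, Finset.mem_image] at hx
    obtain ⟨a, ha, rfl⟩ := hx
    by_cases hga : g = a
    · rw [hga, vv]; exact Finset.mem_insert_self _ _
    · exact Finset.mem_insert_of_mem (h g hg a ha hga)
  have hins : (insert 0 Q).card ≤ 5 := (Finset.card_insert_le _ _).trans (by omega)
  have heq : P = insert 0 Q := Finset.eq_of_subset_of_card_le hsub (by omega)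
  have h0 : (0 : V) ∈ P := by rw [heq]; exact Finset.mem_insert_self _ _
  obtain ⟨n, hn⟩ := closed_card (P := P) (by
    intro x hx y hy
    rw [hP, Finset.mem_image] at hx hy
    obtain ⟨a, ha, rfl⟩ := hx
    obtain ⟨b, hb, rfl⟩ := hy
    rw [show g + a + (g + b) = a + b + (g + g) by abel, vv, add_zero]
    by_cases hab : a = b
    · rw [hab, vv]; exact h0
    · rw [heq]; exact Finset.mem_insert_of_mem (h a ha b hb hab)) h0
  have h5 : P.card = 5 := by rw [← heq] at hins; omega
  rw [h5] at hn
  rcases n with _ | _ | _ | n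
  · norm_num at hn
  · norm_num at hn
  · norm_num at hn
  · have : 2 ^ (n + 1 + 1 + 1) = 8 * 2 ^ n := by ring
    omega
open Classical in
lemma kge4 [Finite V] {s : ℕ} (hs : 2 ≤ s) {f : V → Zt} (hf : dg (s + 2) f) {k : ℕ} (hk : 3 ≤ k) {K : Sb V}
    (hK : nc V = 2 ^ (k + 1) * nc K) (h0 : ∀ x ∈ K, f x = 0) (hV : ¬ Van f k) (ho : om (s + 1) f < 5 / 2) : False := by
  obtain ⟨C, cC, C0, Ca, CK, hsum⟩ := sum_setup s hK h0
  have hKT : ∀ y ∉ K, om s (res K y f) = 1 ∨ 3 / 2 ≤ om s (res K y f) := by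
    intro y hy
    rcases KTc (drop1 hf h0 y) (res_ne hK h0 hV hy) with h | h | h
    · left; exact h
    · right; linarith
    · right; linarith
  set ε : V → ℚ := fun c => 2 - om s (res K c f) with hε
  set E0 := C.filter (· ≠ 0) with hE0
  have cE0 : E0.card + 1 = 2 ^ (k + 1) := by
    rw [hE0, Finset.filter_ne', Finset.card_erase_add_one C0, cC]
  have cE0' : (E0.card : ℚ) + 1 = 2 ^ (k + 1) := by exact_mod_cast cE0
  have hM : (16 : ℚ) ≤ 2 ^ (k + 1) := by
    calc (16:ℚ) = 2 ^ 4 := by norm_num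
      _ ≤ _ := pow_le_pow_right₀ (by norm_num) (by omega)
  have hεs : ∑ c ∈ E0, ε c = 2 * E0.card - ∑ c ∈ E0, om s (res K c f) := by
    simp only [hε, Finset.sum_sub_distrib, Finset.sum_const, nsmul_eq_mul]; ring
  have hbig : 3 / 4 * (2:ℚ) ^ (k + 1) - 2 < ∑ c ∈ E0, ε c := by
    rw [hεs]
    have : (2:ℚ) ^ (k + 1) * om (s + 1) f < 2 ^ (k + 1) * (5 / 2) := by gcongr
    linarith
  have mE0 : ∀ {c}, c ∈ E0 ↔ c ∈ C ∧ c ≠ 0 := by intro c; rw [hE0, Finset.mem_filter]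
  have nK : ∀ {c}, c ∈ E0 → c ∉ K := fun h => CK _ (mE0.1 h).1 (mE0.1 h).2
  have nZ : ∀ {c}, c ∈ E0 → om s (res K c f) ≠ 1 → ε c ≤ 1 / 2 := by
    intro c hc h
    rcases hKT c (nK hc) with h1 | h1
    · exact absurd h1 h
    · simp only [hε]; linarith
  obtain ⟨y, hy, oy⟩ : ∃ y ∈ E0, om s (res K y f) = 1 := by
    by_contra hh; push Not at hh
    have : ∑ c ∈ E0, ε c ≤ ∑ c ∈ E0, (1 / 2 : ℚ) := Finset.sum_le_sum fun c hc => nZ hc (hh c hc)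
    rw [Finset.sum_const, nsmul_eq_mul] at this
    linarith
  set E := E0.erase y with hE
  have cE : E.card + 1 = E0.card := Finset.card_erase_add_one hy
  have cE' : (E.card : ℚ) + 1 = E0.card := by exact_mod_cast cE
  have mE : ∀ {c}, c ∈ E ↔ c ≠ y ∧ c ∈ C ∧ c ≠ 0 := by intro c; rw [hE, Finset.mem_erase, mE0]
  have Ey : ∀ c ∈ E, y + c ∈ E := by
    intro c hc
    rw [mE] at hc ⊢
    refine ⟨fun h => hc.2.2 ?_, Ca _ (mE0.1 hy).1 _ hc.2.1, fun h => hc.1 (vv0.1 h).symm⟩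
    simpa using h
  have hEs : ∑ c ∈ E0, ε c = 1 + ∑ c ∈ E, ε c := by
    rw [hE, ← Finset.add_sum_erase _ _ hy]; simp only [hε]; rw [oy]; norm_num
  have flip : ∀ u : V → ℚ, ∑ c ∈ E, u (y + c) = ∑ c ∈ E, u c := by
    intro u
    refine Finset.sum_nbij' (fun c => y + c) (fun c => y + c) Ey Ey ?_ ?_ ?_
    · intro c _; exact vvl _ _
    · intro c _; exact vvl _ _
    · intro c _; rfl
  set G := E.filter (fun c => om s (res K (y + c) f) = 1 ∧ om s (res K c f) < 2) with hG
  have mG : ∀ {c}, c ∈ G ↔ c ∈ E ∧ om s (res K (y + c) f) = 1 ∧ om s (res K c f) < 2 := by intro c; rw [hG, Finset.mem_filter]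
  have mEE0 : ∀ {c}, c ∈ E → c ∈ E0 := fun h => Finset.mem_of_mem_erase h
  set γ : V → ℚ := fun c => if c ∈ G then 1 / 2 else 0 with hγ
  have hγs : ∑ c ∈ E, γ c = G.card / 2 := by
    rw [hγ, ← Finset.sum_filter, Finset.sum_const, nsmul_eq_mul, Finset.filter_mem_eq_inter,
      Finset.inter_eq_right.2 (Finset.filter_subset _ _)]; ring
  have γ0 : ∀ c, 0 ≤ γ c := by intro c; simp only [hγ]; split_ifs <;> norm_num
  have hpt : ∀ c ∈ E, ε c + ε (y + c) ≤ 1 + γ c + γ (y + c) := by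
    intro c hc
    have hc' := Ey c hc
    have a1 := γ0 c; have a2 := γ0 (y + c)
    by_cases z1 : om s (res K c f) = 1
    · have z2 : om s (res K (y + c) f) ≠ 1 := fun z2 => noline hs hf hK h0 hV (nK hy) (nK (mEE0 hc)) (nK (mEE0 hc')) oy z1 z2
      have b1 : ε c = 1 := by simp only [hε]; rw [z1]; norm_num
      have b2 := nZ (mEE0 hc') z2
      by_cases z3 : om s (res K (y + c) f) < 2
      · have : y + c ∈ G := mG.2 ⟨hc', by rw [vvl]; exact z1, z3⟩
        have : γ (y + c) = 1 / 2 := by simp only [hγ]; rw [if_pos this]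
        linarith
      · have : ε (y + c) ≤ 0 := by simp only [hε]; linarith
        linarith
    · have b2 := nZ (mEE0 hc) z1
      by_cases z2 : om s (res K (y + c) f) = 1
      · have b1 : ε (y + c) = 1 := by simp only [hε]; rw [z2]; norm_num
        by_cases z3 : om s (res K c f) < 2
        · have : c ∈ G := mG.2 ⟨hc, z2, z3⟩
          have : γ c = 1 / 2 := by simp only [hγ]; rw [if_pos this]
          linarith
        · have : ε c ≤ 0 := by simp only [hε]; linarith
          linarith
      · have b3 := nZ (mEE0 hc') z2
        linarith
  have hsum2 := Finset.sum_le_sum hpt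
  rw [Finset.sum_add_distrib, Finset.sum_add_distrib, Finset.sum_add_distrib, flip, flip, hγs, Finset.sum_const, nsmul_eq_mul] at hsum2
  have hg : (2:ℚ) ^ (k + 1) / 2 - 4 < G.card := by linarith
  have hg' : 2 ^ (k + 1) < 2 * G.card + 8 := by
    have : (2:ℚ) ^ (k + 1) < 2 * G.card + 8 := by linarith
    exact_mod_cast this
  have hM' : 16 ≤ 2 ^ (k + 1) := by exact_mod_cast hM
  have heven : 2 ^ (k + 1) = 2 * 2 ^ k := by ring
  set Q := E0.filter (fun c => om s (res K c f) ≠ 1 ∧ c ∉ G) with hQ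
  have Gnz : ∀ c ∈ G, om s (res K c f) ≠ 1 := by
    intro c hc h
    rw [mG] at hc
    exact noline hs hf hK h0 hV (nK hy) (nK (mEE0 hc.1)) (nK (mEE0 (Ey c hc.1))) oy h hc.2.1
  apply sumset5 (G := G) (Q := Q) (by omega)
  · have h1 : (insert y (G.image (fun c => y + c))) ∪ G ∪ Q ⊆ E0 := by
      intro c hc
      rw [Finset.mem_union, Finset.mem_union, Finset.mem_insert, Finset.mem_image] at hc
      rcases hc with ((rfl | ⟨d, hd, rfl⟩) | hc) | hc
      · exact hy
      · exact mEE0 (Ey d (mG.1 hd).1)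
      · exact mEE0 (mG.1 hc).1
      · rw [hQ] at hc; exact Finset.mem_of_mem_filter c hc
    have h2 := Finset.card_le_card h1
    have hz : ∀ c ∈ insert y (G.image (fun c => y + c)), om s (res K c f) = 1 := by
      intro c hc
      rw [Finset.mem_insert, Finset.mem_image] at hc
      rcases hc with rfl | ⟨d, hd, rfl⟩
      · exact oy
      · exact (mG.1 hd).2.1
    rw [Finset.card_union_of_disjoint, Finset.card_union_of_disjoint, Finset.card_insert_of_notMem,
      Finset.card_image_of_injective _ (add_right_injective y)] at h2
    · omega
    · intro h
      rw [Finset.mem_image] at h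
      obtain ⟨d, hd, hd'⟩ := h
      have := (mE.1 (mG.1 hd).1).2.2
      exact this (by simpa using hd')
    · rw [Finset.disjoint_left]; intro c h3 h4; exact Gnz c h4 (hz c h3)
    · rw [Finset.disjoint_left]; intro c h3 h4
      rw [hQ, Finset.mem_filter] at h4
      rw [Finset.mem_union] at h3
      rcases h3 with h3 | h3
      · exact h4.2.1 (hz c h3)
      · exact h4.2.2 h3
  · intro a ha b hb hab
    have ha' := mG.1 ha; have hb' := mG.1 hb
    have hab0 : a + b ∈ E0 := mE0.2 ⟨Ca _ (mE0.1 (mEE0 ha'.1)).1 _ (mE0.1 (mEE0 hb'.1)).1, fun h => hab (vv0.1 h)⟩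
    have q4 : y + a + (y + b) = a + b := by rw [show y + a + (y + b) = a + b + (y + y) by abel, vv, add_zero]
    rw [hQ, Finset.mem_filter]
    refine ⟨hab0, fun h => ?_, fun h => ?_⟩
    · exact noline hs hf hK h0 hV (nK (mEE0 (Ey a ha'.1))) (nK (mEE0 (Ey b hb'.1))) (by rw [q4]; exact nK hab0) ha'.2.1 hb'.2.1
        (by rw [q4]; exact h)
    · have h' := mG.1 h
      exact quad_Z hs hf hK h0 hV (nK hy) (nK (mEE0 ha'.1)) (nK (mEE0 hb'.1)) (nK hab0) (nK (mEE0 (Ey _ ha'.1)))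
        (nK (mEE0 (Ey _ hb'.1))) (nK (mEE0 (Ey _ h'.1))) oy ha'.2.1 hb'.2.1 h'.2.1 ha'.2.2 hb'.2.2 h'.2.2
structure fr (K : Sb V) (y1 y2 y3 : V) : Prop where
  a1 : y1 ∉ K
  a2 : y2 ∉ K
  a3 : y3 ∉ K
  b12 : y1 + y2 ∉ K
  b13 : y1 + y3 ∉ K
  b23 : y2 + y3 ∉ K
  c : y1 + y2 + y3 ∉ K
lemma sum3 [Finite V] (s : ℕ) {f : V → Zt} {K : Sb V}
    (hK : nc V = 2 ^ (2 + 1) * nc K) (h0 : ∀ x ∈ K, f x = 0) {y1 y2 y3 : V} (hy : fr K y1 y2 y3) :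
    4 * om (s + 1) f = om s (res K y1 f) + om s (res K y2 f) + om s (res K y3 f) + om s (res K (y1 + y2) f)
      + om s (res K (y1 + y3) f) + om s (res K (y2 + y3) f) + om s (res K (y1 + y2 + y3) f) := by
  have n2 := nmem_ad hy.a2 hy.b12
  have n3 : y3 ∉ ad (ad K y1) y2 := by
    rw [mem_ad, mem_ad, mem_ad, ← add_assoc]; have := hy.a3; have := hy.b13; have := hy.b23; have := hy.c; tauto
  have h1 : ad (ad (ad K y1) y2) y3 = ⊤ := eq_of_le_card le_top (by rw [card_ad n3, card_ad n2, card_ad hy.a1, card_top, hK]; omega)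
  have h2 := w_ad n3 0 f
  have h3 : w K 0 f = 0 := by
    rw [← wt_res, wt_eq_zero]; funext x; simp only [res, zero_add]; exact h0 x x.2
  rw [h1, w_top, w_ad n2, w_ad n2, w_ad hy.a1, w_ad hy.a1, w_ad hy.a1, w_ad hy.a1, h3, zero_add, zero_add, zero_add, zero_add,
    add_comm y2 y1, add_comm y3 y1, add_comm y3 y2, show y2 + y3 + y1 = y1 + y2 + y3 by abel] at h2
  have hKp : (nc K : ℚ) ≠ 0 := by exact_mod_cast card_pos'.ne'
  unfold om; simp only [wt_res]; rw [h2, hK]; push_cast; field_simp; ring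
lemma quad_int [Finite V] {f g : V → Zt} {X : Sb V} {p : V} (hX : nc V = 4 * nc X)
    (hf : dg 3 f) (hg : dg 3 g) (h : dg 2 (f + g + ind X p)) (j : ℕ) (hj : om 2 g = 2 - 2 / 2 ^ j) :
    ∃ n : ℤ, om 2 f = 2 - n / 2 ^ j := by
  have hbg : bet g = 1 / 2 ^ j := by
    have := om2_bet g; rw [hj] at this; rw [show (2:ℚ) / 2 ^ j = 2 * (1 / 2 ^ j) by ring] at this; linarith
  have hpos : (0:ℚ) < 1 / 2 ^ j := by positivity
  obtain ⟨j', c1, c2⟩ : ∃ h : ℕ, 4 ^ h * nc (rad g) = nc V ∧ bet g = 1 / 2 ^ h := by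
    rcases quad hg with h | ⟨h, h1, h2 | h2⟩
    · rw [h] at hbg; linarith
    · exact ⟨h, h1, h2⟩
    · rw [h2] at hbg; have : (0:ℚ) < 1 / 2 ^ h := by positivity
      linarith
  have hjj : j' = j := by
    rw [hbg] at c2
    have h1 : (2:ℚ) ^ j = 2 ^ j' := by
      have := one_div_one_div ((2:ℚ) ^ j); rw [c2, one_div_one_div] at this; exact this.symm
    exact (pow_right_injective₀ (by norm_num : (0:ℚ) < 2) (by norm_num) h1).symm
  subst hjj
  rw [om2_bet]
  rcases quad hf with h' | ⟨i, h1, h2⟩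
  · exact ⟨0, by rw [h']; simp⟩
  · have hi := quad_ratio hX h h1 c1
    have hp : (2:ℚ) * (1 / 2 ^ i) = (2 ^ (j' + 1 - i) : ℤ) / 2 ^ j' := by
      push_cast
      rw [mul_one_div, div_eq_div_iff (by positivity) (by positivity), ← pow_add, show j' + 1 - i + i = j' + 1 by omega, pow_succ]; ring
    rcases h2 with h2 | h2
    · exact ⟨_, by rw [h2, hp]⟩
    · exact ⟨-2 ^ (j' + 1 - i), by rw [h2, mul_neg, hp]; push_cast; ring⟩
lemma k3_s2 [Finite V] {f : V → Zt} (hf : dg 4 f) {K : Sb V}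
    (hK : nc V = 2 ^ (2 + 1) * nc K) (h0 : ∀ x ∈ K, f x = 0) (hV : ¬ Van f 2) {y1 y2 y3 : V} (hy : fr K y1 y2 y3)
    (o1 : om 2 (res K y1 f) = 1) (o2 : om 2 (res K y2 f) = 1) (o3 : om 2 (res K y3 f) = 1)
    (h2 : 2 < om 3 f) (h5 : om 3 f < 5 / 2) : fin5 (5 / 2 - om 3 f) := by
  have hsum := sum3 2 hK h0 hy
  have key : ∀ y z, y ∉ K → z ∉ K → y + z ∉ K → om 2 (res K y f) = 1 → om 2 (res K z f) = 1 →
      ∃ n : ℤ, n ≤ 1 ∧ om 2 (res K (y + z) f) = 2 - n / 2 := by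
    intro y z hy hz hyz oy oz
    obtain ⟨X, p, e, c⟩ := om_flat (drop1 hf h0 y) oy
    have hd := drop2 hf h0 y z
    rw [e, show ind X p + res K z f + res K (y + z) f = res K (y + z) f + res K z f + ind X p by abel] at hd
    obtain ⟨n, hn⟩ := quad_int (by rw [c]; norm_num) (drop1 hf h0 _) (drop1 hf h0 _) hd 1 (by rw [oz]; norm_num)
    rw [pow_one] at hn
    refine ⟨n, ?_, hn⟩
    by_contra hlt
    have : (2:ℚ) ≤ n := by exact_mod_cast (by omega : 2 ≤ n)
    rcases KTc (drop1 hf h0 _) (res_ne hK h0 hV hyz) with h | h | h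
    · exact noline le_rfl hf hK h0 hV hy hz hyz oy oz h
    · linarith
    · linarith
  have keyc : ∀ y z t, om 2 (res K y f) = 1 → om 2 (res K z f) = 3 / 2 → y + z = t → ∃ n : ℤ, om 2 (res K t f) = 2 - n / 4 := by
    intro y z t oy oz ht
    obtain ⟨X, p, e, c⟩ := om_flat (drop1 hf h0 y) oy
    have hd := drop2 hf h0 y z
    rw [ht, e, show ind X p + res K z f + res K t f = res K t f + res K z f + ind X p by abel] at hd
    obtain ⟨n, hn⟩ := quad_int (by rw [c]; norm_num) (drop1 hf h0 _) (drop1 hf h0 _) hd 2 (by rw [oz]; norm_num)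
    exact ⟨n, by rw [hn]; norm_num⟩
  obtain ⟨n12, l12, e12⟩ := key _ _ hy.a1 hy.a2 hy.b12 o1 o2
  obtain ⟨n13, l13, e13⟩ := key _ _ hy.a1 hy.a3 hy.b13 o1 o3
  obtain ⟨n23, l23, e23⟩ := key _ _ hy.a2 hy.a3 hy.b23 o2 o3
  rw [o1, o2, o3, e12, e13, e23] at hsum
  by_cases oc : om 2 (res K (y1 + y2 + y3) f) = 1
  · rw [oc] at hsum
    have hN : 5 / 2 - om 3 f = ((n12 + n13 + n23 : ℤ) : ℚ) / 8 := by push_cast; linarith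
    have h3 : 0 < n12 + n13 + n23 := by
      by_contra hh
      have : ((n12 + n13 + n23 : ℤ) : ℚ) ≤ 0 := by exact_mod_cast not_lt.1 hh
      linarith
    rw [hN]
    obtain h | h | h : n12 + n13 + n23 = 1 ∨ n12 + n13 + n23 = 2 ∨ n12 + n13 + n23 = 3 := by omega
    · exact ⟨3, Or.inl (by rw [h]; norm_num)⟩
    · exact ⟨2, Or.inl (by rw [h]; norm_num)⟩
    · exact ⟨3, Or.inr (by rw [h]; norm_num)⟩
  · have oc' : 3 / 2 ≤ om 2 (res K (y1 + y2 + y3) f) := by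
      rcases KTc (drop1 hf h0 _) (res_ne hK h0 hV hy.c) with h | h | h
      · exact absurd h oc
      · linarith
      · linarith
    have hs : n12 = 1 ∨ n13 = 1 ∨ n23 = 1 := by
      by_contra hh
      have : ((n12 + n13 + n23 : ℤ) : ℚ) ≤ 0 := by exact_mod_cast (by omega)
      push_cast at this
      linarith
    obtain ⟨n, hn⟩ : ∃ n : ℤ, om 2 (res K (y1 + y2 + y3) f) = 2 - n / 4 := by
      rcases hs with h | h | h
      · exact keyc y3 (y1 + y2) _ o3 (by rw [e12, h]; norm_num) (by abel)
      · exact keyc y2 (y1 + y3) _ o2 (by rw [e13, h]; norm_num) (by abel)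
      · exact keyc y1 (y2 + y3) _ o1 (by rw [e23, h]; norm_num) (by abel)
    have hn2 : n ≤ 2 := by
      by_contra hh
      have : (3:ℚ) ≤ n := by exact_mod_cast (by omega : 3 ≤ n)
      linarith
    rw [hn] at hsum
    have hN : 5 / 2 - om 3 f = ((2 * (n12 + n13 + n23) + n - 4 : ℤ) : ℚ) / 16 := by push_cast; linarith
    have h3 : 0 < 2 * (n12 + n13 + n23) + n - 4 := by
      by_contra hh
      have : ((2 * (n12 + n13 + n23) + n - 4 : ℤ) : ℚ) ≤ 0 := by exact_mod_cast not_lt.1 hh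
      linarith
    rw [hN]
    obtain ⟨m, hm⟩ : ∃ m, m = 2 * (n12 + n13 + n23) + n - 4 := ⟨_, rfl⟩
    rw [← hm] at h3 ⊢
    obtain h | h | h | h : m = 1 ∨ m = 2 ∨ m = 3 ∨ m = 4 := by omega
    · exact ⟨4, Or.inl (by rw [h]; norm_num)⟩
    · exact ⟨3, Or.inl (by rw [h]; norm_num)⟩
    · exact ⟨4, Or.inr (by rw [h]; norm_num)⟩
    · exact ⟨2, Or.inl (by rw [h]; norm_num)⟩
lemma om_top_inter [Finite V] {r : ℕ} {X Y : Sb V} (hX : nc V = 2 ^ r * nc X) (hY : nc V = 2 ^ r * nc Y)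
    (h : X ⊔ Y = ⊤) (p q : V) : om r (ind X p * ind Y q) = 1 / 2 ^ r := by
  have h1 := om_add r (ind X p) (ind Y q)
  rw [om_two hX hY h, om_ind hX, om_ind hY] at h1
  rw [show (2:ℚ) / 2 ^ r = 2 * (1 / 2 ^ r) by ring] at h1; linarith
lemma eq_of_om_one [Finite V] {r : ℕ} {X Y : Sb V} (hX : nc V = 2 ^ r * nc X) (hY : nc V = 2 ^ r * nc Y)
    {p q : V} (h : om r (ind X p * ind Y q) = 1) : X = Y := by
  obtain ⟨o, ho⟩ := om_pt (r := r) (f := ind X p * ind Y q) (by rw [h]; norm_num)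
  rw [Pi.mul_apply, mul1, ind1, ind1] at ho
  rw [pair_val ho.1 ho.2, om_ind' hX] at h
  have hp : (nc X : ℚ) ≠ 0 := by exact_mod_cast card_pos'.ne'
  rw [div_eq_one_iff_eq hp] at h
  have h' : nc (X ⊓ Y : Sb V) = nc X := by exact_mod_cast h
  have h1 : X ⊓ Y = X := eq_of_le_card inf_le_left h'.ge
  have h2 : X ≤ Y := inf_eq_left.1 h1
  exact eq_of_le_card h2 (by
    rw [hX] at hY; exact (Nat.eq_of_mul_eq_mul_left (by positivity) hY).ge)
lemma two_two [Finite V] {s : ℕ} (hs : 3 ≤ s) {X1 X2 X3 X4 : Sb V} {q1 q2 q3 q4 : V}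
    (c1 : nc V = 2 ^ s * nc X1) (c2 : nc V = 2 ^ s * nc X2) (c3 : nc V = 2 ^ s * nc X3)
    (c4 : nc V = 2 ^ s * nc X4) (h12 : X1 ⊔ X2 = ⊤) (h34 : X3 ⊔ X4 = ⊤)
    (e : ind X1 q1 + ind X2 q2 = ind X3 q3 + ind X4 q4) : X3 = X1 ∨ X3 = X2 := by
  by_contra hh; push Not at hh
  have hx : om s (ind X3 q3 * ind X1 q1) ≠ 1 := fun h => hh.1 (eq_of_om_one c3 c1 h)
  have hy : om s (ind X3 q3 * ind X2 q2) ≠ 1 := fun h => hh.2 (eq_of_om_one c3 c2 h)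
  have e1 : ind X3 q3 * ind X1 q1 + ind X3 q3 * ind X2 q2 = ind X3 q3 + ind X3 q3 * ind X4 q4 := by
    have := congrArg (fun g => ind X3 q3 * g) e
    simp only [mul_add] at this
    rw [this]; congr 1
    funext x; simp only [Pi.mul_apply]; generalize ind X3 q3 x = a; clear * -; revert a; decide
  have a1 := om_add s (ind X3 q3 * ind X1 q1) (ind X3 q3 * ind X2 q2)
  have a2 := om_add s (ind X3 q3) (ind X3 q3 * ind X4 q4)
  have m1 : ind X3 q3 * ind X1 q1 * (ind X3 q3 * ind X2 q2) = ind X3 q3 * ind X1 q1 * ind X2 q2 := by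
    funext x; simp only [Pi.mul_apply]; generalize ind X3 q3 x = a; generalize ind X1 q1 x = b; generalize ind X2 q2 x = c
    clear * -; revert a b c; decide
  have m2 : ind X3 q3 * (ind X3 q3 * ind X4 q4) = ind X3 q3 * ind X4 q4 := by
    funext x; simp only [Pi.mul_apply]; generalize ind X3 q3 x = a; generalize ind X4 q4 x = b
    clear * -; revert a b; decide
  rw [m1, e1] at a1
  rw [m2, om_ind c3, om_top_inter c3 c4 h34] at a2
  have hg : om s (ind X3 q3 * ind X1 q1 * ind X2 q2) ≤ 1 / 2 ^ s := by
    rw [← om_top_inter c1 c2 h12 q1 q2]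
    apply om_mono
    intro x hx; simp only [Pi.mul_apply, mul1] at hx ⊢; exact ⟨hx.1.2, hx.2⟩
  have hd8 : (1:ℚ) / 2 ^ s ≤ 1 / 8 := by have := ip_le hs; norm_num at this ⊢; exact this
  have hd0 : (0:ℚ) < 1 / 2 ^ s := by positivity
  have g0 := om_nonneg s (ind X3 q3 * ind X1 q1 * ind X2 q2)
  have f3 := @f3_om _ _ _ _ s X3 X1 X2 q3 q1 q2 c3
  have dx := dy_cases (pair_dy (r := s) (B := X1) c3 q3 q1)
  have dY := dy_cases (pair_dy (r := s) (B := X2) c3 q3 q2)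
  revert hx hy a1 f3 dx dY hg g0
  generalize om s (ind X3 q3 * ind X1 q1 * ind X2 q2) = γ
  generalize om s (ind X3 q3 * ind X1 q1) = x
  generalize om s (ind X3 q3 * ind X2 q2) = y
  intro hx hy a1 hg g0 f3 dx dY
  have hx2 : x ≤ 1 / 2 := by rcases dx with h | h | h | h | h <;> first | exact absurd h hx | linarith
  have hy2 : y ≤ 1 / 2 := by rcases dY with h | h | h | h | h <;> first | exact absurd h hy | linarith
  have hx3 : x = 1 / 2 := by rcases dx with h | h | h | h | h <;> linarith
  have hy3 : y = 1 / 2 := by rcases dY with h | h | h | h | h <;> linarith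
  have := f3 (by linarith)
  rw [hx3, hy3] at this
  linarith
lemma w_map [Finite V] (K : Sb V) (X : Sb K) (y : V) (k : K) (f : V → Zt) :
    w (X.map K.subtype) (y + k) f = w X k (res K y f) := by
  unfold w
  have : {x | f x = 1 ∧ y + (k : V) + x ∈ X.map K.subtype} = (fun z : K => y + (z : V)) '' {x | res K y f x = 1 ∧ k + x ∈ X} := by
    ext x; simp only [Set.mem_setOf_eq, Set.mem_image, Submodule.mem_map, res]
    constructor
    · rintro ⟨h1, z, hz, h2⟩
      rw [Submodule.subtype_apply] at h2
      refine ⟨k + z, ⟨?_, ?_⟩, ?_⟩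
      · rw [Submodule.coe_add, h2, show y + ((k : V) + (y + k + x)) = x + (y + y) + (k + k) by abel, vv, vv, add_zero, add_zero]; exact h1
      · rw [vvl]; exact hz
      · rw [Submodule.coe_add, h2, show y + ((k : V) + (y + k + x)) = x + (y + y) + (k + k) by abel, vv, vv, add_zero, add_zero]
    · rintro ⟨z, ⟨h1, h2⟩, rfl⟩
      refine ⟨h1, k + z, h2, ?_⟩
      rw [Submodule.subtype_apply, Submodule.coe_add, show y + (k : V) + (y + z) = k + z + (y + y) by abel, vv, add_zero]
  rw [this, Set.ncard_image_of_injective]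
  intro a b h; exact Subtype.ext (add_left_cancel h)
lemma exists_shift {X Y : Sb V} (h : X ⊔ Y = ⊤) (t : V) : ∃ k : X, t + k ∈ Y := by
  have : t ∈ X ⊔ Y := by rw [h]; trivial
  obtain ⟨a, ha, b, hb, rfl⟩ := Submodule.mem_sup.1 this
  exact ⟨⟨a, ha⟩, by show a + b + a ∈ Y; rwa [add_comm a b, add_assoc, vv, add_zero]⟩
lemma k3_M [Finite V] {s : ℕ} (hs : 3 ≤ s) {f : V → Zt} (hf : dg (s + 2) f) {K : Sb V}
    (hK : nc V = 2 ^ (2 + 1) * nc K) (h0 : ∀ x ∈ K, f x = 0) (hV1 : ¬ Van f 1) {y1 y2 y3 : V} (hy : fr K y1 y2 y3)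
    {X1 X2 : Sb K} {p1 p2 p3 q1 q2 : K}
    (c1 : nc K = 2 ^ s * nc X1) (c2 : nc K = 2 ^ s * nc X2) (h12 : X1 ⊔ X2 = ⊤)
    (e1 : res K y1 f = ind X1 p1) (e2 : res K y2 f = ind X2 p2) (e3 : res K y3 f = ind X1 p3)
    (e12 : res K (y1 + y2) f = ind X1 q1 + ind X2 q2)
    (h2 : 2 < om (s + 1) f) (h5 : om (s + 1) f < 5 / 2) : fin5 (5 / 2 - om (s + 1) f) := by
  obtain ⟨ρ, rfl⟩ : ∃ ρ, s = ρ + 1 := ⟨s - 1, by omega⟩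
  obtain ⟨Y, hY⟩ : ∃ Y, Y = X1.map K.subtype := ⟨_, rfl⟩
  have YK : Y ≤ K := by rw [hY]; exact Submodule.map_subtype_le _ _
  have cY : nc Y = nc X1 := by rw [hY]; exact card_map' K X1
  have cc : nc X1 = 2 ^ (ρ + 1) * nc (X2 ⊓ X1 : Sb K) := by
    have := card_sup_inf X1 X2
    rw [h12, card_top, c2, inf_comm] at this
    have hp := card_pos' (V := X2)
    nlinarith
  have n1 : y1 + p1 + y3 + p3 ∉ Y := by
    intro h
    apply hy.b13
    have := K.add_mem (YK h) (K.add_mem p1.2 p3.2)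
    rwa [show y1 + p1 + y3 + p3 + ((p1 : V) + p3) = y1 + y3 + (p1 + p1) + (p3 + p3) by abel, vv, vv, add_zero, add_zero] at this
  have n2 : y2 + p1 + q1 ∉ ad Y (y1 + p1 + y3 + p3) := by
    rw [mem_ad]; push Not
    constructor
    · intro h
      apply hy.a2
      have := K.add_mem (YK h) (K.add_mem p1.2 q1.2)
      rwa [show y2 + p1 + q1 + ((p1 : V) + q1) = y2 + (p1 + p1) + (q1 + q1) by abel, vv, vv, add_zero, add_zero] at this
    · intro h
      apply hy.c
      have := K.add_mem (YK h) (K.add_mem p3.2 q1.2)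
      rwa [show y1 + p1 + y3 + p3 + (y2 + p1 + q1) + ((p3 : V) + q1) = y1 + y2 + y3 + (p1 + p1) + (p3 + p3) + (q1 + q1) by abel, vv, vv, vv, add_zero, add_zero, add_zero] at this
  have hw := w_ad n2 (y1 + p1) f
  rw [w_ad n1, w_ad n1,
    show y1 + (p1 : V) + (y1 + p1 + y3 + p3) = y3 + p3 + (y1 + y1) + (p1 + p1) by abel, vv, vv, add_zero, add_zero,
    show y1 + (p1 : V) + (y2 + p1 + q1) = y1 + y2 + q1 + (p1 + p1) by abel, vv, add_zero,
    show y1 + y2 + (q1 : V) + (y1 + p1 + y3 + p3) = y2 + y3 + ((p1 + p3 + q1 : K) : V) + (y1 + y1) by push_cast; abel, vv, add_zero,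
    hY, w_map, w_map, w_map, w_map, e1, e3, e12] at hw
  have w1 : ∀ p : K, w X1 p (ind X1 p) = nc X1 := fun p => w_full (fun x hx => by rw [ind1, vvl]; exact hx)
  rw [w1, w1] at hw
  have w3 : nc X1 ≤ w X1 q1 (ind X1 q1 + ind X2 q2) + nc (X2 ⊓ X1 : Sb K) := by
    have ha := wt_add_mul (res X1 q1 (ind X1 q1)) (res X1 q1 (ind X2 q2))
    obtain ⟨k, hk⟩ := exists_shift h12 (q2 + q1)
    have hone : res X1 q1 (ind X1 q1) = 1 := funext fun x => by
      show ind X1 q1 (q1 + x) = 1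
      rw [ind1, vvl]; exact x.2
    rw [← res_add, wt_res, hone, one_mul, wt_one, res_ind_mem X1 X2 hk, wt_ind, card_sub] at ha
    omega
  have w4 : nc (X2 ⊓ X1 : Sb K) ≤ w X1 (p1 + p3 + q1) (res K (y2 + y3) f) := by
    have hd := dg_res (drop2 hf h0 y2 y3) X1 (p1 + p3 + q1)
    rw [e2, e3, res_add, res_add] at hd
    obtain ⟨k, hk⟩ := exists_shift h12 (p2 + (p1 + p3 + q1))
    rw [res_ind_mem X1 X2 hk] at hd
    have hc : dg (ρ + 1) (res X1 (p1 + p3 + q1) (ind X1 p3)) := by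
      rcases res_ind_cases X1 X1 (p1 + p3 + q1) p3 with h | ⟨k', h⟩
      · rw [h]; exact dg_zero _
      · rw [h, show ind (sub X1 X1) k' = fun _ => 1 from funext fun x => by rw [ind1, mem_sub]; exact (k' + x).2]
        exact dg_const _ _
    have hne : res X1 (p1 + p3 + q1) (res K (y2 + y3) f) ≠ 0 := by
      intro h
      rw [h, add_zero] at hd
      have := dg_add hd hc
      rw [add_assoc, fadd, add_zero] at this
      exact not_dg_ind (by rw [card_sub]; exact cc) _ this
    have hd2 : dg (ρ + 1 + 1) (res X1 (p1 + p3 + q1) (res K (y2 + y3) f)) := dg_res (drop1 hf h0 _) _ _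
    have := minw hd2 hne
    rw [wt_res, cc] at this
    exact Nat.le_of_mul_le_mul_left this (by positivity)
  rw [← hY] at hw
  refine Mlem (ρ := ρ) (by omega) hf hV1 h2 h5 (X := ad (ad Y (y1 + p1 + y3 + p3)) (y2 + p1 + q1)) (p := y1 + p1) ?_ ?_
  · rw [card_ad n2, card_ad n1, cY, hK, c1]; ring
  · rw [hw, card_ad n2, card_ad n1, cY]; omega
lemma pair_val2 [Finite V] {s : ℕ} (hs : 1 ≤ s) {f : V → Zt} (hf : dg (s + 2) f) {k : ℕ} {K : Sb V}
    (hK : nc V = 2 ^ (k + 1) * nc K) (h0 : ∀ x ∈ K, f x = 0) (hV : ¬ Van f k) {y1 y2 : V} (hy1 : y1 ∉ K)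
    (hy2 : y2 ∉ K) (hy3 : y1 + y2 ∉ K) {X1 X2 : Sb K} {p1 p2 : K} (e1 : res K y1 f = ind X1 p1)
    (c1 : nc K = 2 ^ s * nc X1) (e2 : res K y2 f = ind X2 p2)
    (c2 : nc K = 2 ^ s * nc X2) (o3 : om s (res K (y1 + y2) f) < 2) : X1 ⊔ X2 = ⊤ ∧
    ∃ q1 q2, res K (y1 + y2) f = ind X1 q1 + ind X2 q2 := by
  have ht := pair_top hf hK h0 hV hy1 hy2 hy3 e1 c1 e2 c2 o3
  refine ⟨ht, TT (p1 := p1) (p2 := p2) hs (drop1 hf h0 _) c1 c2 ?_ ht o3⟩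
  have := drop2 hf h0 y1 y2
  rwa [e1, e2, show ind X1 p1 + ind X2 p2 + res K (y1 + y2) f = res K (y1 + y2) f + ind X1 p1 + ind X2 p2 by abel] at this
lemma fr.swap {K : Sb V} {y1 y2 y3 : V} (h : fr K y1 y2 y3) : fr K y2 y1 y3 :=
  ⟨h.a2, h.a1, h.a3, by rw [add_comm]; exact h.b12, h.b23, h.b13, by rw [add_comm y2]; exact h.c⟩
lemma fr.rot {K : Sb V} {y1 y2 y3 : V} (h : fr K y1 y2 y3) : fr K y2 y3 y1 :=
  ⟨h.a2, h.a3, h.a1, h.b23, by rw [add_comm]; exact h.b12, by rw [add_comm]; exact h.b13, by rw [show y2 + y3 + y1 = y1 + y2 + y3 by abel]; exact h.c⟩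
lemma k3_c [Finite V] {s : ℕ} (hs : 3 ≤ s) {f : V → Zt} (hf : dg (s + 2) f) {K : Sb V}
    (hK : nc V = 2 ^ (2 + 1) * nc K) (h0 : ∀ x ∈ K, f x = 0) (hV : ¬ Van f 2) (hV1 : ¬ Van f 1) {y1 y2 y3 : V} (hy : fr K y1 y2 y3)
    (o1 : om s (res K y1 f) = 1) (o2 : om s (res K y2 f) = 1) (o3 : om s (res K y3 f) = 1)
    (oc : om s (res K (y1 + y2 + y3) f) = 1) (o12 : om s (res K (y1 + y2) f) < 2)
    (h2 : 2 < om (s + 1) f) (h5 : om (s + 1) f < 5 / 2) : fin5 (5 / 2 - om (s + 1) f) := by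
  obtain ⟨X1, p1, e1, c1⟩ := om_flat (drop1 hf h0 y1) o1
  obtain ⟨X2, p2, e2, c2⟩ := om_flat (drop1 hf h0 y2) o2
  obtain ⟨X3, p3, e3, c3⟩ := om_flat (drop1 hf h0 y3) o3
  obtain ⟨X4, p4, e4, c4⟩ := om_flat (drop1 hf h0 (y1 + y2 + y3)) oc
  have hc : y3 + (y1 + y2 + y3) = y1 + y2 := by rw [add_comm (y1 + y2), vvl]
  obtain ⟨t12, q1, q2, e12⟩ := pair_val2 (by omega) hf hK h0 hV hy.a1 hy.a2 hy.b12 e1 c1 e2 c2 o12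
  obtain ⟨t34, q3, q4, e34⟩ := pair_val2 (by omega) hf hK h0 hV hy.a3 hy.c (by rw [hc]; exact hy.b12) e3 c3 e4 c4 (by rw [hc]; exact o12)
  rw [hc] at e34
  rcases two_two hs c1 c2 c3 c4 t12 t34 (e12.symm.trans e34) with rfl | rfl
  · exact k3_M hs hf hK h0 hV1 hy c1 c2 t12 e1 e2 e3 e12 h2 h5
  · exact k3_M hs hf hK h0 hV1 hy.swap c2 c1 (by rw [sup_comm]; exact t12) e2 e1 e3 (by rw [add_comm y2, e12, add_comm]) h2 h5
lemma k3_s3 [Finite V] {s : ℕ} (hs : 3 ≤ s) {f : V → Zt} (hf : dg (s + 2) f) {K : Sb V}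
    (hK : nc V = 2 ^ (2 + 1) * nc K) (h0 : ∀ x ∈ K, f x = 0) (hV : ¬ Van f 2) (hV1 : ¬ Van f 1) {y1 y2 y3 : V} (hy : fr K y1 y2 y3)
    (o1 : om s (res K y1 f) = 1) (o2 : om s (res K y2 f) = 1) (o3 : om s (res K y3 f) = 1)
    (h2 : 2 < om (s + 1) f) (h5 : om (s + 1) f < 5 / 2) : fin5 (5 / 2 - om (s + 1) f) := by
  have hsum := sum3 s hK h0 hy
  rw [o1, o2, o3] at hsum
  have hd8 : (2:ℚ) / 2 ^ s ≤ 1 / 4 := by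
    have := ip_le hs; rw [show (2:ℚ) / 2 ^ s = 2 * (1 / 2 ^ s) by ring]; norm_num at this ⊢; linarith
  by_cases oc : om s (res K (y1 + y2 + y3) f) = 1
  · by_cases l12 : om s (res K (y1 + y2) f) < 2
    · exact k3_c hs hf hK h0 hV hV1 hy o1 o2 o3 oc l12 h2 h5
    by_cases l13 : om s (res K (y1 + y3) f) < 2
    · exact k3_c hs hf hK h0 hV hV1 hy.rot.rot o3 o1 o2 (by rwa [show y3 + y1 + y2 = y1 + y2 + y3 by abel]) (by rwa [add_comm y3]) h2 h5
    by_cases l23 : om s (res K (y2 + y3) f) < 2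
    · exact k3_c hs hf hK h0 hV hV1 hy.rot o2 o3 o1 (by rwa [show y2 + y3 + y1 = y1 + y2 + y3 by abel]) l23 h2 h5
    linarith
  · have key : ∀ y z, y ∉ K → z ∉ K → y + z ∉ K → om s (res K y f) = 1 → om s (res K z f) = 1 →
        om s (res K (y + z) f) = 2 - 2 / 2 ^ s ∨ 2 ≤ om s (res K (y + z) f) := by
      intro y z hy hz hyz oy oz
      by_cases h : om s (res K (y + z) f) < 2
      · left
        obtain ⟨X1, p1, e1, c1⟩ := om_flat (drop1 hf h0 y) oy
        obtain ⟨X2, p2, e2, c2⟩ := om_flat (drop1 hf h0 z) oz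
        obtain ⟨t, q1, q2, e⟩ := pair_val2 (by omega) hf hK h0 hV hy hz hyz e1 c1 e2 c2 h
        rw [e]; exact om_two c1 c2 t _ _
      · right; linarith
    have k12 := key _ _ hy.a1 hy.a2 hy.b12 o1 o2
    have k13 := key _ _ hy.a1 hy.a3 hy.b13 o1 o3
    have k23 := key _ _ hy.a2 hy.a3 hy.b23 o2 o3
    have hs3 : s = 3 ∨ (2:ℚ) / 2 ^ s ≤ 1 / 8 := by
      rcases hs.lt_or_eq with h | h
      · right
        have := ip_le (show 4 ≤ s from h); rw [show (2:ℚ) / 2 ^ s = 2 * (1 / 2 ^ s) by ring]; norm_num at this ⊢; linarith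
      · left; exact h.symm
    have hp : (0:ℚ) < 2 / 2 ^ s := by positivity
    refine ⟨4, Or.inl ?_⟩
    rcases KTc (drop1 hf h0 _) (res_ne hK h0 hV hy.c) with h | h | h
    · exact absurd h oc
    · rcases hs3 with rfl | hs3
      · norm_num at k12 k13 k23 ⊢
        rcases k12 with h1 | h1 <;> rcases k13 with h2 | h2 <;> rcases k23 with h3 | h3 <;> linarith
      · exfalso
        rcases k12 with h1 | h1 <;> rcases k13 with h2 | h2 <;> rcases k23 with h3 | h3 <;> linarith
    · exfalso
      rcases k12 with h1 | h1 <;> rcases k13 with h2 | h2 <;> rcases k23 with h3 | h3 <;> linarith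
lemma fin5_half {v : ℚ} (n : ℕ) {i : ℕ} (h : v = 1 / 2 ^ i / 2 ^ n) : fin5 v := ⟨i + n, Or.inl (by rw [h, pow_add]; field_simp)⟩
lemma exists_out [Finite V] {K : Sb V} (h : nc K < nc V) : ∃ y, y ∉ K := by
  by_contra hh; push Not at hh
  have : K = ⊤ := eq_top_iff.2 fun x _ => hh x
  rw [this, card_top] at h; omega
lemma om_KT [Finite V] {s : ℕ} {f : V → Zt} (hf : dg (s + 1) f) (hne : f ≠ 0) (v : ℚ) (n : ℕ) (h : v = (2 - om s f) / 2 ^ n) (hv : 0 < v) : fin5 v := by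
  have : om s f < 2 := by
    by_contra hh; push Not at hh
    have : (2 - om s f) / 2 ^ n ≤ 0 := div_nonpos_of_nonpos_of_nonneg (by linarith) (by positivity)
    linarith
  obtain ⟨i, hi⟩ := KT s V f hf hne this
  exact fin5_half n (i := i) (by rw [h, hi]; ring)
lemma k3 [Finite V] {s : ℕ} (hs : 2 ≤ s) {f : V → Zt} (hf : dg (s + 2) f) {K : Sb V}
    (hK : nc V = 2 ^ (2 + 1) * nc K) (h0 : ∀ x ∈ K, f x = 0) (hV : ¬ Van f 2) (hV1 : ¬ Van f 1)
    (h2 : 2 < om (s + 1) f) (h5 : om (s + 1) f < 5 / 2) : fin5 (5 / 2 - om (s + 1) f) := by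
  have hKp := card_pos' (V := K)
  have hKT : ∀ y ∉ K, om s (res K y f) = 1 ∨ om s (res K y f) = 3 / 2 ∨ 7 / 4 ≤ om s (res K y f) := fun y hy =>
    KTc (drop1 hf h0 y) (res_ne hK h0 hV hy)
  have hfin : ∀ y, y ∉ K → 5 / 2 - om (s + 1) f = (2 - om s (res K y f)) / 2 ^ 2 → fin5 (5 / 2 - om (s + 1) f) := fun y hy h =>
    om_KT (drop1 hf h0 y) (res_ne hK h0 hV hy) _ 2 h (by linarith)
  have mk : ∀ y1 y2 y3, y1 ∉ K → y2 ∉ ad K y1 → y3 ∉ ad (ad K y1) y2 → fr K y1 y2 y3 := by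
    intro y1 y2 y3 h1 h2 h3
    rw [mem_ad] at h2; rw [mem_ad, mem_ad, mem_ad, ← add_assoc] at h3
    push Not at h2 h3
    exact ⟨h1, h2.1, h3.1.1, h2.2, h3.1.2, h3.2.1, h3.2.2⟩
  have ext2 : ∀ y1, y1 ∉ K → ∃ y2, y2 ∉ ad K y1 := fun y1 h1 => exists_out (by rw [card_ad h1]; omega)
  have ext3 : ∀ y1 y2, y1 ∉ K → y2 ∉ ad K y1 → ∃ y3, y3 ∉ ad (ad K y1) y2 := fun y1 y2 h1 h2 =>
    exists_out (by rw [card_ad h2, card_ad h1]; omega)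
  obtain ⟨y1, a1, o1⟩ : ∃ y ∉ K, om s (res K y f) = 1 := by
    by_contra hh; push Not at hh
    obtain ⟨y1, h1⟩ := exists_notin hK
    obtain ⟨y2, h2'⟩ := ext2 y1 h1
    obtain ⟨y3, h3⟩ := ext3 y1 y2 h1 h2'
    have hy := mk _ _ _ h1 h2' h3
    have hsum := sum3 s hK h0 hy
    have hb : ∀ y ∉ K, 3 / 2 ≤ om s (res K y f) := fun y hy => by
      rcases hKT y hy with h | h | h
      · exact absurd h (hh y hy)
      · linarith
      · linarith
    linarith [hb _ hy.a1, hb _ hy.a2, hb _ hy.a3, hb _ hy.b12, hb _ hy.b13, hb _ hy.b23, hb _ hy.c]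
  obtain ⟨y2, a2, o2⟩ : ∃ y ∉ ad K y1, om s (res K y f) = 1 := by
    by_contra hh; push Not at hh
    obtain ⟨y2, h2'⟩ := ext2 y1 a1
    obtain ⟨y3, h3⟩ := ext3 y1 y2 a1 h2'
    have hy := mk _ _ _ a1 h2' h3
    have hsum := sum3 s hK h0 hy
    have hb : ∀ y ∉ ad K y1, 3 / 2 ≤ om s (res K y f) := fun y hy => by
      rcases hKT y (fun h => hy (le_ad _ _ h)) with h | h | h
      · exact absurd h (hh y hy)
      · linarith
      · linarith
    have nm : ∀ y, y ∉ K → y1 + y ∉ K → y ∉ ad K y1 := fun y h h' => by rw [mem_ad]; tauto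
    linarith [hb _ (nm _ hy.a2 hy.b12), hb _ (nm _ hy.a3 hy.b13), hb _ (nm _ hy.b12 (by rw [vvl]; exact hy.a2)),
      hb _ (nm _ hy.b13 (by rw [vvl]; exact hy.a3)), hb _ (nm _ hy.b23 (by rw [← add_assoc]; exact hy.c)),
      hb _ (nm _ hy.c (by rw [add_assoc, vvl]; exact hy.b23))]
  by_cases hex : ∃ y ∉ ad (ad K y1) y2, om s (res K y f) = 1
  · obtain ⟨y3, a3, o3⟩ := hex
    have hy := mk _ _ _ a1 a2 a3
    rcases hs.lt_or_eq with h | rfl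
    · exact k3_s3 h hf hK h0 hV hV1 hy o1 o2 o3 h2 h5
    · exact k3_s2 hf hK h0 hV hy o1 o2 o3 h2 h5
  · push Not at hex
    obtain ⟨y3, a3⟩ := ext3 y1 y2 a1 a2
    have hy := mk _ _ _ a1 a2 a3
    have hsum := sum3 s hK h0 hy
    rw [o1, o2] at hsum
    have nm : ∀ y, y ∉ K → y1 + y ∉ K → y2 + y ∉ K → y1 + (y2 + y) ∉ K → y ∉ ad (ad K y1) y2 := fun y h h' h'' h3 => by
      rw [mem_ad, mem_ad, mem_ad]; tauto
    have hb : ∀ y ∉ ad (ad K y1) y2, om s (res K y f) = 3 / 2 ∨ 7 / 4 ≤ om s (res K y f) := fun y hy => by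
      rcases hKT y (fun h => hy (le_ad _ _ (le_ad _ _ h))) with h | h
      · exact absurd h (hex y hy)
      · exact h
    have b3 := hb _ a3
    have b13 := hb (y1 + y3) (nm _ hy.b13 (by rw [vvl]; exact hy.a3) (by rw [show y2 + (y1 + y3) = y1 + y2 + y3 by abel]; exact hy.c)
      (by rw [show y1 + (y2 + (y1 + y3)) = y1 + (y1 + (y2 + y3)) by abel, vvl]; exact hy.b23))
    have b23 := hb (y2 + y3) (nm _ hy.b23 (by rw [← add_assoc]; exact hy.c) (by rw [vvl]; exact hy.a3) (by rw [vvl]; exact hy.b13))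
    have bc := hb (y1 + y2 + y3) (nm _ hy.c (by rw [add_assoc, vvl]; exact hy.b23)
      (by rw [show y2 + (y1 + y2 + y3) = y2 + (y2 + (y1 + y3)) by abel, vvl]; exact hy.b13)
      (by rw [show y1 + (y2 + (y1 + y2 + y3)) = y1 + (y1 + (y2 + (y2 + y3))) by abel, vvl, vvl]; exact hy.a3))
    have b12 : om s (res K (y1 + y2) f) = 3 / 2 ∨ 7 / 4 ≤ om s (res K (y1 + y2) f) := by
      rcases hKT _ hy.b12 with h | h
      · exact (noline hs hf hK h0 hV hy.a1 hy.a2 hy.b12 o1 o2 h).elim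
      · exact h
    rcases b3 with b3 | b3 <;> rcases b13 with b13 | b13 <;> rcases b23 with b23 | b23 <;> rcases bc with bc | bc <;>
      rcases b12 with b12 | b12 <;>
      first
      | (exfalso; linarith)
      | exact hfin _ hy.a3 (by norm_num; linarith)
      | exact hfin _ hy.b13 (by norm_num; linarith)
      | exact hfin _ hy.b23 (by norm_num; linarith)
      | exact hfin _ hy.c (by norm_num; linarith)
      | exact hfin _ hy.b12 (by norm_num; linarith)
structure Cx (s : ℕ) (f : V → Zt) (H X : Sb V) : Prop where
  hs : 3 ≤ s
  hf : dg (s + 2) f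
  hV : ¬ Van f 1
  XH : X ≤ H
  cH : nc V = 2 * nc H
  cX : nc H = 2 ^ (s + 1) * nc X
  fH : ∀ x ∈ H, f x = 1 ↔ x ∈ X
  h2 : 2 < om (s + 1) f
  h5 : om (s + 1) f < 5 / 2
structure Hy (H X W : Sb V) : Prop where
  XW : X ≤ W
  WH : W ≤ H
  c : nc H = 2 * nc W
lemma half_inf [Finite V] {A L W : Sb V} (hA : A ≤ W) (hL : L ≤ W) (c : nc W = 2 * nc L) (h : ¬ A ≤ L) :
    A ⊔ L = W ∧ nc A = 2 * nc (A ⊓ L : Sb V) := by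
  obtain ⟨a, ha, haL⟩ := Set.not_subset.1 h
  have e : A ⊔ L = W := by
    apply le_antisymm (sup_le hA hL)
    rw [← eq_of_le_card (ad_le.2 ⟨hL, hA ha⟩) (by rw [card_ad haL, c]), ad_le]
    exact ⟨le_sup_right, Submodule.mem_sup_left ha⟩
  refine ⟨e, ?_⟩
  have := card_sup_inf A L
  rw [e, c] at this
  have hp := card_pos' (V := L)
  nlinarith
lemma nmem_add {H : Sb V} {y e : V} (hy : y ∉ H) (he : e ∈ H) : y + e ∉ H :=
  fun h => hy (by have := H.add_mem h he; rwa [add_assoc, vv, add_zero] at this)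
lemma nmem_add' {H : Sb V} {y e : V} (hy : y ∉ H) (he : e ∈ H) : e + y ∉ H := by
  rw [add_comm]; exact nmem_add hy he
lemma exists_lt [Finite V] {W H : Sb V} (hl : W ≤ H) (h : nc W < nc H) : ∃ e ∈ H, e ∉ W := by
  by_contra hh; push Not at hh
  have := card_le_of_le (K := H) (L := W) hh; omega
lemma hy_e [Finite V] {H X W : Sb V} (h : Hy H X W) : ∃ e ∈ H, e ∉ W :=
  exists_lt h.WH (by have := h.c; have := card_pos' (V := W); omega)
lemma cx_e {s : ℕ} {f : V → Zt} {H X W : Sb V} (c : Cx s f H X) (h : Hy H X W) {e : V} (he : e ∈ H) (heW : e ∉ W) :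
    ∀ x ∈ W, f (e + x) = 0 := by
  intro x hx
  rw [← zne1]; intro h1
  have := h.XW ((c.fH _ (H.add_mem he (h.WH hx))).1 h1)
  exact nmem_add heW hx this
lemma cx_dg [Finite V] {s : ℕ} {f : V → Zt} {H X W : Sb V} (c : Cx s f H X) (h : Hy H X W) (y : V) :
    dg (s + 1) (res W y f) := by
  obtain ⟨e, he, heW⟩ := hy_e h
  have := drop1 (dg_trans c.hf e) (cx_e c h he heW) (e + y)
  rwa [show res W (e + y) (fun x => f (e + x)) = res W y f from funext fun x => by
    show f (e + (e + y + x)) = f (y + x); rw [add_assoc, vvl]] at this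
lemma cx_sum [Finite V] {s : ℕ} {f : V → Zt} {H X W : Sb V} (c : Cx s f H X) (h : Hy H X W) {e y : V} (he : e ∈ H) (heW : e ∉ W)
    (hy : y ∉ H) : om s (res W y f) + om s (res W (y + e) f) = 2 * om (s + 1) f - 1 := by
  have hW : ∀ {x}, x ∉ H → x ∉ W := fun h1 h2 => h1 (h.WH h2)
  have := sum2 s (f := fun x => f (e + x)) (by rw [c.cH, h.c]; ring) (cx_e c h he heW) heW (hW hy) (hW (nmem_add' hy he))
  rw [om_trans] at this
  have e1 : res W e (fun x => f (e + x)) = ind (sub W X) 0 := by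
    apply fun_ext1; intro x
    show f (e + (e + x)) = 1 ↔ _
    rw [vvl, ind1, zero_add, mem_sub, c.fH _ (h.WH x.2)]
  have e2 : res W y (fun x => f (e + x)) = res W (y + e) f := funext fun x => by
    show f (e + (y + x)) = f (y + e + x); congr 1; abel
  have e3 : res W (e + y) (fun x => f (e + x)) = res W y f := funext fun x => by
    show f (e + (e + y + x)) = f (y + x); rw [add_assoc, vvl]
  have hc : nc W = 2 ^ s * nc (sub W X) := by
    rw [card_sub, inf_eq_left.2 h.XW]
    have h1 := c.cX; rw [h.c, pow_succ] at h1; nlinarith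
  rw [e1, e2, e3, om_ind hc] at this
  linarith
lemma om_res_shift {s : ℕ} {f : V → Zt} {W : Sb V} {y p : V} (hp : p ∈ W) : om s (res W (y + p) f) = om s (res W y f) := by
  have := om_trans s (res W y f) ⟨p, hp⟩
  rw [← this]; congr 1; funext x; simp only [res, Submodule.coe_add, add_assoc]
lemma k2_A [Finite V] {s : ℕ} {f : V → Zt} (hf : dg (s + 2) f) {K : Sb V}
    (hK : nc V = 2 ^ (1 + 1) * nc K) (h0 : ∀ x ∈ K, f x = 0) (hV : ¬ Van f 1) {y1 y2 : V} (hy1 : y1 ∉ K)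
    (hy2 : y2 ∉ K) (hy3 : y1 + y2 ∉ K) (h5 : om (s + 1) f < 5 / 2)
    (o1 : om s (res K y1 f) ≠ 1) (o2 : om s (res K y2 f) ≠ 1) (o3 : om s (res K (y1 + y2) f) ≠ 1) : fin5 (5 / 2 - om (s + 1) f) := by
  have hsum := sum2 s hK h0 hy1 hy2 hy3
  have k : ∀ y, y ∉ K → om s (res K y f) ≠ 1 → om s (res K y f) = 3 / 2 ∨ 7 / 4 ≤ om s (res K y f) := fun y hy ho =>
    (KTc (drop1 hf h0 y) (res_ne hK h0 hV hy)).resolve_left ho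
  have hfin : ∀ y, y ∉ K → 5 / 2 - om (s + 1) f = (2 - om s (res K y f)) / 2 ^ 1 → fin5 (5 / 2 - om (s + 1) f) := fun y hy h =>
    om_KT (drop1 hf h0 y) (res_ne hK h0 hV hy) _ 1 h (by linarith)
  rcases k _ hy1 o1 with k1 | k1 <;> rcases k _ hy2 o2 with k2 | k2 <;> rcases k _ hy3 o3 with k3 | k3 <;>
    first
    | (exfalso; linarith)
    | exact hfin _ hy1 (by norm_num; linarith)
    | exact hfin _ hy2 (by norm_num; linarith)
    | exact hfin _ hy3 (by norm_num; linarith)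
lemma cx_c [Finite V] {s : ℕ} {f : V → Zt} {H X W : Sb V} (c : Cx s f H X) (h : Hy H X W)
    (meet : ∀ b ∉ H, ∃ x ∈ X, f (b + x) = 1) {y : V} (hy : y ∉ H) (o1 : 3 / 2 ≤ om s (res W y f)) (o2 : om s (res W y f) < 2)
    (hv : Van (res W y f) 1) : fin5 (5 / 2 - om (s + 1) f) := by
  obtain ⟨L0, p, hL0, hz⟩ := hv
  obtain ⟨L, hL⟩ : ∃ L, L = L0.map W.subtype := ⟨_, rfl⟩
  have LW : L ≤ W := by rw [hL]; exact Submodule.map_subtype_le _ _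
  have cL : nc W = 2 * nc L := by rw [hL, card_map', hL0]; ring
  obtain ⟨z, hzd⟩ : ∃ z, z = y + (p : V) := ⟨_, rfl⟩
  have hzH : z ∉ H := by rw [hzd]; exact nmem_add hy (h.WH p.2)
  have zL : ∀ x ∈ L, f (z + x) = 0 := by
    intro x hx; rw [hL, Submodule.mem_map] at hx; obtain ⟨x, hx, rfl⟩ := hx
    have := hz x hx; rw [hzd, add_assoc]; exact this
  rw [← om_res_shift (y := y) p.2, ← hzd] at o1 o2
  clear hz hL0 hy hzd hL
  obtain ⟨e, he, heW⟩ := hy_e h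
  obtain ⟨m, hm, hmL⟩ := exists_lt LW (by have := card_pos' (V := L); omega)
  have LH : L ≤ H := LW.trans h.WH
  have mH := h.WH hm
  have dH : z + e ∉ H := nmem_add hzH he
  have dL : z + e ∉ L := fun h => dH (LH h)
  have cL' : nc (ad L (z + e)) = nc W := by rw [card_ad dL, cL]
  have cV : nc V = 2 ^ (1 + 1) * nc (ad L (z + e)) := by rw [cL', c.cH, h.c]; ring
  have v0 : ∀ x ∈ ad L (z + e), f (z + x) = 0 := by
    intro x hx
    rcases mem_ad.1 hx with h1 | h1
    · exact zL x h1
    · have := cx_e c h he heW _ (LW h1)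
      rwa [show e + (z + e + x) = z + x + (e + e) by abel, vv, add_zero] at this
  have n1 : m ∉ ad L (z + e) := by
    rw [mem_ad]; push Not; exact ⟨hmL, fun h' => nmem_add dH mH (LH h')⟩
  have n2 : z ∉ ad L (z + e) := by
    rw [mem_ad]; push Not; refine ⟨fun h' => hzH (LH h'), fun h' => heW (LW ?_)⟩
    rwa [show z + e + z = e + (z + z) by abel, vv, add_zero] at h'
  have n3 : m + z ∉ ad L (z + e) := by
    rw [mem_ad]; push Not; refine ⟨fun h' => nmem_add' hzH mH (LH h'), fun h' => nmem_add heW hm (LW ?_)⟩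
    rwa [show z + e + (m + z) = e + m + (z + z) by abel, vv, add_zero] at h'
  have hsum := sum2 s (f := fun x => f (z + x)) cV v0 n1 n2 n3
  have hF := dg_trans c.hf z
  have hVF : ¬ Van (fun x => f (z + x)) 1 := fun h => c.hV (van_trans h)
  have r1 : om s (res (ad L (z + e)) m (fun x => f (z + x))) = om s (res W z f) := by
    rw [show res (ad L (z + e)) m (fun x => f (z + x)) = res (ad L (z + e)) (z + m) f from funext fun x => by
      show f (z + (m + x)) = f (z + m + x); rw [add_assoc]]
    have hW : ad L m = W := eq_of_le_card (ad_le.2 ⟨LW, hm⟩) (by rw [card_ad hmL, cL])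
    have w1 := w_ad hmL z f
    have w0 : w L z f = 0 := by rw [← wt_res, wt_eq_zero]; funext x; exact zL x x.2
    have w2 := w_ad dL (z + m) f
    have w3 : w L (z + m + (z + e)) f = 0 := by
      rw [← wt_res, wt_eq_zero]; funext x
      have := cx_e c h he heW _ (W.add_mem hm (LW x.2))
      show f (z + m + (z + e) + x) = 0
      rwa [show z + m + (z + e) + x = e + (m + x) + (z + z) by abel, vv, add_zero]
    unfold om
    rw [wt_res, wt_res, cL', w2, w3, ← hW, w1, w0]; simp
  have KTm := KTc (drop1 hF v0 z) (res_ne cV v0 hVF n2)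
  have KTn := KTc (drop1 hF v0 (m + z)) (res_ne cV v0 hVF n3)
  have dgF := drop1 hF v0 z
  have dgn := drop1 hF v0 (m + z)
  have eF : res (ad L (z + e)) z (fun x => f (z + x)) = res (ad L (z + e)) 0 f := funext fun x => by
    show f (z + (z + x)) = f (0 + x); rw [vvl, zero_add]
  have en : res (ad L (z + e)) (m + z) (fun x => f (z + x)) = res (ad L (z + e)) m f := funext fun x => by
    show f (z + (m + z + x)) = f (m + x); rw [show z + (m + z + x) = z + (z + (m + x)) by abel, vvl]
  rw [om_trans, r1, eF, en] at hsum
  rw [eF] at KTm dgF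
  rw [en] at KTn dgn
  have XL : ¬ X ≤ L := by
    intro hXL
    obtain ⟨x, hx, hx1⟩ := meet z hzH
    rw [zL x (hXL hx)] at hx1; exact absurd hx1 (by decide)
  obtain ⟨XLW, cXL⟩ := half_inf h.XW LW cL XL
  have flat : ∀ t ∈ W, dg (s + 1) (res (ad L (z + e)) t f) → om s (res (ad L (z + e)) t f) = 1 → fin5 (5 / 2 - om (s + 1) f) := by
    intro t ht hd ho
    obtain ⟨Y, q, eY, cY⟩ := om_flat hd ho
    obtain ⟨ρ, hρ⟩ : ∃ ρ, s = ρ + 1 := ⟨s - 1, by have := c.hs; omega⟩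
    have ht' := ht
    rw [← XLW] at ht
    obtain ⟨x0, hx0, l, hl, rfl⟩ := Submodule.mem_sup.1 ht
    have key : ∀ x (hx : x ∈ ad L (z + e)), f (x0 + l + x) = 1 ↔ q + ⟨x, hx⟩ ∈ Y := fun x hx => by
      have := congrFun eY ⟨x, hx⟩
      rw [← ind1, ← this]; rfl
    have hf0 : ∀ x ∈ X, f (x0 + x) = 1 := fun x hx => (c.fH _ (c.XH (X.add_mem hx0 hx))).2 (X.add_mem hx0 hx)
    have lL : l ∈ ad L (z + e) := le_ad _ _ hl
    have q0 : q + ⟨l, lL⟩ ∈ Y := by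
      rw [← key, add_assoc, vv]; exact hf0 0 X.zero_mem
    have key2 : ∀ x (hx : x ∈ ad L (z + e)), f (x0 + x) = 1 ↔ (⟨x, hx⟩ : ad L (z + e)) ∈ Y := fun x hx => by
      have h1 := key (l + x) ((ad L (z + e)).add_mem lL hx)
      rw [show x0 + l + (l + x) = x0 + x + (l + l) by abel, vv, add_zero] at h1
      rw [h1, show q + (⟨l + x, (ad L (z + e)).add_mem lL hx⟩ : ad L (z + e)) = q + ⟨l, lL⟩ + ⟨x, hx⟩ from by
        rw [add_assoc]; rfl]
      exact Submodule.add_mem_iff_right _ q0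
    subst hρ
    have mY : ∀ x, x ∈ Y.map (ad L (z + e)).subtype ↔ ∃ hx : x ∈ ad L (z + e), (⟨x, hx⟩ : ad L (z + e)) ∈ Y := fun x => by
      rw [Submodule.mem_map]
      constructor
      · rintro ⟨u, hu, rfl⟩; exact ⟨u.2, hu⟩
      · rintro ⟨hx, hu⟩; exact ⟨_, hu, rfl⟩
    refine two_flats_M (X := X) (Y := Y.map (ad L (z + e)).subtype) (o := x0) (by have := c.hs; omega) c.hf c.hV c.h2 c.h5 ?_ ?_ ?_ hf0 ?_
    · rw [c.cH, c.cX]; ring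
    · rw [cXL]; congr 2
      have : X ⊓ L = X ⊓ Y.map (ad L (z + e)).subtype := by
        ext x; rw [Submodule.mem_inf, Submodule.mem_inf, mY]
        constructor
        · rintro ⟨h1, h2⟩; exact ⟨h1, le_ad _ _ h2, (key2 _ _).1 (hf0 x h1)⟩
        · rintro ⟨h1, h2, h3⟩
          refine ⟨h1, ?_⟩
          rcases mem_ad.1 h2 with h4 | h4
          · exact h4
          · exact absurd (LH h4) (nmem_add dH (c.XH h1))
      rw [this]
    · rw [card_map']
      have h1 := c.cX; rw [h.c, ← cL', cY] at h1
      have hp : 0 < 2 ^ (ρ + 1) := by positivity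
      rw [pow_succ _ (ρ + 1)] at h1; nlinarith
    · intro x hx
      obtain ⟨h1, h2⟩ := (mY x).1 hx
      exact (key2 x h1).2 h2
  by_cases h1 : om s (res (ad L (z + e)) 0 f) = 1
  · exact flat 0 W.zero_mem dgF h1
  by_cases h3 : om s (res (ad L (z + e)) m f) = 1
  · exact flat m hm dgn h3
  have := k2_A hF cV v0 hVF n1 n2 n3 (by rw [om_trans]; exact c.h5) (by rw [r1]; intro h'; linarith) (by rwa [eF]) (by rwa [en])
  rwa [om_trans] at this
lemma flat_at [Finite V] {s : ℕ} {f : V → Zt} {W : Sb V} {o : V} (hd : dg (s + 1) (res W o f))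
    (ho : om s (res W o f) = 1) (h1 : f o = 1) : ∃ Y : Sb V, Y ≤ W ∧ nc W = 2 ^ s * nc Y ∧
      ∀ x ∈ W, f (o + x) = 1 ↔ x ∈ Y := by
  obtain ⟨Y, q, eY, cY⟩ := om_flat hd ho
  refine ⟨Y.map W.subtype, Submodule.map_subtype_le _ _, by rw [card_map', cY], fun x hx => ?_⟩
  have key : ∀ x : W, f (o + x) = 1 ↔ q + x ∈ Y := fun x => by
    have := congrFun eY x
    rw [← ind1, ← this]; rfl
  have q0 : q ∈ Y := by
    have := (key 0).1 (by rw [Submodule.coe_zero, add_zero]; exact h1); rwa [add_zero] at this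
  rw [key ⟨x, hx⟩, Submodule.add_mem_iff_right _ q0, Submodule.mem_map]
  constructor
  · intro h; exact ⟨_, h, rfl⟩
  · rintro ⟨u, hu, rfl⟩; exact hu
lemma cx_d [Finite V] {s : ℕ} {f : V → Zt} {H X W W' : Sb V} (c : Cx s f H X) (h : Hy H X W) (h' : Hy H X W')
    (hne : W ≠ W') (meet : ∀ b ∉ H, ∃ x ∈ X, f (b + x) = 1) {y y' : V} (hy : y ∉ H) (hy' : y' ∉ H) (o1 : om s (res W y f) = 1)
    (o2 : om s (res W' y' f) = 1) : fin5 (5 / 2 - om (s + 1) f) := by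
  have hnl : ¬ W ≤ W' := fun hl => hne (eq_of_le_card hl (by have := h.c; have := h'.c; omega))
  obtain ⟨hsup, -⟩ := half_inf h.WH h'.WH h'.c hnl
  have cH := c.cH
  have hyy : y + y' ∈ W ⊔ W' := by
    rw [hsup]
    have h1 : ad H y = ⊤ := eq_of_le_card le_top (by rw [card_ad hy, card_top, cH])
    have h2 : y' ∈ ad H y := by rw [h1]; trivial
    exact (mem_ad.1 h2).resolve_left hy'
  obtain ⟨a, ha, b, hb, hab⟩ := Submodule.mem_sup.1 hyy
  have hzz : y + a = y' + b := by
    rw [← vv0, show y + a + (y' + b) = (a + b) + (y + y') by abel, hab, vv]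
  obtain ⟨x, hx, hx1⟩ := meet (y + a) (nmem_add hy (h.WH ha))
  obtain ⟨o, hod⟩ : ∃ o, o = y + a + x := ⟨_, rfl⟩
  have e1 : om s (res W o f) = 1 := by rw [hod, add_assoc, om_res_shift (W.add_mem ha (h.XW hx)), o1]
  have e2 : om s (res W' o f) = 1 := by rw [hod, hzz, add_assoc, om_res_shift (W'.add_mem hb (h'.XW hx)), o2]
  rw [← hod] at hx1
  have oH : o ∉ H := by rw [hod]; exact nmem_add (nmem_add hy (h.WH ha)) (c.XH hx)
  obtain ⟨Y, YW, cY, fY⟩ := flat_at (cx_dg c h o) e1 hx1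
  obtain ⟨Y', YW', cY', fY'⟩ := flat_at (cx_dg c h' o) e2 hx1
  have ee : Y ⊓ W' = Y ⊓ Y' := by
    ext u; rw [Submodule.mem_inf, Submodule.mem_inf]
    constructor
    · rintro ⟨h1, h2⟩; exact ⟨h1, (fY' u h2).1 ((fY u (YW h1)).2 h1)⟩
    · rintro ⟨h1, h2⟩; exact ⟨h1, YW' h2⟩
  have nYW : ¬ Y ≤ W' := by
    intro hl
    obtain ⟨t, ht, htW⟩ := Set.not_subset.1 hnl
    obtain ⟨u, hu, hu1⟩ := meet (o + t) (nmem_add oH (h.WH ht))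
    rw [add_assoc, fY _ (W.add_mem ht (h.XW hu))] at hu1
    exact nmem_add htW (h'.XW hu) (hl hu1)
  obtain ⟨-, hc⟩ := half_inf (YW.trans h.WH) h'.WH h'.c nYW
  obtain ⟨ρ, hρ⟩ : ∃ ρ, s = ρ + 1 := ⟨s - 1, by have := c.hs; omega⟩
  subst hρ
  refine two_flats_M (X := Y) (Y := Y') (o := o) (by have := c.hs; omega) c.hf c.hV c.h2 c.h5 ?_ (by rw [← ee]; exact hc) ?_
    (fun x hx => (fY x (YW hx)).2 hx) (fun x hx => (fY' x (YW' hx)).2 hx)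
  · rw [c.cH, h.c, cY]; ring
  · have h1 := h.c; rw [h'.c, cY, cY'] at h1
    have : 0 < 2 ^ (ρ + 1) := by positivity
    nlinarith
lemma two_hy [Finite V] {s : ℕ} {f : V → Zt} {H X : Sb V} (c : Cx s f H X) :
    ∃ W W', Hy H X W ∧ Hy H X W' ∧ W ≠ W' := by
  have hX := card_pos' (V := X)
  have c4 : 4 * nc X ≤ nc H := by
    rw [c.cX]
    have : 2 ^ 2 ≤ 2 ^ (s + 1) := Nat.pow_le_pow_right (by norm_num) (by have := c.hs; omega)
    nlinarith
  have mk : ∀ e ∈ H, e ∉ X → ∃ W, Hy H X W ∧ e ∉ W := by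
    intro e he heX
    obtain ⟨a, ha, hk⟩ := exists_ker (K := sub H X) (v := ⟨e, he⟩) heX
    refine ⟨(LinearMap.ker a).map H.subtype, ⟨?_, Submodule.map_subtype_le _ _, ?_⟩, ?_⟩
    · intro x hx
      exact ⟨⟨x, c.XH hx⟩, hk ⟨x, c.XH hx⟩ hx, rfl⟩
    · rw [card_map']; exact card_ker (fun h => by rw [h] at ha; exact absurd (show (0 : Zt) = 1 from ha) (by decide))
    · rintro ⟨u, hu, hue⟩
      have : u = ⟨e, he⟩ := Subtype.ext hue
      have hu' : a u = 0 := hu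
      rw [this, ha] at hu'; exact absurd hu' (by decide)
  obtain ⟨e, he, heX⟩ := exists_lt c.XH (by omega)
  obtain ⟨W, hW, -⟩ := mk e he heX
  obtain ⟨e', he', heX'⟩ := exists_lt hW.XW (by have := hW.c; omega)
  obtain ⟨W', hW', h2⟩ := mk e' (hW.WH he') heX'
  exact ⟨W, W', hW, hW', fun h => h2 (h ▸ he')⟩
lemma averaging [Finite V] (f : V → Zt) {H : Sb V} (y : V) (n : ℕ) : ∀ {X : Sb V}, X ≤ H →
    nc H = 2 ^ n * nc X → ∃ b ∈ H, 2 ^ n * w X (y + b) f ≤ w H y f := by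
  induction n with
  | zero =>
    intro X hX hc
    have : X = H := eq_of_le_card hX (by omega)
    subst this
    exact ⟨0, X.zero_mem, by rw [add_zero]; omega⟩
  | succ n ih =>
    intro X hX hc
    have hp := card_pos' (V := X)
    have h2 : 2 * nc X ≤ nc H := by
      rw [hc, pow_succ]; have : 0 < 2 ^ n := by positivity
      nlinarith
    obtain ⟨x, hx, hxX⟩ := exists_lt hX (by omega)
    obtain ⟨b, hb, hw⟩ := ih (X := ad X x) (ad_le.2 ⟨hX, hx⟩) (by rw [card_ad hxX, hc]; ring)
    rw [w_ad hxX] at hw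
    rcases le_total (w X (y + b) f) (w X (y + b + x) f) with h | h
    · refine ⟨b, hb, ?_⟩
      have := Nat.mul_le_mul_left (2 ^ n) h
      rw [pow_succ]; nlinarith
    · refine ⟨b + x, H.add_mem hb hx, ?_⟩
      have := Nat.mul_le_mul_left (2 ^ n) h
      rw [pow_succ, ← add_assoc]; nlinarith
def Good (r N : ℕ) (ω : ℚ) : Prop := (∃ l : ℕ, 2 ≤ l ∧ 4 ^ l * 2 ^ r ≤ 4 * N ∧ ω = 2 + 2 / 2 ^ l) ∨ fin5 (5 / 2 - ω)
lemma good_up {r N M : ℕ} {ω : ℚ} (hN : N = 2 * M) (h : Good r M ω) : Good (r + 1) N ω := by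
  rcases h with ⟨l, h1, h2, h3⟩ | h
  · exact Or.inl ⟨l, h1, by rw [hN, pow_succ]; nlinarith, h3⟩
  · exact Or.inr h
lemma cx_g [Finite V] {s : ℕ} {f : V → Zt} {H X : Sb V} (c : Cx s f H X) {b : V} (hb : b ∉ H) :
    ∃ g : H → Zt, dg (s + 1) g ∧ om s g = om (s + 1) f - w X b f / nc X := by
  refine ⟨res H 0 (D b f), dg_res (c.hf b) H 0, ?_⟩
  have e : res H 0 (D b f) = res H b f + res H 0 f := funext fun x => by
    show f (0 + x + b) + f (0 + x) = f (b + x) + f (0 + x); rw [zero_add, add_comm (x : V) b]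
  have h1 := wt_add_mul (res H b f) (res H 0 f)
  have e0 : res H 0 f = ind (sub H X) 0 := by
    apply fun_ext1; intro x; show f (0 + x) = 1 ↔ _
    rw [ind1, zero_add, zero_add, mem_sub, c.fH _ x.2]
  have hm : wt (res H b f * res H 0 f) = w X b f := by
    rw [e0, wt_mul_ind, ← w_map, Submodule.coe_zero, add_zero]
    congr 1
    exact Submodule.map_comap_subtype H X ▸ (inf_eq_right.2 c.XH)
  have hH : ad H b = ⊤ := eq_of_le_card le_top (by rw [card_ad hb, card_top, c.cH])
  have hw := w_ad hb 0 f
  rw [hH, w_top, zero_add] at hw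
  rw [hm, ← e, wt_res H b f, wt_res H 0 f] at h1
  have hq : (wt (res H 0 (D b f)) : ℚ) = wt f - 2 * w X b f := by
    have : wt (res H 0 (D b f)) + 2 * w X b f = wt f := by omega
    rw [← this]; push_cast; ring
  have hXp : (nc X : ℚ) ≠ 0 := by exact_mod_cast card_pos'.ne'
  unfold om
  rw [hq, c.cH, c.cX]; push_cast; field_simp; ring
lemma cx_R [Finite V] {s : ℕ} {f : V → Zt} {H X W : Sb V} (c : Cx s f H X) (h : Hy H X W)
    (meet : ∀ b ∉ H, ∃ x ∈ X, f (b + x) = 1) {y : V} (hy : y ∉ H) (o1 : 3 / 2 ≤ om s (res W y f)) (o2 : om s (res W y f) < 2) :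
    fin5 (5 / 2 - om (s + 1) f) ∨ om s (res W y f) = 2 - 2 / 2 ^ s := by
  by_cases hv : Van (res W y f) 1
  · exact Or.inl (cx_c c h meet hy o1 o2 hv)
  · right
    have hs := c.hs
    have hd := cx_dg c h y
    obtain ⟨ρ, rfl⟩ : ∃ ρ, s = ρ + 1 := ⟨s - 1, by omega⟩
    have hne : res W y f ≠ 0 := fun h0 => by rw [om_eq_zero.2 h0] at o1; norm_num at o1
    obtain ⟨X1, X2, p1, p2, e, c1, c2, hsup⟩ := KTstar (by omega) hd hne hv o2 (Or.inl (by omega))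
    rw [e]; exact om_two c1 c2 hsup p1 p2
lemma num_e {ω t g : ℚ} {ρ i j : ℕ} (h5 : ω < 5 / 2) (hu : 5 - 2 * ω < 1 / 2 ^ ρ) (ht : t = 1 / 2 ^ ρ - 1 / 2 ^ ρ / 2 ^ (i + 1)) (hg : g = ω - t)
    (hj : 5 / 2 - g = 1 / 2 ^ j ∨ 5 / 2 - g = 3 / 2 ^ j) : fin5 (5 / 2 - ω) := by
  have hd : (0 : ℚ) < 1 / 2 ^ ρ := by positivity
  have hi : (1 : ℚ) / 2 ^ ρ / 2 ^ (i + 1) = 1 / 2 ^ ρ * (1 / 2 ^ (i + 1)) := by ring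
  have hi0 : (0 : ℚ) < 1 / 2 ^ (i + 1) := by positivity
  have hi1 : (1 : ℚ) / 2 ^ (i + 1) ≤ 1 / 2 := by have := ip_le (show 1 ≤ i + 1 by omega); rwa [pow_one] at this
  have e1 : (1 : ℚ) / 2 ^ (ρ + 1) = 1 / 2 ^ ρ / 2 := by rw [pow_succ]; field_simp
  have e2 : (1 : ℚ) / 2 ^ (ρ + 2) = 1 / 2 ^ ρ / 4 := by rw [pow_add]; field_simp; norm_num
  have e3 : (1 : ℚ) / 2 ^ (ρ + 3) = 1 / 2 ^ ρ / 8 := by rw [pow_add]; field_simp; norm_num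
  have hp : 1 / 2 ^ ρ * (1 / 2 ^ (i + 1)) ≤ (1 : ℚ) / 2 ^ ρ * (1 / 2) := mul_le_mul_of_nonneg_left hi1 hd.le
  have hp0 : 0 < (1 : ℚ) / 2 ^ ρ * (1 / 2 ^ (i + 1)) := by positivity
  rw [hi] at ht
  rcases hj with hj | hj
  · have h1 : j < ρ + 1 := ip_lt (by rw [e1]; linarith)
    have h2 : j = ρ := by
      by_contra hne
      have := ip_le (show j + 1 ≤ ρ by omega)
      rw [pow_succ, show (1 : ℚ) / (2 ^ j * 2) = 1 / 2 ^ j / 2 by field_simp] at this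
      linarith
    subst h2
    exact ⟨j + (i + 1), Or.inl (by rw [pow_add, show (1 : ℚ) / (2 ^ j * 2 ^ (i + 1)) = 1 / 2 ^ j * (1 / 2 ^ (i + 1)) by field_simp]; linarith)⟩
  · rw [show (3 : ℚ) / 2 ^ j = 3 * (1 / 2 ^ j) by ring] at hj
    have h1 : ρ + 1 < j := ip_lt (by rw [e1]; linarith)
    have h2 : j = ρ + 2 := by
      by_contra hne
      have := ip_le (show ρ + 3 ≤ j by omega)
      rw [e3] at this
      linarith
    rw [h2, e2] at hj
    have h3 : i = 0 := by
      by_contra hne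
      have h4 := ip_le (show 2 ≤ i + 1 by omega)
      have h6 := mul_le_mul_of_nonneg_left h4 hd.le
      linarith
    subst h3
    exact ⟨ρ + 2, Or.inl (by rw [e2]; linarith)⟩
lemma cx_e5 [Finite V] {s : ℕ} {f : V → Zt} {H X : Sb V} (c : Cx s f H X)
    (meet : ∀ b ∉ H, ∃ x ∈ X, f (b + x) = 1)
    (IH : ∀ g : H → Zt, dg (s + 1) g → 2 < om s g → om s g < 5 / 2 → Good s (nc H) (om s g))
    (hu : 5 - 2 * om (s + 1) f < 2 / 2 ^ s) : fin5 (5 / 2 - om (s + 1) f) := by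
  have hXp : (0 : ℚ) < nc X := by exact_mod_cast card_pos'
  obtain ⟨y, hy⟩ := exists_out (K := H) (by have := c.cH; have := card_pos' (V := H); omega)
  have hH : ad H y = ⊤ := eq_of_le_card le_top (by rw [card_ad hy, card_top, c.cH])
  have hw := w_ad hy 0 f
  rw [hH, w_top, zero_add] at hw
  have e0 : res H 0 f = ind (sub H X) 0 := by
    apply fun_ext1; intro x; show f (0 + x) = 1 ↔ _
    rw [ind1, zero_add, zero_add, mem_sub, c.fH _ x.2]
  have w0 : w H 0 f = nc X := by
    rw [← wt_res, e0, wt_ind, card_sub, inf_eq_left.2 c.XH]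
  obtain ⟨b0, hb0, hav⟩ := averaging f y (s + 1) c.XH c.cX
  obtain ⟨b, hb⟩ : ∃ b, b = y + b0 := ⟨_, rfl⟩
  rw [← hb] at hav
  have hbH : b ∉ H := by rw [hb]; exact nmem_add hy hb0
  have hom : (wt f : ℚ) = 2 * om (s + 1) f * nc X := by
    unfold om; rw [c.cH, c.cX]; push_cast; field_simp
  obtain ⟨t, ht⟩ : ∃ t : ℚ, t = w X b f / nc X := ⟨_, rfl⟩
  have hpw : (0 : ℚ) < 2 ^ s := by positivity
  have tlt : t * 2 ^ (s + 1) < 4 := by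
    have h1 : (2 : ℚ) ^ (s + 1) * w X b f ≤ wt f - nc X := by
      have : 2 ^ (s + 1) * w X b f + nc X ≤ wt f := by omega
      have h2 : ((2 ^ (s + 1) * w X b f + nc X : ℕ) : ℚ) ≤ wt f := by exact_mod_cast this
      push_cast at h2; linarith
    rw [hom] at h1
    rw [ht, div_mul_eq_mul_div, div_lt_iff₀ hXp]
    have := c.h5
    nlinarith
  obtain ⟨x1, hx1, hf1⟩ := meet b hbH
  have oms : om s (res X b f) = 2 ^ s * t := by unfold om; rw [wt_res, ht]; ring
  have hne : res X b f ≠ 0 := fun h0 => by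
    have h3 : f (b + x1) = 0 := congrFun h0 (⟨x1, hx1⟩ : X)
    rw [hf1] at h3; exact absurd h3 (by decide)
  have hd : dg (s + 1) (res X b f) := by
    have h1 := dg_add (dg_res (c.hf b) X 0) (dg_const (V := X) 1 s)
    convert h1 using 1
    funext x
    show f (b + x) = (f (0 + x + b) + f (0 + x)) + 1
    rw [zero_add, (c.fH _ (c.XH x.2)).2 x.2, add_comm (x : V) b, add_assoc, zz, add_zero]
  obtain ⟨i, hi⟩ := KT s X _ hd hne (by rw [oms, pow_succ] at *; linarith)
  obtain ⟨g, dgg, hg⟩ := cx_g c hbH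
  rw [← ht] at hg
  have hs := c.hs
  obtain ⟨ρ, rfl⟩ : ∃ ρ, s = ρ + 1 := ⟨s - 1, by omega⟩
  have e2 : (2 : ℚ) / 2 ^ (ρ + 1) = 1 / 2 ^ ρ := by rw [pow_succ]; field_simp
  rw [e2] at hu
  have hd4 : (1 : ℚ) / 2 ^ ρ ≤ 1 / 4 := by have := ip_le (show 2 ≤ ρ by omega); norm_num at this ⊢; exact this
  have tt : t = 1 / 2 ^ ρ - 1 / 2 ^ ρ / 2 ^ (i + 1) := by
    rw [oms, pow_succ] at hi
    rw [pow_succ]; field_simp at hi ⊢; linarith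
  have tl : t < 1 / 2 ^ ρ := by
    rw [tt]; have : (0 : ℚ) < 1 / 2 ^ ρ / 2 ^ (i + 1) := by positivity
    linarith
  have tp : 0 ≤ t := by rw [ht]; positivity
  have h5 := c.h5
  rcases IH g dgg (by rw [hg]; linarith) (by rw [hg]; linarith) with ⟨l, l2, -, hl⟩ | ⟨j, hj⟩
  · rcases (show l = 2 ∨ l = 3 ∨ 4 ≤ l by omega) with rfl | rfl | h
    · norm_num at hl; linarith
    · exact num_e (j := 2) h5 hu tt hg (Or.inl (by rw [hl]; norm_num))
    · have := ip_le h
      rw [show (2 : ℚ) / 2 ^ l = 2 * (1 / 2 ^ l) by ring] at hl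
      norm_num at this hl; linarith
  · exact num_e h5 hu tt hg hj
theorem cx_main [Finite V] {s : ℕ} {f : V → Zt} {H X : Sb V} (c : Cx s f H X)
    (IH : ∀ g : H → Zt, dg (s + 1) g → 2 < om s g → om s g < 5 / 2 → Good s (nc H) (om s g)) :
    Good (s + 1) (nc V) (om (s + 1) f) := by
  have h2 := c.h2
  have h5 := c.h5
  by_cases hz : ∃ b, b ∉ H ∧ w X b f = 0
  · obtain ⟨b, hb, hw⟩ := hz
    obtain ⟨g, dgg, hg⟩ := cx_g c hb
    rw [hw, Nat.cast_zero, zero_div, sub_zero] at hg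
    rw [← hg]
    exact good_up c.cH (IH g dgg (by rw [hg]; exact h2) (by rw [hg]; exact h5))
  right
  have meet : ∀ b ∉ H, ∃ x ∈ X, f (b + x) = 1 := by
    intro b hb
    by_contra hh; push Not at hh
    refine hz ⟨b, hb, ?_⟩
    rw [← wt_res, wt_eq_zero]
    funext x
    exact zne1.1 (hh x x.2)
  have main : ∀ W, Hy H X W → (∀ y ∉ H, om s (res W y f) ≠ 1) → fin5 (5 / 2 - om (s + 1) f) := by
    intro W h hW
    obtain ⟨y, hy⟩ := exists_out (K := H) (by have := c.cH; have := card_pos' (V := H); omega)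
    obtain ⟨e, he, heW⟩ := hy_e h
    have K3 : ∀ y ∉ H, 3 / 2 ≤ om s (res W y f) := by
      intro y hy
      obtain ⟨x, hx, hx1⟩ := meet y hy
      have hne : res W y f ≠ 0 := fun h0 => by
        have h3 : f (y + x) = 0 := congrFun h0 (⟨x, h.XW hx⟩ : W)
        rw [hx1] at h3; exact absurd h3 (by decide)
      rcases KTc (cx_dg c h y) hne with h1 | h1 | h1
      · exact absurd h1 (hW y hy)
      · linarith
      · linarith
    have go : ∀ a b, a ∉ H → b ∉ H → om s (res W a f) + om s (res W b f) = 2 * om (s + 1) f - 1 → om s (res W a f) < 2 →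
        fin5 (5 / 2 - om (s + 1) f) := by
      intro a b ha hb hs h1
      rcases cx_R c h meet ha (K3 a ha) h1 with h3 | h3
      · exact h3
      have e2 : (2 : ℚ) / 2 ^ s = 1 / 2 ^ s * 2 := by ring
      rcases lt_trichotomy (om s (res W b f)) 2 with h4 | h4 | h4
      · rcases cx_R c h meet hb (K3 b hb) h4 with h6 | h6
        · exact h6
        · have h3' := c.hs
          refine ⟨s - 1, Or.inl ?_⟩
          rw [show (1 : ℚ) / 2 ^ (s - 1) = 2 / 2 ^ s by
            obtain ⟨ρ, rfl⟩ : ∃ ρ, s = ρ + 1 := ⟨s - 1, by omega⟩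
            rw [Nat.add_sub_cancel, pow_succ]; field_simp]
          linarith
      · exact ⟨s, Or.inl (by linarith)⟩
      · exact cx_e5 c meet IH (by linarith)
    have hs := cx_sum c h he heW hy
    have hye := nmem_add hy he
    rcases lt_or_ge (om s (res W y f)) 2 with h1 | h1
    · exact go _ _ hy hye hs h1
    · exact go _ _ hye hy (by linarith) (by linarith)
  obtain ⟨W, W', hW, hW', hne⟩ := two_hy c
  by_cases h1 : ∀ y ∉ H, om s (res W y f) ≠ 1
  · exact main W hW h1
  by_cases h3 : ∀ y ∉ H, om s (res W' y f) ≠ 1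
  · exact main W' hW' h3
  push Not at h1 h3
  obtain ⟨y, hy, hy1⟩ := h1
  obtain ⟨y', hy', hy1'⟩ := h3
  exact cx_d c hW hW' hne meet hy hy' hy1 hy1'
lemma num_b {b c v : ℚ} (hb : b = 0 ∨ ∃ h : ℕ, b = 1 / 2 ^ h ∨ b = - (1 / 2 ^ h)) (hc : c = 0 ∨ ∃ h : ℕ, c = 1 / 2 ^ h ∨ c = - (1 / 2 ^ h))
    (hr : b = 0 ∨ c = 0 ∨ |b| = |c| ∨ |b| = 2 * |c| ∨ |c| = 2 * |b|) (hv : v = b + c) (h0 : 0 < v) (h1 : v < 1 / 2) : fin5 v := by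
  have two : ∀ h : ℕ, v = 2 * (1 / 2 ^ h) → fin5 v := by
    intro h hh
    rcases h with _ | h
    · norm_num at hh; linarith
    · exact ⟨h, Or.inl (by rw [hh, pow_succ]; field_simp)⟩
  have pos : ∀ {b : ℚ}, (b = 0 ∨ ∃ h : ℕ, b = 1 / 2 ^ h ∨ b = - (1 / 2 ^ h)) → v = b → fin5 v := by
    rintro b (hb | ⟨h, hb | hb⟩) e
    · linarith
    · exact ⟨h, Or.inl (by linarith)⟩
    · have : (0 : ℚ) < 1 / 2 ^ h := by positivity
      linarith
  rcases hr with hr | hr | hr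
  · exact pos hc (by linarith)
  · exact pos hb (by linarith)
  rcases hb with hb | ⟨h, hb⟩
  · exact pos hc (by linarith)
  rcases hc with hc | ⟨k, hc⟩
  · exact pos (Or.inr ⟨h, hb⟩) (by linarith)
  have ph : (0 : ℚ) < 1 / 2 ^ h := by positivity
  have pk : (0 : ℚ) < 1 / 2 ^ k := by positivity
  have ab : |b| = 1 / 2 ^ h := by rcases hb with hb | hb <;> rw [hb] <;> simp
  have ac : |c| = 1 / 2 ^ k := by rcases hc with hc | hc <;> rw [hc] <;> simp
  rw [ab, ac] at hr
  have th : (3 : ℚ) / 2 ^ h = 3 * (1 / 2 ^ h) := by ring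
  have tk : (3 : ℚ) / 2 ^ k = 3 * (1 / 2 ^ k) := by ring
  rcases hr with hr | hr | hr <;> rcases hb with hb | hb <;> rcases hc with hc | hc <;>
    first
    | (exfalso; linarith)
    | exact two h (by linarith)
    | exact ⟨h, Or.inl (by linarith)⟩
    | exact ⟨k, Or.inl (by linarith)⟩
    | exact ⟨h, Or.inr (by linarith)⟩
    | exact ⟨k, Or.inr (by linarith)⟩
lemma k2_s2 [Finite V] {f : V → Zt} (hf : dg 4 f) {K : Sb V}
    (hK : nc V = 4 * nc K) (h0 : ∀ x ∈ K, f x = 0) {y1 y2 : V} (hy1 : y1 ∉ K)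
    (hy2 : y2 ∉ K) (hy3 : y1 + y2 ∉ K) (h2 : 2 < om 3 f) (h5 : om 3 f < 5 / 2)
    (o1 : om 2 (res K y1 f) = 1) : fin5 (5 / 2 - om 3 f) := by
  obtain ⟨X, p, eX, cX⟩ := om_flat (drop1 hf h0 y1) o1
  have hsum := sum2 2 hK h0 hy1 hy2 hy3
  have hd := drop2 hf h0 y1 y2
  rw [o1, om2_bet, om2_bet] at hsum
  have q2 := quad (drop1 hf h0 y2)
  have q3 := quad (drop1 hf h0 (y1 + y2))
  rw [eX] at hd
  have d1 : dg 2 (res K y2 f + res K (y1 + y2) f + ind X p) := by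
    rw [show res K y2 f + res K (y1 + y2) f + ind X p = ind X p + res K y2 f + res K (y1 + y2) f by abel]; exact hd
  have d2 : dg 2 (res K (y1 + y2) f + res K y2 f + ind X p) := by
    rw [show res K (y1 + y2) f + res K y2 f + ind X p = ind X p + res K y2 f + res K (y1 + y2) f by abel]; exact hd
  refine num_b (b := bet (res K y2 f)) (c := bet (res K (y1 + y2) f)) (q2.imp id fun ⟨h, _, h'⟩ => ⟨h, h'⟩)
    (q3.imp id fun ⟨h, _, h'⟩ => ⟨h, h'⟩) ?_ (by linarith) (by linarith) (by linarith)
  rcases q2 with q2 | ⟨h, r2, q2⟩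
  · exact Or.inl q2
  rcases q3 with q3 | ⟨k, r3, q3⟩
  · exact Or.inr (Or.inl q3)
  have l1 := quad_ratio cX d1 r2 r3
  have l2 := quad_ratio cX d2 r3 r2
  have ab : |bet (res K y2 f)| = 1 / 2 ^ h := by rcases q2 with hb | hb <;> rw [hb] <;> simp
  have ac : |bet (res K (y1 + y2) f)| = 1 / 2 ^ k := by rcases q3 with hc | hc <;> rw [hc] <;> simp
  rw [ab, ac]
  right; right
  rcases (show h = k ∨ h = k + 1 ∨ k = h + 1 by omega) with rfl | rfl | rfl
  · exact Or.inl rfl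
  · right; right; rw [pow_succ]; field_simp
  · right; left; rw [pow_succ]; field_simp
def IHt (s : ℕ) : Prop := ∀ (U : Type) [AddCommGroup U] [Module Zt U] [Finite U] (g : U → Zt), dg (s + 1) g → 2 < om s g →
  om s g < 5 / 2 → Good s (nc U) (om s g)
lemma k2_C [Finite V] {s : ℕ} (hs : 3 ≤ s) (IH : IHt s) {f : V → Zt} (hf : dg (s + 2) f) {K : Sb V}
    (hK : nc V = 4 * nc K) (h0 : ∀ x ∈ K, f x = 0) (hV : ¬ Van f 1) {y1 : V} (hy1 : y1 ∉ K)
    (h2 : 2 < om (s + 1) f) (h5 : om (s + 1) f < 5 / 2)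
    (o1 : om s (res K y1 f) = 1) : Good (s + 1) (nc V) (om (s + 1) f) := by
  obtain ⟨X, p, eX, cX⟩ := om_flat (drop1 hf h0 y1) o1
  have key : ∀ x : K, f (y1 + x) = 1 ↔ p + x ∈ X := fun x => by
    have := congrFun eX x
    rw [← ind1, ← this]; rfl
  have c : Cx s (fun x => f (y1 + p + x)) (ad K y1) (X.map K.subtype) := by
    refine ⟨hs, dg_trans hf _, fun h => hV (van_trans h), (Submodule.map_subtype_le _ _).trans (le_ad _ _), ?_, ?_, ?_, ?_, ?_⟩
    · rw [card_ad hy1, hK]; ring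
    · rw [card_ad hy1, card_map', cX]; ring
    · intro x hx
      rcases mem_ad.1 hx with h | h
      · have k := key (p + ⟨x, h⟩)
        rw [vvl] at k
        show f (y1 + p + x) = 1 ↔ _
        rw [add_assoc]
        refine k.trans ⟨fun h => ⟨_, h, rfl⟩, ?_⟩
        rintro ⟨u, hu, rfl⟩; exact hu
      · have h1 : f (y1 + p + x) = 0 := h0 _ (by rw [show y1 + p + x = p + (y1 + x) by abel]; exact K.add_mem p.2 h)
        show f (y1 + p + x) = 1 ↔ _
        rw [h1]
        refine ⟨fun h => absurd h (by decide), fun h' => ?_⟩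
        exact absurd h (nmem_add hy1 (Submodule.map_subtype_le _ _ h'))
    · rw [om_trans]; exact h2
    · rw [om_trans]; exact h5
  have := cx_main c (fun g h1 h3 h4 => IH _ g h1 h3 h4)
  rwa [om_trans] at this
lemma k2 [Finite V] {s : ℕ} (hs : 2 ≤ s) (IH : IHt s) {f : V → Zt} (hf : dg (s + 2) f) {K : Sb V}
    (hK : nc V = 4 * nc K) (h0 : ∀ x ∈ K, f x = 0) (hV : ¬ Van f 1) (h2 : 2 < om (s + 1) f) (h5 : om (s + 1) f < 5 / 2) :
    Good (s + 1) (nc V) (om (s + 1) f) := by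
  obtain ⟨y1, y2, hy1, hy2, hy3⟩ := exists_plane hK
  have go : ∀ y1 y2, y1 ∉ K → y2 ∉ K → y1 + y2 ∉ K → om s (res K y1 f) = 1 → Good (s + 1) (nc V) (om (s + 1) f) := by
    intro y1 y2 hy1 hy2 hy3 o1
    rcases (show s = 2 ∨ 3 ≤ s by omega) with rfl | hs3
    · exact Or.inr (k2_s2 hf hK h0 hy1 hy2 hy3 h2 h5 o1)
    · exact k2_C hs3 IH hf hK h0 hV hy1 h2 h5 o1
  by_cases o1 : om s (res K y1 f) = 1
  · exact go y1 y2 hy1 hy2 hy3 o1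
  by_cases o2 : om s (res K y2 f) = 1
  · exact go y2 y1 hy2 hy1 (by rwa [add_comm]) o2
  by_cases o3 : om s (res K (y1 + y2) f) = 1
  · exact go (y1 + y2) y1 hy3 hy1 (by rwa [add_comm, vvl]) o3
  exact Or.inr (k2_A hf hK h0 hV hy1 hy2 hy3 h5 o1 o2 o3)
theorem MAIN (r : ℕ) : IHt r := by
  induction r with
  | zero =>
    intro V _ _ _ f hf h2 h5
    exfalso
    unfold om at h2
    have h1 : (wt f : ℚ) ≤ nc V := by exact_mod_cast wt_le_card f
    have hp : (0 : ℚ) < nc V := by exact_mod_cast card_pos'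
    rw [lt_div_iff₀ hp] at h2
    linarith
  | succ s IH =>
    intro V _ _ _ f hf h2 h5
    rcases (show s = 0 ∨ s = 1 ∨ 2 ≤ s by omega) with rfl | rfl | hs
    · exfalso
      have := om1 hf
      norm_num at this h2
      rcases this with h | h | h <;> linarith
    · left
      rw [show 1 + 1 = 2 from rfl] at *
      have hb := om2_bet f
      rw [hb] at h2 h5 ⊢
      rcases quad hf with q | ⟨h, hr, q | q⟩
      · linarith
      · have : (0 : ℚ) < 1 / 2 ^ h := by positivity
        linarith
      · refine ⟨h, ?_, ?_, by rw [q]; ring⟩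
        · have : 2 < h := ip_lt (by norm_num; norm_num at q; linarith)
          omega
        · have := card_pos' (V := rad f)
          rw [← hr]; nlinarith [pow_pos (show 0 < 4 by norm_num) h]
    · have hne : f ≠ 0 := fun h => by rw [om_eq_zero.2 h] at h2; linarith
      by_cases hV : Van f 1
      · obtain ⟨K, e, cK, -, hd, ho⟩ := van1 hV
        rw [ho s] at h2 h5 ⊢
        exact good_up cK (IH K _ (hd _ hf) h2 h5)
      have h8 : (2 : ℚ) ^ (2 + 1) ≤ 2 ^ (s + 1) := pow_le_pow_right₀ (by norm_num) (by omega)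
      obtain ⟨k, K, p, hK, h0, hj⟩ := setup0 hne (zero_of_om (r := s + 1) (by norm_num at h8; linarith))
      have hV' : ¬ Van (fun x => f (p + x)) 1 := fun h => hV (van_trans h)
      have hf' := dg_trans hf p
      rw [← om_trans (s + 1) f p] at h2 h5 ⊢
      rcases (show k = 0 ∨ k = 1 ∨ k = 2 ∨ 3 ≤ k by omega) with rfl | rfl | rfl | hk
      · exact absurd ⟨K, 0, hK, fun x hx => by rw [zero_add]; exact h0 x hx⟩ hV'
      · exact k2 hs IH hf' hK h0 hV' h2 h5
      · exact Or.inr (k3 hs hf' hK h0 (hj 2 (by omega)) hV' h2 h5)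
      · exact (kge4 hs hf' hk hK h0 (hj k (by omega)) h5).elim
lemma dg_smul {V : Type} [AddCommGroup V] [Module Zt V] {s : ℕ} (c : Zt) {f : V → Zt} (hf : dg s f) :
    dg s (fun x => c * f x) := by
  rcases z01 c with rfl | rfl
  · simp only [zero_mul]; exact dg_zero s
  · simpa only [one_mul] using hf
lemma dg_coord {v : ℕ} (i : Fin v) (s : ℕ) : ∀ {f : (Fin v → Zt) → Zt}, dg s f → dg (s + 1) (fun x => x i * f x) := by
  induction s with
  | zero =>
    intro f hf
    have : (fun x : Fin v → Zt => x i * f x) = 0 := funext fun x => by rw [hf x, mul_zero]; rfl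
    rw [this]; exact dg_zero _
  | succ s ih =>
    intro f hf a
    have e : D a (fun x => x i * f x) = (fun x => x i * D a f x) + (fun x => a i * f (a + x)) := by
      funext x
      show (x i + a i) * f (x + a) + x i * f x = x i * (f (x + a) + f x) + a i * f (a + x)
      rw [add_comm a x]; ring
    rw [e]
    exact dg_add (ih (hf a)) (dg_smul (a i) (dg_trans hf a))
lemma dg_pow {v : ℕ} (i : Fin v) {s : ℕ} {f : (Fin v → Zt) → Zt} (hf : dg s f) (n : ℕ) : dg (s + n) (fun x => x i ^ n * f x) := by
  induction n with
  | zero => simpa using hf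
  | succ n ih =>
    have := dg_coord i _ ih
    rw [show (fun x : Fin v → Zt => x i ^ (n + 1) * f x) = fun x => x i * (x i ^ n * f x) from funext fun x => by rw [pow_succ]; ring]
    exact this
lemma dg_mon {v : ℕ} (m : Fin v → ℕ) (S : Finset (Fin v)) : dg (1 + ∑ i ∈ S, m i) (fun x : Fin v → Zt => ∏ i ∈ S, x i ^ m i) := by
  classical
  induction S using Finset.induction_on with
  | empty => simpa using dg_const (V := Fin v → Zt) 1 0
  | insert a S ha ih =>
    have := dg_pow a ih (m a)
    simp only [Finset.prod_insert ha, Finset.sum_insert ha]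
    rwa [add_assoc, add_comm (∑ i ∈ S, m i)] at this
lemma dg_sum {V : Type} [AddCommGroup V] [Module Zt V] {s : ℕ} {ι : Type} (S : Finset ι) (f : ι → V → Zt) (h : ∀ i ∈ S, dg s (f i)) :
    dg s (fun x => ∑ i ∈ S, f i x) := by
  classical
  induction S using Finset.induction_on with
  | empty => exact dg_zero (V := V) s
  | insert a S ha ih =>
    simp only [Finset.sum_insert ha]
    exact dg_add (h a (Finset.mem_insert_self _ _)) (ih fun i hi => h i (Finset.mem_insert_of_mem hi))
lemma dg_RM {r v : ℕ} {f : (Fin v → Zt) → Zt} (hf : RM r v f) : dg (r + 1) f := by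
  obtain ⟨P, hP, hPf⟩ := hf
  have e : f = fun x => ∑ d ∈ P.support, P.coeff d * ∏ i, x i ^ d i := funext fun x => by
    rw [← hPf, MvPolynomial.eval_eq']
  rw [e]
  refine dg_sum _ _ fun d hd => dg_smul _ (dg_mono ?_ (dg_mon (fun i => d i) Finset.univ))
  have := MvPolynomial.le_totalDegree hd
  rw [Finsupp.sum_fintype _ _ (fun _ => rfl)] at this
  omega
lemma even_RM {r v : ℕ} (hrv : r < v) {f : (Fin v → Zt) → Zt} (hf : RM r v f) : Even (weight f) := by
  obtain ⟨P, hP, hPf⟩ := hf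
  have h := MvPolynomial.sum_eval_eq_zero P (by rw [ZMod.card, Fintype.card_fin]; omega)
  rw [← ZMod.natCast_eq_zero_iff_even]
  unfold weight
  rw [Finset.natCast_card_filter]
  refine Eq.trans ?_ h
  refine Finset.sum_congr rfl fun x _ => ?_
  rw [hPf]
  rcases z01 (f x) with h | h <;> rw [h] <;> simp
lemma arith_m {n m c i : ℕ} (hm : Even m) (hc : ¬ Even c) (h : m * 2 ^ i = c * 2 ^ n) : ∃ j, j + 1 ≤ n ∧ m = 2 * c * 2 ^ j := by
  rcases Nat.lt_or_ge i n with hi | hi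
  · refine ⟨n - i - 1, by omega, ?_⟩
    have e : 2 ^ n = 2 * 2 ^ (n - i - 1) * 2 ^ i := by
      rw [← pow_succ', ← pow_add]; congr 1; omega
    rw [e] at h
    have hp : 0 < 2 ^ i := by positivity
    apply Nat.eq_of_mul_eq_mul_right hp
    rw [h]; ring
  · exfalso
    have e : 2 ^ i = 2 ^ (i - n) * 2 ^ n := by rw [← pow_add]; congr 1; omega
    rw [e, ← mul_assoc] at h
    have := Nat.eq_of_mul_eq_mul_right (show 0 < 2 ^ n by positivity) h
    exact hc (this ▸ hm.mul_right _)
end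
end KTA
open KTA in
/-- Kasami–Tokura–Azumi: the weights of codewords of `RM(r,v)` that are
larger than `2·2^(v-r)` and smaller than `2.5·2^(v-r) = 5·2^(v-r-1)` have one of three
listed forms. -/
theorem RM_weights_between (v r : ℕ) (hrv : r < v)
    (f : (Fin v → ZMod 2) → ZMod 2) (hf : RM r v f)
    (hl : 2 * 2 ^ (v - r) < weight f) (hu : weight f < 5 * 2 ^ (v - r - 1)) :
    (∃ l, 2 ≤ l ∧ 2 * l ≤ v - r + 2 ∧
      weight f = 2 * 2 ^ (v - r) + 2 * 2 ^ (v - r - l)) ∨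
    (∃ i, i + 3 ≤ v - r ∧ weight f = 5 * 2 ^ (v - r - 1) - 2 * 2 ^ i) ∨
    (∃ i, i + 4 ≤ v - r ∧ weight f = 5 * 2 ^ (v - r - 1) - 6 * 2 ^ i) := by
  have hev := even_RM hrv hf
  have hwt : wt f = weight f := by
    unfold wt weight
    rw [← Set.ncard_coe_finset]; congr 1; ext x; simp
  have hcard : Nat.card (Fin v → ZMod 2) = 2 ^ v := by
    rw [Nat.card_eq_fintype_card, Fintype.card_fun, ZMod.card, Fintype.card_fin]
  obtain ⟨n, hn⟩ : ∃ n, n = v - r := ⟨_, rfl⟩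
  have hv : v = r + n := by omega
  rw [← hn] at hl hu ⊢
  obtain ⟨N, hN⟩ : ∃ N, N = weight f := ⟨_, rfl⟩
  have hom : om r f = N / 2 ^ n := by
    unfold om; rw [hwt, hcard, ← hN, hv]; push_cast; rw [pow_add]; field_simp
  rw [← hN] at hl hu hev ⊢
  have hpn : (0 : ℚ) < 2 ^ n := by positivity
  obtain ⟨k, hk⟩ : ∃ k, n = k + 1 := ⟨n - 1, by omega⟩
  have hk1 : 1 ≤ k := by
    by_contra h
    have : k = 0 := by omega
    rw [hk, this] at hl hu; norm_num at hl hu; omega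
  have e1 : n - 1 = k := by omega
  have e2 : 2 ^ n = 2 * 2 ^ k := by rw [hk, pow_succ]; ring
  have e2' : (2 : ℚ) ^ n = 2 * 2 ^ k := by rw [hk, pow_succ]; ring
  have hlq : (2 * 2 ^ n : ℚ) < N := by exact_mod_cast hl
  have huq : (N : ℚ) < 5 * 2 ^ (n - 1) := by exact_mod_cast hu
  have h2 : 2 < om r f := by rw [hom, lt_div_iff₀ hpn]; exact hlq
  have h5 : om r f < 5 / 2 := by rw [hom, div_lt_iff₀ hpn, e2']; rw [e1] at huq; linarith
  have hg := MAIN r _ f (dg_RM hf) h2 h5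
  rw [hom, hcard] at hg
  have mm : ∀ c i : ℕ, ¬ Even c → (5 / 2 - N / 2 ^ n : ℚ) = c / 2 ^ i →
      ∃ j, j + 1 ≤ n ∧ N + 2 * c * 2 ^ j = 5 * 2 ^ k ∧ 2 * c * 2 ^ j < 2 ^ k := by
    intro c i hc h
    rw [e1] at hu
    obtain ⟨m, hm⟩ : ∃ m, N + m = 5 * 2 ^ k := ⟨5 * 2 ^ k - N, by omega⟩
    have hmq : (N : ℚ) = 5 * 2 ^ k - m := by
      have : ((N + m : ℕ) : ℚ) = (5 * 2 ^ k : ℕ) := by rw [hm]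
      push_cast at this; linarith
    have hme : Even m := by
      have h3 : Even (N + m) := by
        rw [hm]; exact ((Nat.even_pow.2 ⟨by decide, by omega⟩).mul_left 5)
      exact (Nat.even_add.1 h3).1 hev
    have hmi : m * 2 ^ i = c * 2 ^ n := by
      have : (m : ℚ) * 2 ^ i = c * 2 ^ n := by
        rw [hmq, e2'] at h
        rw [e2']
        field_simp at h
        linarith
      exact_mod_cast this
    obtain ⟨j, hj, hmj⟩ := arith_m hme hc hmi
    exact ⟨j, hj, by rw [← hmj]; exact hm, by rw [← hmj]; omega⟩
  rcases hg with ⟨l, l2, hl4, hl⟩ | ⟨i, hi | hi⟩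
  · left
    have h3 : 2 * l + r ≤ v + 2 := by
      have h4 : 2 ^ (2 * l + r) ≤ 2 ^ (v + 2) := by
        rw [pow_add, pow_mul, pow_add]; norm_num; linarith
      exact (Nat.pow_le_pow_iff_right (by norm_num)).1 h4
    refine ⟨l, l2, by omega, ?_⟩
    have e3 : (2 : ℚ) ^ n = 2 ^ (n - l) * 2 ^ l := by rw [← pow_add]; congr 1; omega
    have : (N : ℚ) = 2 * 2 ^ n + 2 * 2 ^ (n - l) := by
      rw [div_eq_iff hpn.ne'] at hl
      rw [hl, add_mul]
      congr 1
      rw [e3]; field_simp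
    exact_mod_cast this
  · right; left
    obtain ⟨j, -, h3, h4⟩ := mm 1 i (by decide) (by rw [hi]; norm_num)
    rw [e1]
    refine ⟨j, ?_, by omega⟩
    have h6 : 2 ^ (j + 1) < 2 ^ k := by rw [pow_succ]; omega
    have := (Nat.pow_lt_pow_iff_right (by norm_num)).1 h6
    omega
  · right; right
    obtain ⟨j, -, h3, h4⟩ := mm 3 i (by decide) (by rw [hi]; norm_num)
    rw [e1]
    refine ⟨j, ?_, by omega⟩
    have h6 : 2 ^ (j + 2) < 2 ^ k := by rw [pow_add]; omega
    have := (Nat.pow_lt_pow_iff_right (by norm_num)).1 h6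
    omega
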